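/- Let 𝕂 = ℚ(√d) be a real quadratic field of class number one with d > 1 squarefree, d ≡ 3 (mod 4), and fix 𝒞 ∈ ℕ. Let c denote the constant c = (2/π) · ∑_{a=𝒞}^{2𝒞} ∑_{b=𝒞}^{2𝒞} (−1)^{a+b} · binom(𝒞, 2𝒞−a) · binom(𝒞, 2𝒞−b) · ∫_{−∞}^{∞} (a·ϵ^{2y} + b·ϵ^{−2y})^{−1} dy, where ϵ > 1 is the fundamental unit of 𝒪. Then c > 0, and there exists ε₀ > 0 such that ∑_{𝔫∈ℐ} Λ(𝔫)·Ψ(𝔫) = c·N + O(N^{1 − ε₀/log log N}) as N → ∞. -/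

import Mathlib

open NumberField

open scoped Classical

set_option synthInstance.maxHeartbeats 1000000
set_option maxHeartbeats 1000000

/-- The weight `f(x) = (exp(−πx²) − exp(−2πx²))^𝒞`. -/
noncomputable def fwt (C : ℕ) (x : ℝ) : ℝ :=
  (Real.exp (-Real.pi * x^2) - Real.exp (-2 * Real.pi * x^2)) ^ C

/-- The smooth weight `Ψ(𝔫) = ∑_{k ∈ 𝒪, (k) = 𝔫} f(σ₁(k)/√N) f(σ₂(k)/√N)`,
where `σ₁` is the inclusion `K ⊆ ℝ` and `σ₂` the second real embedding. -/
noncomputable def PsiW (K : Subfield ℝ) [NumberField K] (σ₂ : K →+* ℝ) (C : ℕ) (N : ℝ)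
    (n : Ideal (𝓞 K)) : ℝ :=
  ∑' k : 𝓞 K, if Ideal.span {k} = n then
    fwt C (((k : K) : ℝ) / Real.sqrt N) * fwt C (σ₂ (k : K) / Real.sqrt N) else 0

/-- The von Mangoldt function for ideals: `Λ(𝔫) = log 𝒩(𝔭)` if `𝔫 = 𝔭^k` with `𝔭` a
nonzero prime ideal and `k ≥ 1`, and `Λ(𝔫) = 0` otherwise. -/
noncomputable def LambdaIdeal (K : Subfield ℝ) [NumberField K] (n : Ideal (𝓞 K)) : ℝ :=
  if h : ∃ p : Ideal (𝓞 K), (∃ k : ℕ, 1 ≤ k ∧ n = p ^ k) ∧ p.IsPrime ∧ p ≠ ⊥ then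
    Real.log (Ideal.absNorm h.choose) else 0

/-- The constant `(2/π) ∑_{a=𝒞}^{2𝒞} ∑_{b=𝒞}^{2𝒞} (−1)^{a+b} binom(𝒞,2𝒞−a) binom(𝒞,2𝒞−b)
∫_ℝ (a ϵ^{2y} + b ϵ^{−2y})^{−1} dy`, where `E = ϵ` is the fundamental unit. -/
noncomputable def sieveConst (C : ℕ) (E : ℝ) : ℝ :=
  (2 / Real.pi) * ∑ a ∈ Finset.Icc C (2*C), ∑ b ∈ Finset.Icc C (2*C),
    (-1 : ℝ)^(a+b) * (C.choose (2*C - a)) * (C.choose (2*C - b)) *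
      ∫ y : ℝ, ((a : ℝ) * E ^ (2*y) + (b : ℝ) * E ^ (-(2*y)))⁻¹

set_option linter.unusedSectionVars false
set_option linter.unusedVariables false

section
open Complex Metric Set

/-- Borel–Carathéodory for the logarithmic derivative of a zero-free function. -/
lemma bc_logDeriv {f : ℂ → ℂ} {s0 : ℂ} {r r' B : ℝ} (hr : 0 < r') (hrr : r' < r)
    (hf : DifferentiableOn ℂ f (ball s0 r)) (hne : ∀ z ∈ ball s0 r, f z ≠ 0)
    (hB : 0 < B) (hM : ∀ z ∈ ball s0 r, ‖f z‖ ≤ Real.exp B * ‖f s0‖)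
    {z : ℂ} (hz : dist z s0 ≤ r') :
    ‖deriv f z / f z‖ ≤ 8 * B * r / (r - r') ^ 2 := by
  have hr0 : 0 < r := hr.trans hrr
  have hs0 : s0 ∈ ball s0 r := mem_ball_self hr0
  have hd : DifferentiableOn ℂ (fun z => deriv f z / f z) (ball s0 r) :=
    (hf.deriv isOpen_ball).div hf hne
  obtain ⟨g, hg0, hg⟩ := hd.isExactOn_ball.with_val_at s0 0
  have hgd : DifferentiableOn ℂ g (ball s0 r) :=
    fun w hw => (hg w hw).differentiableAt.differentiableWithinAt
  have hexp : ∀ w ∈ ball s0 r, f w = f s0 * Complex.exp (g w) := by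
    have hconst : ∀ w ∈ ball s0 r, f w * Complex.exp (- g w) = f s0 * Complex.exp (- g s0) := by
      intro w hw
      refine (convex_ball s0 r).is_const_of_fderivWithin_eq_zero (𝕜 := ℂ)
        (f := fun w => f w * Complex.exp (- g w)) ?_ ?_ hw hs0
      · exact hf.mul (hgd.neg.cexp)
      · intro x hx
        rw [fderivWithin_of_isOpen isOpen_ball hx]
        have h1 := (hf.differentiableAt (isOpen_ball.mem_nhds hx)).hasDerivAt
        have h2 := h1.mul (hg x hx).neg.cexp
        have h3 : deriv f x * cexp (-g x) + f x * (cexp (-g x) * -(deriv f x / f x)) = 0 := by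
          have := hne x hx
          field_simp
          ring
        have h4 := h2.hasFDerivAt.fderiv
        simp only [Pi.neg_apply] at h4
        rw [h3] at h4
        exact h4.trans (by simp)
    intro w hw
    have := hconst w hw
    rw [hg0, neg_zero, Complex.exp_zero, mul_one, Complex.exp_neg] at this
    rw [← this]
    field_simp
  have hre : ∀ w ∈ ball s0 r, (g w).re ≤ B := by
    intro w hw
    have h1 := hM w hw
    rw [hexp w hw, norm_mul, Complex.norm_exp, mul_comm] at h1
    have h2 : 0 < ‖f s0‖ := norm_pos_iff.mpr (hne s0 hs0)
    have h3 := le_of_mul_le_mul_right h1 h2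
    exact Real.exp_le_exp.mp h3
  -- bound for g
  have hgb : ∀ w ∈ ball s0 r, ‖g w‖ ≤ 2 * B * ‖w - s0‖ / (r - ‖w - s0‖) := by
    intro w hw
    have := Complex.borelCaratheodory_zero (f := fun u => g (u + s0)) (M := B) (R := r)
      (z := w - s0) hB ?_ ?_ hr0 ?_ ?_
    · simpa using this
    · intro u hu
      have hu' : u + s0 ∈ ball s0 r := by simpa [dist_eq_norm] using hu
      exact ((hg _ hu').differentiableAt.comp u (by fun_prop : DifferentiableAt ℂ (fun u => u + s0) u)).differentiableWithinAt
    · intro u hu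
      have hu' : u + s0 ∈ ball s0 r := by simpa [dist_eq_norm] using hu
      exact hre _ hu'
    · simpa [dist_eq_norm] using hw
    · simpa using hg0
  set q := (r - r') / 2 with hq
  have hq0 : 0 < q := by rw [hq]; linarith
  have hsub : closedBall z q ⊆ ball s0 r := by
    intro w hw
    have h1 : dist w z ≤ q := hw
    have := dist_triangle w z s0
    simp only [mem_ball]; linarith
  have hzm : z ∈ ball s0 r := hsub (mem_closedBall_self hq0.le)
  have hder : deriv g z = deriv f z / f z := (hg z hzm).deriv
  rw [← hder]
  have hcs : ∀ w ∈ sphere z q, ‖g w‖ ≤ 2 * B * r / q := by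
    intro w hw
    have hw' : w ∈ ball s0 r := hsub (sphere_subset_closedBall hw)
    have h1 : dist w z = q := hw
    have h2 := dist_triangle w z s0
    have h3 : ‖w - s0‖ ≤ r - q := by rw [← dist_eq_norm]; linarith
    refine (hgb w hw').trans ?_
    gcongr
    · linarith
    · linarith
  have := norm_deriv_le_of_forall_mem_sphere_norm_le hq0
    ((hgd.mono hsub).diffContOnCl_ball Subset.rfl) hcs
  refine this.trans (le_of_eq ?_)
  rw [hq]
  have : r - r' ≠ 0 := by linarith
  field_simp
  ring

/-- Blaschke induction: lower bound for the real part of the log-derivative at the center, when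
all zeros lie to the left of the center. -/
lemma blaschke_step {f : ℂ → ℂ} {s0 ρ : ℂ} {R M : ℝ} {U : Set ℂ} (hU : IsOpen U)
    (hR : 0 < R) (hUR : closedBall s0 R ⊆ U) (hf : DifferentiableOn ℂ f U)
    (hM : ∀ z ∈ closedBall s0 R, ‖f z‖ ≤ M) (h0 : f s0 ≠ 0)
    (hρ : f ρ = 0) (hρd : dist ρ s0 < R) :
    ∃ g : ℂ → ℂ, DifferentiableOn ℂ g U ∧ (∀ z ∈ closedBall s0 R, ‖g z‖ ≤ M) ∧
      ‖g s0‖ = ‖f s0‖ * (R / ‖s0 - ρ‖) ∧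
      (∀ z ∈ closedBall s0 R, g z = 0 → f z = 0) ∧
      (deriv g s0 / g s0).re = (deriv f s0 / f s0).re
        - (s0 - ρ).re * (1 / ‖s0 - ρ‖ ^ 2 - 1 / R ^ 2) := by
  have hρU : ρ ∈ U := hUR (by simpa using hρd.le)
  have hne : s0 - ρ ≠ 0 := by
    intro h; rw [sub_eq_zero] at h; rw [h] at h0; exact h0 hρ
  have hnρ : 0 < ‖s0 - ρ‖ := norm_pos_iff.mpr hne
  set p : ℂ := s0 - ρ with hp
  let b : ℂ → ℂ := fun z => (R ^ 2 + (starRingEnd ℂ) p * (z - s0)) / R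
  let g : ℂ → ℂ := fun z => dslope f ρ z * b z
  have hRc : (R : ℂ) ≠ 0 := by exact_mod_cast hR.ne'
  have hbd : Differentiable ℂ b := by fun_prop
  have hds : DifferentiableOn ℂ (dslope f ρ) U :=
    (differentiableOn_dslope (hU.mem_nhds hρU)).mpr hf
  have hgd : DifferentiableOn ℂ g U := hds.mul hbd.differentiableOn
  have hgv : ∀ z, z ≠ ρ → g z = f z * b z / (z - ρ) := by
    intro z hz
    simp only [g, dslope_of_ne _ hz, slope, hρ, vsub_eq_sub, sub_zero, smul_eq_mul]
    field_simp
  have hs0ρ : s0 ≠ ρ := sub_ne_zero.mp hne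
  have hbs : b s0 = R := by
    simp only [b, sub_self, mul_zero, add_zero]; field_simp
  have hbb : ∀ z ∈ closedBall s0 R, b z ≠ 0 := by
    intro z hz hb
    have h1 : (R : ℂ) ^ 2 + (starRingEnd ℂ) p * (z - s0) = 0 := by
      simpa [b, hRc] using hb
    have h2 : (starRingEnd ℂ) p * (z - s0) = - (R : ℂ) ^ 2 := by linear_combination h1
    have h3 := congrArg norm h2
    rw [norm_mul, norm_neg, norm_pow, RCLike.norm_conj, Complex.norm_real, Real.norm_eq_abs,
      abs_of_pos hR] at h3
    have h4 : ‖z - s0‖ ≤ R := by simpa [dist_eq_norm] using hz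
    have h5 : ‖p‖ < R := by rw [hp, ← dist_eq_norm, dist_comm]; exact hρd
    nlinarith [norm_nonneg (z - s0)]
  refine ⟨g, hgd, ?_, ?_, ?_, ?_⟩
  · intro z hz
    have hcl : closure (ball s0 R) = closedBall s0 R := closure_ball s0 hR.ne'
    refine norm_le_of_forall_mem_frontier_norm_le isBounded_ball
      ((hgd.mono hUR).diffContOnCl_ball Subset.rfl) ?_ (hcl ▸ hz)
    intro w hw
    rw [frontier_ball s0 hR.ne'] at hw
    have hwR : ‖w - s0‖ = R := by simpa [dist_eq_norm] using hw
    have hwρ : w ≠ ρ := by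
      rintro rfl
      rw [dist_eq_norm] at hρd; linarith
    have hb : ‖b w‖ = ‖w - ρ‖ := by
      have h1 : b w * R = (w - s0) * (starRingEnd ℂ) (w - ρ) := by
        have h2 : (w - s0) * (starRingEnd ℂ) (w - s0) = (R : ℂ) ^ 2 := by
          rw [Complex.mul_conj, Complex.normSq_eq_norm_sq, hwR]; push_cast; rfl
        have h3 : w - ρ = (w - s0) + p := by rw [hp]; ring
        rw [h3, map_add, mul_add, h2]
        simp only [b]
        field_simp
      have h2 := congrArg norm h1
      rw [norm_mul, norm_mul, RCLike.norm_conj, hwR, Complex.norm_real, Real.norm_eq_abs,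
        abs_of_pos hR] at h2
      have := hR.ne'
      rw [mul_comm] at h2
      exact mul_left_cancel₀ this h2
    rw [hgv w hwρ, norm_div, norm_mul, hb]
    have : ‖w - ρ‖ ≠ 0 := norm_ne_zero_iff.mpr (sub_ne_zero.mpr hwρ)
    rw [mul_div_assoc, div_self this, mul_one]
    exact hM w (sphere_subset_closedBall hw)
  · rw [hgv s0 hs0ρ, norm_div, norm_mul, hbs, Complex.norm_real, Real.norm_eq_abs, abs_of_pos hR]
    ring
  · intro z hz hgz
    by_cases h : z = ρ
    · rw [h, hρ]
    · rw [hgv z h] at hgz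
      have h1 : z - ρ ≠ 0 := sub_ne_zero.mpr h
      have := hbb z hz
      simpa [h1, this] using hgz
  · have hfd : HasDerivAt f (deriv f s0) s0 :=
      (hf.differentiableAt (hU.mem_nhds (hUR (mem_closedBall_self hR.le)))).hasDerivAt
    have hbder : HasDerivAt b ((starRingEnd ℂ) p / R) s0 := by
      have h := (((hasDerivAt_id s0).sub_const s0).const_mul ((starRingEnd ℂ) p)).const_add
        ((R : ℂ) ^ 2) |>.div_const (R : ℂ)
      simpa [b] using h
    have h1 := (hfd.mul hbder).div ((hasDerivAt_id s0).sub_const ρ) hne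
    have h2 : HasDerivAt g _ s0 := h1.congr_of_eventuallyEq (by
      filter_upwards [isOpen_ne.mem_nhds hs0ρ] with z hz
      rw [hgv z hz]; rfl)
    rw [h2.deriv, hgv s0 hs0ρ]
    simp only [id, Pi.mul_apply, hbs]
    have h3 : (((deriv f s0 * ↑R + f s0 * ((starRingEnd ℂ) p / ↑R)) * (s0 - ρ) - f s0 * ↑R * 1) /
        (s0 - ρ) ^ 2 / (f s0 * ↑R / (s0 - ρ))) =
        deriv f s0 / f s0 - (1 / p - (starRingEnd ℂ) p / R ^ 2) := by
      rw [← hp]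
      field_simp
      ring
    rw [h3, Complex.sub_re]
    congr 1
    rw [Complex.sub_re, one_div, Complex.inv_re, Complex.normSq_eq_norm_sq]
    have : ((starRingEnd ℂ) p / (R : ℂ) ^ 2).re = p.re / R ^ 2 := by
      rw [← Complex.ofReal_pow, Complex.div_ofReal_re, Complex.conj_re]
    rw [this]
    ring

lemma blaschke_bound {s0 : ℂ} {R M : ℝ} {U : Set ℂ} (hU : IsOpen U)
    (hR : 0 < R) (hUR : closedBall s0 R ⊆ U) (hMp : 0 < M) (n : ℕ) :
    ∀ f : ℂ → ℂ, DifferentiableOn ℂ f U →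
    (∀ z ∈ closedBall s0 R, ‖f z‖ ≤ M) → M / 2 ^ n ≤ ‖f s0‖ →
    (∀ z ∈ closedBall s0 R, f z = 0 → z.re ≤ s0.re) →
    ∀ B : ℝ, 0 < B → M ≤ Real.exp B * ‖f s0‖ →
    - (deriv f s0 / f s0).re ≤ 64 * B / R := by
  induction n with
  | zero =>
    intro f hf hM h0 hz B hB hBM
    have h0' : f s0 ≠ 0 := by
      intro h; rw [h] at h0; simp at h0; linarith
    by_cases hzero : ∃ ρ, f ρ = 0 ∧ dist ρ s0 ≤ R / 2
    · exfalso
      obtain ⟨ρ, hρ, hρd⟩ := hzero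
      obtain ⟨g, -, hg2, hg3, -⟩ := blaschke_step hU hR hUR hf hM h0' hρ (by linarith)
      have h1 := hg2 s0 (mem_closedBall_self hR.le)
      rw [hg3] at h1
      have h2 : s0 - ρ ≠ 0 := by
        intro h; rw [sub_eq_zero] at h; rw [h] at h0'; exact h0' hρ
      have h3 : 0 < ‖s0 - ρ‖ := norm_pos_iff.mpr h2
      rw [dist_comm, dist_eq_norm] at hρd
      have h4 : 2 ≤ R / ‖s0 - ρ‖ := by rw [le_div_iff₀ h3]; linarith
      simp at h0
      nlinarith
    · push Not at hzero
      have := bc_logDeriv (f := f) (s0 := s0) (r := R / 2) (r' := R / 4) (B := B) (z := s0)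
        (by linarith) (by linarith)
        (hf.mono ((ball_subset_closedBall).trans ((closedBall_subset_closedBall (by linarith)).trans hUR)))
        (fun z hz h => by have := hzero z h; have := mem_ball.mp hz; linarith) hB
        (fun z hz => (hM z (closedBall_subset_closedBall (by linarith) (ball_subset_closedBall hz))).trans hBM) (by simp; linarith)
      have h2 := (neg_le_abs _).trans ((Complex.abs_re_le_norm _).trans this)
      refine h2.trans (le_of_eq ?_)
      field_simp
      ring
  | succ n ih =>
    intro f hf hM h0 hz B hB hBM
    have h0' : f s0 ≠ 0 := by
      intro h; rw [h] at h0; simp at h0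
      have : 0 < M / 2 ^ (n+1) := by positivity
      linarith
    by_cases hzero : ∃ ρ, f ρ = 0 ∧ dist ρ s0 ≤ R / 2
    · obtain ⟨ρ, hρ, hρd⟩ := hzero
      obtain ⟨g, hg1, hg2, hg3, hg4, hg5⟩ := blaschke_step hU hR hUR hf hM h0' hρ (by linarith)
      have h2 : s0 - ρ ≠ 0 := by
        intro h; rw [sub_eq_zero] at h; rw [h] at h0'; exact h0' hρ
      have h3 : 0 < ‖s0 - ρ‖ := norm_pos_iff.mpr h2
      have hρd' := hρd
      rw [dist_comm, dist_eq_norm] at hρd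
      have h4 : 2 ≤ R / ‖s0 - ρ‖ := by rw [le_div_iff₀ h3]; linarith
      have h5 : 2 * ‖f s0‖ ≤ ‖g s0‖ := by rw [hg3]; nlinarith [norm_nonneg (f s0)]
      have h6 := ih g hg1 hg2 (by
        rw [pow_succ] at h0
        have : M / 2 ^ n = 2 * (M / (2 ^ n * 2)) := by field_simp
        linarith) (fun z hz' h => hz z hz' (hg4 z hz' h)) B hB
        (hBM.trans (by gcongr; linarith [norm_nonneg (f s0)]))
      rw [hg5] at h6
      have h7 : 0 ≤ (s0 - ρ).re := by
        have := hz ρ (by rw [mem_closedBall]; linarith) hρ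
        simp; linarith
      have h8 : 0 ≤ 1 / ‖s0 - ρ‖ ^ 2 - 1 / R ^ 2 := by
        have : 1 / R ^ 2 ≤ 1 / ‖s0 - ρ‖ ^ 2 := by
          apply one_div_le_one_div_of_le (by positivity)
          gcongr; linarith
        linarith
      nlinarith [mul_nonneg h7 h8]
    · push Not at hzero
      have := bc_logDeriv (f := f) (s0 := s0) (r := R / 2) (r' := R / 4) (B := B) (z := s0)
        (by linarith) (by linarith)
        (hf.mono ((ball_subset_closedBall).trans ((closedBall_subset_closedBall (by linarith)).trans hUR)))
        (fun z hz h => by have := hzero z h; have := mem_ball.mp hz; linarith) hB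
        (fun z hz => (hM z (closedBall_subset_closedBall (by linarith) (ball_subset_closedBall hz))).trans hBM) (by simp; linarith)
      have h2 := (neg_le_abs _).trans ((Complex.abs_re_le_norm _).trans this)
      refine h2.trans (le_of_eq ?_)
      field_simp
      ring

/-- Landau's inequality without a distinguished zero. -/
lemma landau_ineq {f : ℂ → ℂ} {s0 : ℂ} {R B : ℝ} {U : Set ℂ} (hU : IsOpen U)
    (hR : 0 < R) (hUR : closedBall s0 R ⊆ U) (hf : DifferentiableOn ℂ f U) (h0 : f s0 ≠ 0)
    (hB : 0 < B) (hM : ∀ z ∈ closedBall s0 R, ‖f z‖ ≤ Real.exp B * ‖f s0‖)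
    (hz : ∀ z ∈ closedBall s0 R, f z = 0 → z.re ≤ s0.re) :
    - (deriv f s0 / f s0).re ≤ 64 * B / R := by
  have hp : 0 < ‖f s0‖ := norm_pos_iff.mpr h0
  have hMp : 0 < Real.exp B * ‖f s0‖ := by positivity
  obtain ⟨n, hn⟩ := pow_unbounded_of_one_lt (Real.exp B) (one_lt_two)
  refine blaschke_bound hU hR hUR hMp n f hf hM ?_ hz B hB le_rfl
  rw [div_le_iff₀ (by positivity)]
  nlinarith

/-- Landau's inequality with a distinguished zero. -/
lemma landau_ineq_zero {f : ℂ → ℂ} {s0 ρ : ℂ} {R B : ℝ} {U : Set ℂ} (hU : IsOpen U)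
    (hR : 0 < R) (hUR : closedBall s0 R ⊆ U) (hf : DifferentiableOn ℂ f U) (h0 : f s0 ≠ 0)
    (hB : 0 < B) (hM : ∀ z ∈ closedBall s0 R, ‖f z‖ ≤ Real.exp B * ‖f s0‖)
    (hz : ∀ z ∈ closedBall s0 R, f z = 0 → z.re ≤ s0.re)
    (hρ : f ρ = 0) (hρd : dist ρ s0 < R) :
    - (deriv f s0 / f s0).re ≤ 64 * B / R
       - (s0 - ρ).re * (1 / ‖s0 - ρ‖ ^ 2 - 1 / R ^ 2) := by
  obtain ⟨g, hg1, hg2, hg3, hg4, hg5⟩ := blaschke_step hU hR hUR hf hM h0 hρ hρd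
  have h2 : s0 - ρ ≠ 0 := by
    intro h; rw [sub_eq_zero] at h; rw [h] at h0; exact h0 hρ
  have h3 : 0 < ‖s0 - ρ‖ := norm_pos_iff.mpr h2
  rw [dist_comm, dist_eq_norm] at hρd
  have h4 : 1 ≤ R / ‖s0 - ρ‖ := by rw [le_div_iff₀ h3]; linarith
  have h5 : ‖f s0‖ ≤ ‖g s0‖ := by rw [hg3]; nlinarith [norm_nonneg (f s0)]
  have hp : 0 < ‖f s0‖ := norm_pos_iff.mpr h0
  have := landau_ineq hU hR hUR hg1 (norm_pos_iff.mp (hp.trans_le h5)) hB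
    (fun z hz => (hg2 z hz).trans (by gcongr)) (fun z hz' h => hz z hz' (hg4 z hz' h))
  rw [hg5] at this
  linarith
end

section
open Complex Metric Set

/-- Dirichlet series attached to the data. -/
noncomputable def Dser {ι : Type} (X y Lam : ι → ℝ) (m : ℤ) (s : ℂ) : ℂ :=
  ∑' i, (Lam i : ℂ) * cexp (2 * Real.pi * I * m * y i) * (X i : ℂ) ^ (-s)

/-- Abstract package of analytic facts about Hecke `L`-functions. -/
structure HeckeData (ι : Type) where
  X : ι → ℝ
  y : ι → ℝ
  Lam : ι → ℝ
  hX : ∀ i, 1 ≤ X i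
  hLam : ∀ i, 0 ≤ Lam i
  hsum : ∀ σ : ℝ, 1 < σ → Summable fun i => Lam i * X i ^ (-σ)
  Z : ℤ → ℂ → ℂ
  hZd : ∀ m, DifferentiableOn ℂ (Z m) {s | 1 / 2 < s.re}
  A : ℝ
  B : ℝ
  hA : 0 ≤ A
  hB : 0 < B
  hZb : ∀ m s, 3 / 4 ≤ s.re → s.re ≤ 4 → ‖Z m s‖ ≤ B * (2 + |s.im| + |(m : ℝ)|) ^ A
  hZeq : ∀ m s, 1 < s.re →
    deriv (Z m) s = (- Dser X y Lam m s + if m = 0 then 1 / (s - 1) else 0) * Z m s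
  c0 : ℝ
  hc0 : 0 < c0
  hZlow : ∀ m s, 1 < s.re → s.re ≤ 3 → c0 * (s.re - 1) ^ 2 ≤ ‖Z m s‖
  hZ0 : Z 0 1 ≠ 0

namespace HeckeData
variable {ι : Type} (H : HeckeData ι)

lemma norm_term (m : ℤ) (s : ℂ) (i : ι) :
    ‖(H.Lam i : ℂ) * cexp (2 * Real.pi * I * m * H.y i) * (H.X i : ℂ) ^ (-s)‖
      = H.Lam i * H.X i ^ (-s.re) := by
  have hX : 0 < H.X i := by linarith [H.hX i]
  rw [norm_mul, norm_mul, Complex.norm_real, Real.norm_eq_abs, abs_of_nonneg (H.hLam i),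
    Complex.norm_cpow_eq_rpow_re_of_pos hX]
  have : (2 * Real.pi * I * m * H.y i : ℂ) = ((2 * Real.pi * m * H.y i : ℝ) : ℂ) * I := by
    push_cast; ring
  rw [this, Complex.norm_exp_ofReal_mul_I]
  simp

lemma summable_term (m : ℤ) {s : ℂ} (hs : 1 < s.re) :
    Summable fun i => (H.Lam i : ℂ) * cexp (2 * Real.pi * I * m * H.y i) * (H.X i : ℂ) ^ (-s) := by
  apply Summable.of_norm
  simp_rw [H.norm_term]
  exact H.hsum _ hs

lemma norm_D_le (m : ℤ) {s : ℂ} (hs : 1 < s.re) :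
    ‖Dser H.X H.y H.Lam m s‖ ≤ ∑' i, H.Lam i * H.X i ^ (-s.re) := by
  have h := norm_tsum_le_tsum_norm (f := fun i => (H.Lam i : ℂ) * cexp (2 * Real.pi * I * m * H.y i) * (H.X i : ℂ) ^ (-s))
    (by simp_rw [H.norm_term]; exact H.hsum _ hs)
  simp_rw [H.norm_term] at h
  exact h

lemma re_term (m : ℤ) (σ t : ℝ) (i : ι) :
    ((H.Lam i : ℂ) * cexp (2 * Real.pi * I * m * H.y i) * (H.X i : ℂ) ^ (-(σ + t * I : ℂ))).re
      = H.Lam i * H.X i ^ (-σ) * Real.cos (2 * Real.pi * m * H.y i - t * Real.log (H.X i)) := by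
  have hX : 0 < H.X i := by linarith [H.hX i]
  have hX' : (H.X i : ℂ) ≠ 0 := by exact_mod_cast hX.ne'
  rw [Complex.cpow_def_of_ne_zero hX', ← Complex.ofReal_log hX.le, mul_assoc, ← Complex.exp_add]
  have h1 : (2 * Real.pi * I * m * H.y i + (Real.log (H.X i) : ℂ) * -(σ + t * I) : ℂ)
    = ((-σ * Real.log (H.X i) : ℝ) : ℂ) +
      ((2 * Real.pi * m * H.y i - t * Real.log (H.X i) : ℝ) : ℂ) * I := by push_cast; ring
  rw [h1, Complex.re_ofReal_mul, Complex.exp_re, Real.rpow_def_of_pos hX]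
  simp only [add_re, ofReal_re, mul_re, I_re, mul_zero, ofReal_im, I_im, mul_one, sub_self,
    add_zero, add_im, mul_im, zero_add]
  rw [mul_comm (-σ)]; ring

lemma re_D (m : ℤ) {σ : ℝ} (hσ : 1 < σ) (t : ℝ) :
    (Dser H.X H.y H.Lam m (σ + t * I)).re = ∑' i, H.Lam i * H.X i ^ (-σ) *
      Real.cos (2 * Real.pi * m * H.y i - t * Real.log (H.X i)) := by
  rw [Dser, Complex.re_tsum (H.summable_term m (by simpa using hσ))]
  simp_rw [H.re_term]

lemma summable_re (m : ℤ) {σ : ℝ} (hσ : 1 < σ) (t : ℝ) :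
    Summable fun i => H.Lam i * H.X i ^ (-σ) *
      Real.cos (2 * Real.pi * m * H.y i - t * Real.log (H.X i)) := by
  have h := (Complex.hasSum_re (H.summable_term m (s := σ + t * I) (by simpa using hσ)).hasSum).summable
  simp_rw [H.re_term] at h
  exact h

lemma re_D_zero {σ : ℝ} (hσ : 1 < σ) :
    (Dser H.X H.y H.Lam 0 σ).re = ∑' i, H.Lam i * H.X i ^ (-σ) := by
  have := H.re_D 0 hσ 0
  simpa using this

lemma three_four_one (m : ℤ) {σ : ℝ} (hσ : 1 < σ) (t : ℝ) :
    0 ≤ 3 * (Dser H.X H.y H.Lam 0 σ).re + 4 * (Dser H.X H.y H.Lam m (σ + t * I)).re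
      + (Dser H.X H.y H.Lam (2 * m) (σ + (2 * t : ℝ) * I)).re := by
  rw [H.re_D_zero hσ, H.re_D m hσ, H.re_D (2 * m) hσ, ← tsum_mul_left, ← tsum_mul_left,
    ← ((H.hsum σ hσ).mul_left 3).tsum_add ((H.summable_re m hσ t).mul_left 4),
    ← (((H.hsum σ hσ).mul_left 3).add ((H.summable_re m hσ t).mul_left 4)).tsum_add
      (H.summable_re (2 * m) hσ (2 * t))]
  apply tsum_nonneg
  intro i
  have hX : 0 < H.X i := by linarith [H.hX i]
  set θ := 2 * Real.pi * m * H.y i - t * Real.log (H.X i) with hθ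
  have h2 : 2 * Real.pi * ((2 * m : ℤ) : ℝ) * H.y i - 2 * t * Real.log (H.X i) = 2 * θ := by
    rw [hθ]; push_cast; ring
  rw [h2, Real.cos_two_mul]
  have h3 : 0 ≤ H.Lam i * H.X i ^ (-σ) := mul_nonneg (H.hLam i) (by positivity)
  nlinarith [mul_nonneg h3 (sq_nonneg (1 + Real.cos θ))]

lemma isOpen_U : IsOpen {s : ℂ | 1 / 2 < s.re} := isOpen_lt continuous_const continuous_re

lemma Z_ne (m : ℤ) {s : ℂ} (h1 : 1 < s.re) (h3 : s.re ≤ 3) : H.Z m s ≠ 0 := by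
  have h := H.hZlow m s h1 h3
  have : 0 < H.c0 * (s.re - 1) ^ 2 := mul_pos H.hc0 (pow_pos (by linarith) 2)
  intro h0; rw [h0, norm_zero] at h; linarith

lemma D_eq (m : ℤ) {s : ℂ} (h1 : 1 < s.re) (h3 : s.re ≤ 3) :
    Dser H.X H.y H.Lam m s = - (deriv (H.Z m) s / H.Z m s) + if m = 0 then 1 / (s - 1) else 0 := by
  rw [H.hZeq m s h1, mul_div_assoc, div_self (H.Z_ne m h1 h3)]; ring

/-- near the pole. -/
lemma near_one : ∃ r0 : ℝ, 0 < r0 ∧ r0 < 1 / 8 ∧ ∀ s : ℂ, ‖s - 1‖ < 2 * r0 → H.Z 0 s ≠ 0 := by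
  have hc : ContinuousAt (H.Z 0) 1 :=
    ((H.hZd 0).differentiableAt (isOpen_U.mem_nhds (by norm_num))).continuousAt
  have h := hc.eventually_ne H.hZ0
  obtain ⟨e, he, h⟩ := Metric.eventually_nhds_iff.mp h
  refine ⟨min (e / 2) (1 / 16), by positivity, ?_, ?_⟩
  · exact (min_le_right _ _).trans_lt (by norm_num)
  · intro s hs
    apply h
    rw [dist_eq_norm]
    have := min_le_left (e / 2) (1 / 16)
    linarith

lemma D_zero_bound : ∃ C0 : ℝ, 0 ≤ C0 ∧ ∀ σ : ℝ, 1 < σ → σ ≤ 3 →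
    ∑' i, H.Lam i * H.X i ^ (-σ) ≤ 1 / (σ - 1) + C0 := by
  have hcont : ContinuousOn (fun σ : ℝ => deriv (H.Z 0) (σ : ℂ) / H.Z 0 (σ : ℂ)) (Icc 1 3) := by
    have hm : MapsTo (fun σ : ℝ => (σ : ℂ)) (Icc 1 3) {s : ℂ | 1 / 2 < s.re} := by
      intro σ hσ; simp only [mem_ofPred_eq, ofReal_re]; linarith [hσ.1]
    refine ContinuousOn.div ?_ ?_ ?_
    · exact ((H.hZd 0).deriv isOpen_U).continuousOn.comp Complex.continuous_ofReal.continuousOn hm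
    · exact (H.hZd 0).continuousOn.comp Complex.continuous_ofReal.continuousOn hm
    · intro σ hσ
      rcases eq_or_lt_of_le hσ.1 with h | h
      · rw [← h]; simpa using H.hZ0
      · exact H.Z_ne 0 (by simpa using h) (by simpa using hσ.2)
  obtain ⟨C, hC⟩ := isCompact_Icc.exists_bound_of_continuousOn hcont
  refine ⟨max C 0, le_max_right _ _, ?_⟩
  intro σ h1 h3
  rw [← H.re_D_zero h1, H.D_eq 0 (by simpa using h1) (by simpa using h3)]
  have h := hC σ ⟨h1.le, h3⟩
  simp only [if_true, add_re, neg_re]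
  have h4 : ((1 : ℂ) / ((σ : ℂ) - 1)).re = 1 / (σ - 1) := by
    have : (1 : ℂ) / ((σ : ℂ) - 1) = ((1 / (σ - 1) : ℝ) : ℂ) := by push_cast; rfl
    rw [this, ofReal_re]
  rw [h4]
  have h5 := (neg_le_abs _).trans ((Complex.abs_re_le_norm _).trans h)
  linarith [le_max_left C 0]

lemma eventually_growth (κ : ℝ) (hκ : 0 < κ) : ∀ᶠ T : ℝ in Filter.atTop,
    H.B * (8 * T) ^ H.A ≤ Real.exp ((H.A + 1) * Real.log T) * (H.c0 * (κ / Real.log T) ^ 2) := by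
  have h1 : (fun T : ℝ => (Real.log T) ^ 2) =o[Filter.atTop] (fun T : ℝ => T) := by
    have := isLittleO_log_rpow_rpow_atTop (s := 1) 2 (by norm_num)
    simpa using this
  have hpos : 0 < H.c0 * κ ^ 2 / (H.B * 8 ^ H.A) :=
    div_pos (mul_pos H.hc0 (by positivity)) (mul_pos H.hB (by positivity))
  have h2 := h1.bound hpos
  filter_upwards [h2, Filter.eventually_gt_atTop (1 : ℝ)] with T h3 hT
  have hT0 : 0 < T := by linarith
  have hlog : 0 < Real.log T := Real.log_pos hT
  rw [Real.norm_eq_abs, abs_of_nonneg (by positivity), Real.norm_eq_abs, abs_of_pos hT0,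
    div_mul_eq_mul_div, le_div_iff₀ (mul_pos H.hB (by positivity))] at h3
  have h4 : Real.exp ((H.A + 1) * Real.log T) = T ^ H.A * T := by
    rw [mul_comm, ← Real.rpow_def_of_pos hT0, Real.rpow_add hT0, Real.rpow_one]
  rw [h4, Real.mul_rpow (by norm_num) hT0.le, div_pow]
  have h5 : T ^ H.A * T * (H.c0 * (κ ^ 2 / Real.log T ^ 2)) =
    T ^ H.A * (H.c0 * κ ^ 2 * T) / Real.log T ^ 2 := by ring
  rw [h5, le_div_iff₀ (by positivity)]
  have : 0 < T ^ H.A := by positivity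
  nlinarith

/-- `Z` in a ball is bounded relative to the value at the center. -/
lemma ball_bound {T κ : ℝ} (hT : 1 < T)
    (hg : H.B * (8 * T) ^ H.A ≤ Real.exp ((H.A + 1) * Real.log T) * (H.c0 * (κ / Real.log T) ^ 2))
    (hκ : 0 < κ) (hκT : κ / Real.log T ≤ 1) {m : ℤ} (hm : |(m : ℝ)| ≤ 2 * T) {t : ℝ}
    (ht : |t| ≤ 2 * T) : ∀ z ∈ closedBall ((1 + κ / Real.log T : ℝ) + t * I : ℂ) (1 / 4),
      ‖H.Z m z‖ ≤ Real.exp ((H.A + 1) * Real.log T) * ‖H.Z m ((1 + κ / Real.log T : ℝ) + t * I : ℂ)‖ := by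
  intro z hz
  have hlog : 0 < Real.log T := Real.log_pos hT
  have hη : 0 < κ / Real.log T := by positivity
  set η := κ / Real.log T with hηd
  set s0 : ℂ := ((1 + η : ℝ) + t * I : ℂ) with hs0
  have hre : s0.re = 1 + η := by simp [hs0]
  have him : s0.im = t := by simp [hs0]
  have h1 : ‖z - s0‖ ≤ 1 / 4 := by simpa [dist_eq_norm] using hz
  have h2 := (Complex.abs_re_le_norm (z - s0)).trans h1
  have h3 := (Complex.abs_im_le_norm (z - s0)).trans h1
  rw [sub_re, hre, abs_le] at h2
  rw [sub_im, him, abs_le] at h3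
  have h4 := H.hZb m z (by linarith) (by linarith)
  have h5 := H.hZlow m s0 (by rw [hre]; linarith) (by rw [hre]; linarith)
  rw [hre] at h5
  have hzi : |z.im| ≤ 2 * T + 1 := by
    rw [abs_le] at ht ⊢; constructor <;> linarith [ht.1, ht.2]
  calc ‖H.Z m z‖ ≤ H.B * (2 + |z.im| + |(m : ℝ)|) ^ H.A := h4
    _ ≤ H.B * (8 * T) ^ H.A := by
      have := H.hB; have := H.hA
      gcongr; linarith
    _ ≤ _ := hg
    _ ≤ _ := by
      gcongr; simpa using h5

lemma closedBall_sub_U {η t : ℝ} (hη : 0 < η) :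
    closedBall ((1 + η : ℝ) + t * I : ℂ) (1 / 4) ⊆ {s : ℂ | 1 / 2 < s.re} := by
  intro z hz
  have h1 : ‖z - ((1 + η : ℝ) + t * I : ℂ)‖ ≤ 1 / 4 := by simpa [dist_eq_norm] using hz
  have h2 := (Complex.abs_re_le_norm _).trans h1
  rw [sub_re, abs_le] at h2
  simp at h2
  simp only [mem_ofPred_eq]; linarith [h2.1]

lemma zero_re_le_one (m : ℤ) {z : ℂ} (h : H.Z m z = 0) (h3 : z.re ≤ 3) : z.re ≤ 1 := by
  by_contra hc
  exact H.Z_ne m (not_le.mp hc) h3 h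

set_option maxHeartbeats 2000000 in
lemma zero_free : ∃ c T0 : ℝ, 0 < c ∧ Real.exp 1 ≤ T0 ∧ ∀ T, T0 ≤ T → ∀ m : ℤ, |(m : ℝ)| ≤ T →
    ∀ s : ℂ, |s.im| ≤ T → 1 - c / Real.log T < s.re → s.re ≤ 3 → H.Z m s ≠ 0 := by
  obtain ⟨r0, hr0, hr08, hnear⟩ := H.near_one
  obtain ⟨C0, hC0, hD0⟩ := H.D_zero_bound
  have hA := H.hA
  set C5 : ℝ := 256 * (H.A + 1) with hC5
  set C6 : ℝ := 5 * C5 + 3 * C0 + 16 + 5 / r0 with hC6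
  have hC6p : 16 ≤ C6 := by
    have : 0 < 5 / r0 := by positivity
    have : 0 ≤ C5 := by rw [hC5]; positivity
    rw [hC6]; linarith
  set κ : ℝ := 1 / (2 * C6) with hκ
  have hκp : 0 < κ := by rw [hκ]; positivity
  have hκ1 : κ ≤ 1 / 32 := by
    rw [hκ]; apply one_div_le_one_div_of_le (by norm_num); linarith
  obtain ⟨T1, hT1⟩ := Filter.eventually_atTop.mp (H.eventually_growth κ hκp)
  -- need log T large for c/log T ≤ r0
  set c : ℝ := min (1 / (14 * C6)) r0 with hc
  have hcp : 0 < c := lt_min (by positivity) hr0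
  refine ⟨c, max T1 (Real.exp 1), hcp, le_max_right _ _, ?_⟩
  intro T hT m hm ρ him hre hre3 hzero
  have hTe : Real.exp 1 ≤ T := (le_max_right _ _).trans hT
  have hT1' : 1 < T := by
    have := Real.add_one_le_exp (1 : ℝ); linarith
  have hlog : 1 ≤ Real.log T := by
    rw [← Real.log_exp 1]; exact Real.log_le_log (Real.exp_pos _) hTe
  have hg := hT1 T ((le_max_left _ _).trans hT)
  set L := Real.log T with hL
  have hη1 : κ / L ≤ 1 / 32 := (div_le_self hκp.le hlog).trans hκ1
  have hη0 : 0 < κ / L := by positivity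
  have hcL : c / L ≤ r0 := (div_le_self hcp.le hlog).trans (min_le_right _ _)
  have hρ1 : ρ.re ≤ 1 := H.zero_re_le_one m hzero hre3
  set η := κ / L with hη
  set t := ρ.im with ht
  set s0 : ℂ := ((1 + η : ℝ) + t * I : ℂ) with hs0
  have hs0re : s0.re = 1 + η := by simp [hs0]
  have hs0im : s0.im = t := by simp [hs0]
  have key : ∀ (m' : ℤ) (t' : ℝ), |(m' : ℝ)| ≤ 2 * T → |t'| ≤ 2 * T →
      - (deriv (H.Z m') ((1 + η : ℝ) + t' * I : ℂ) / H.Z m' ((1 + η : ℝ) + t' * I : ℂ)).re ≤ C5 * L := by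
    intro m' t' hm' ht'
    have := landau_ineq (f := H.Z m') (s0 := ((1 + η : ℝ) + t' * I : ℂ)) (R := 1 / 4)
      (B := (H.A + 1) * L) isOpen_U (by norm_num) (closedBall_sub_U hη0) (H.hZd m')
      (H.Z_ne m' (by simp; linarith) (by simp; linarith)) (by positivity)
      (H.ball_bound hT1' hg hκp (by linarith) hm' ht')
      (by
        intro z hz h0
        have h1 : ‖z - ((1 + η : ℝ) + t' * I : ℂ)‖ ≤ 1 / 4 := by simpa [dist_eq_norm] using hz
        have h2 := (Complex.abs_re_le_norm _).trans h1
        rw [sub_re, abs_le] at h2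
        simp at h2
        have := H.zero_re_le_one m' h0 (by linarith)
        simp; linarith)
    refine this.trans (le_of_eq ?_)
    rw [hC5]; ring
  have hs0ρ : s0 - ρ = ((1 + η - ρ.re : ℝ) : ℂ) := by
    apply Complex.ext
    · simp [hs0re]
    · simp [hs0im, ht]
  set δ := 1 + η - ρ.re with hδ
  have hδ0 : 0 < δ := by rw [hδ]; linarith
  have hδ4 : δ < 1 / 4 := by rw [hδ]; linarith
  have key2 : - (deriv (H.Z m) s0 / H.Z m s0).re ≤ C5 * L - (1 / δ - 16 * δ) := by
    have := landau_ineq_zero (f := H.Z m) (s0 := s0) (ρ := ρ) (R := 1 / 4)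
      (B := (H.A + 1) * L) isOpen_U (by norm_num) (closedBall_sub_U hη0) (H.hZd m)
      (H.Z_ne m (by rw [hs0re]; linarith) (by rw [hs0re]; linarith)) (by positivity)
      (H.ball_bound hT1' hg hκp (by linarith) (by linarith) (by linarith))
      (by
        intro z hz h0
        have h1 : ‖z - s0‖ ≤ 1 / 4 := by simpa [dist_eq_norm] using hz
        have h2 := (Complex.abs_re_le_norm _).trans h1
        rw [sub_re, abs_le, hs0re] at h2
        have := H.zero_re_le_one m h0 (by linarith)
        rw [hs0re]; linarith) hzero
      (by rw [dist_comm, dist_eq_norm, hs0ρ, Complex.norm_real, Real.norm_eq_abs, abs_of_pos hδ0]; exact hδ4)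
    rw [hs0ρ, Complex.norm_real, Real.norm_eq_abs, abs_of_pos hδ0, ofReal_re] at this
    refine this.trans (le_of_eq ?_)
    rw [hC5]; field_simp; ring
  -- pole terms
  have hpole : ∀ (m' : ℤ) (t' : ℝ), (m' = 0 → r0 ≤ |t'|) →
      ((if m' = 0 then 1 / (((1 + η : ℝ) + t' * I : ℂ) - 1) else 0 : ℂ)).re ≤ 1 / r0 := by
    intro m' t' h
    split_ifs with h0
    · refine (Complex.re_le_norm _).trans ?_
      rw [norm_div, norm_one]
      apply one_div_le_one_div_of_le hr0
      refine (h h0).trans ?_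
      have := Complex.abs_im_le_norm (((1 + η : ℝ) + t' * I : ℂ) - 1)
      simpa using this
    · simp; exact hr0.le
  have hbig : m = 0 → r0 ≤ |t| := by
    intro h0
    by_contra hlt
    push Not at hlt
    rw [h0] at hzero
    refine hnear ρ ?_ hzero
    have h1 := Complex.norm_le_abs_re_add_abs_im (ρ - 1)
    have h2 : |(ρ - 1).re| ≤ r0 := by
      rw [sub_re, one_re, abs_le]; constructor <;> linarith
    have h3 : |(ρ - 1).im| < r0 := by simpa using hlt
    linarith
  have h341 := H.three_four_one m (σ := 1 + η) (by linarith) t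
  have e1 := hD0 (1 + η) (by linarith) (by linarith)
  rw [H.re_D_zero (by linarith), H.D_eq m (s := ((1 + η : ℝ) + t * I : ℂ)) (by simp; linarith) (by simp; linarith),
    H.D_eq (2 * m) (s := ((1 + η : ℝ) + (2 * t : ℝ) * I : ℂ)) (by simp; linarith) (by simp; linarith),
    add_re, add_re, neg_re, neg_re] at h341
  have e2 := key (2 * m) (2 * t) (by push_cast; rw [abs_mul, abs_two]; linarith)
    (by rw [abs_mul, abs_two]; linarith)
  have e3 := hpole m t hbig
  have e4 := hpole (2 * m) (2 * t) (by
    intro h; have := hbig (by omega); rw [abs_mul, abs_two]; linarith [abs_nonneg t])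
  have e5 : 4 / δ ≤ 3 / η + C6 * L := by
    have a1 : 3 * C0 ≤ 3 * C0 * L := by nlinarith
    have a2 : 5 / r0 ≤ 5 / r0 * L := by
      have : 0 < 5 / r0 := by positivity
      nlinarith
    have a3 : 4 / δ = 4 * (1 / δ) := by ring
    have a4 : 3 / η = 3 * (1 / η) := by ring
    have a5 : 5 / r0 = 5 * (1 / r0) := by ring
    have a6 : 1 + η - 1 = η := by ring
    rw [a6] at e1
    have a7 : C6 * L = 5 * (C5 * L) + 3 * C0 * L + 16 * L + 5 / r0 * L := by rw [hC6]; ring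
    rw [a7, a3, a4]
    rw [a5] at a2
    rw [a5]
    clear_value s0 C5 C6 κ c L η δ t
    clear a7 key hpole hD0 hT1 hnear
    rw [hs0] at key2
    generalize (deriv (H.Z m) (↑(1 + η) + ↑t * I) / H.Z m (↑(1 + η) + ↑t * I)).re = q1 at *
    generalize (deriv (H.Z (2 * m)) (↑(1 + η) + ↑(2 * t) * I) / H.Z (2 * m) (↑(1 + η) + ↑(2 * t) * I)).re = q2 at *
    generalize hq3 : (if m = 0 then 1 / (((1 + η : ℝ) : ℂ) + (t:ℂ) * I - 1) else 0).re = q3 at h341 e3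
    generalize hq4 : (if 2 * m = 0 then 1 / (((1 + η : ℝ) : ℂ) + ((2 * t : ℝ):ℂ) * I - 1) else 0).re = q4 at h341 e4
    generalize ∑' (i : ι), H.Lam i * H.X i ^ (-(1 + η)) = q5 at h341 e1
    have : 5 * (1 / r0) * L = 5 * (1/r0*L) := by ring
    linarith
  have e6 : 3 / η + C6 * L = 7 * C6 * L := by
    rw [hη, hκ]; field_simp; norm_num
  rw [e6, div_le_iff₀ hδ0] at e5
  have hCL : 0 < C6 * L := by positivity
  have e7 : 4 / (7 * (C6 * L)) ≤ δ := by
    rw [div_le_iff₀ (by positivity)]; linarith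
  have e8 : η = 1 / (2 * (C6 * L)) := by rw [hη, hκ]; field_simp
  have e9 : c / L ≤ 1 / (14 * (C6 * L)) := by
    have : 1 / (14 * (C6 * L)) = (1 / (14 * C6)) / L := by field_simp
    rw [this]; gcongr; exact min_le_left _ _
  have e10 : 4 / (7 * (C6 * L)) = 1 / (2 * (C6 * L)) + 1 / (14 * (C6 * L)) := by
    field_simp; norm_num
  rw [hδ] at e7
  linarith

/-- Main output: zero-free region with bounds on the logarithmic derivative. -/
theorem logDeriv_bound : ∃ c C T0 : ℝ, 0 < c ∧ c ≤ 1 / 8 ∧ 0 ≤ C ∧ Real.exp 1 ≤ T0 ∧ ∀ T, T0 ≤ T → ∀ m : ℤ, |(m : ℝ)| ≤ T →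
    ∀ s : ℂ, |s.im| ≤ T → 1 - c / Real.log T ≤ s.re → s.re ≤ 3 →
      H.Z m s ≠ 0 ∧ ‖deriv (H.Z m) s / H.Z m s‖ ≤ C * T ^ 2 := by
  obtain ⟨cz, T1, hcz, hT1, hzf⟩ := H.zero_free
  obtain ⟨C0, hC0, hD0⟩ := H.D_zero_bound
  have hA := H.hA
  set c : ℝ := min (cz / 4) (1 / 32) with hc
  have hcp : 0 < c := lt_min (by positivity) (by norm_num)
  have hc1 : c ≤ 1 / 32 := min_le_right _ _
  have hc2 : c ≤ cz / 4 := min_le_left _ _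
  obtain ⟨T2, hT2⟩ := Filter.eventually_atTop.mp (H.eventually_growth c hcp)
  refine ⟨c, 24 * (H.A + 1) / c + 2 / c + C0, max T1 T2, hcp, by linarith, by positivity,
    hT1.trans (le_max_left _ _), ?_⟩
  intro T hT m hm s him hre hre3
  have hTT1 : T1 ≤ T := (le_max_left _ _).trans hT
  have hTe : Real.exp 1 ≤ T := hT1.trans hTT1
  have hT2' : 2 ≤ T := by
    have := Real.add_one_le_exp (1 : ℝ); linarith
  have hlog : 1 ≤ Real.log T := by
    rw [← Real.log_exp 1]; exact Real.log_le_log (Real.exp_pos _) hTe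
  have hg := hT2 T ((le_max_right _ _).trans hT)
  have hlogT : Real.log T ≤ T := (Real.log_le_sub_one_of_pos (by linarith)).trans (by linarith)
  have hlog2 : Real.log (2 * T) ≤ 2 * Real.log T := by
    rw [Real.log_mul (by norm_num) (by linarith)]
    have := Real.log_le_log (by norm_num) hT2'
    linarith
  have hzf' : ∀ z : ℂ, |z.im| ≤ 2 * T → 1 - 2 * c / Real.log T < z.re → z.re ≤ 3 → H.Z m z ≠ 0 := by
    intro z hz1 hz2 hz3
    refine hzf (2 * T) (by linarith) m (by linarith) z hz1 ?_ hz3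
    have h1 : 2 * c / Real.log T ≤ cz / Real.log (2 * T) := by
      have h2 : 0 < Real.log (2 * T) := Real.log_pos (by linarith)
      rw [div_le_div_iff₀ (by linarith) h2]
      calc 2 * c * Real.log (2 * T) ≤ 2 * c * (2 * Real.log T) := by gcongr
        _ ≤ 2 * (cz / 4) * (2 * Real.log T) := by gcongr
        _ = cz * Real.log T := by ring
    linarith
  set L := Real.log T with hL
  have hη0 : 0 < c / L := by positivity
  have hη1 : c / L ≤ 1 / 32 := (div_le_self hcp.le hlog).trans hc1
  refine ⟨hzf' s (by linarith) (by
    have : 2 * c / L = c / L + c / L := by ring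
    linarith) hre3, ?_⟩
  have hTsq : L ^ 2 ≤ T ^ 2 := by gcongr
  have hLsq : L ≤ L ^ 2 := by nlinarith
  have h1sq : 1 ≤ L ^ 2 := by nlinarith
  by_cases hcase : 1 + c / L ≤ s.re
  · have h1 : 1 < s.re := by linarith
    have h2 : deriv (H.Z m) s / H.Z m s = - Dser H.X H.y H.Lam m s + if m = 0 then 1 / (s - 1) else 0 := by
      rw [H.hZeq m s h1, mul_div_assoc, div_self (H.Z_ne m h1 hre3), mul_one]
    rw [h2]
    have h3 : c / L ≤ s.re - 1 := by linarith
    have h4 : 1 / (s.re - 1) ≤ L / c := by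
      have : L / c = 1 / (c / L) := by field_simp
      rw [this]; exact one_div_le_one_div_of_le hη0 h3
    have h5 : ‖(if m = 0 then 1 / (s - 1) else 0 : ℂ)‖ ≤ L / c := by
      split_ifs
      · rw [norm_div, norm_one]
        refine le_trans ?_ h4
        apply one_div_le_one_div_of_le (by linarith)
        have := Complex.re_le_norm (s - 1)
        simpa using this
      · simp; positivity
    have h6 := (H.norm_D_le m h1).trans (hD0 s.re h1 hre3)
    have h7 := norm_add_le (- Dser H.X H.y H.Lam m s) (if m = 0 then 1 / (s - 1) else 0)
    rw [norm_neg] at h7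
    have h8 : 2 * (L / c) + C0 ≤ (2 / c + C0) * T ^ 2 := by
      have : 2 * (L / c) = (2 / c) * L := by ring
      rw [this, add_mul]
      have : 0 < 2 / c := by positivity
      nlinarith
    have h9 : 0 ≤ 24 * (H.A + 1) / c * T ^ 2 := by positivity
    rw [add_assoc, add_mul]
    linarith
  · push Not at hcase
    set s0 : ℂ := ((1 + c / L : ℝ) + s.im * I : ℂ) with hs0
    have hs0re : s0.re = 1 + c / L := by simp [hs0]
    have hs0im : s0.im = s.im := by simp [hs0]
    have h3c : 3 * c / L = 3 * (c / L) := by ring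
    have h2c : 2 * c / L = 2 * (c / L) := by ring
    have hsub : ball s0 (3 * c / L) ⊆ closedBall s0 (1 / 4) :=
      ball_subset_closedBall.trans (closedBall_subset_closedBall (by rw [h3c]; linarith))
    have hbb := H.ball_bound (m := m) (t := s.im) (by linarith) hg hcp (by linarith)
      (by linarith) (by linarith)
    have hmain := bc_logDeriv (f := H.Z m) (s0 := s0) (r := 3 * c / L) (r' := 2 * c / L)
      (B := (H.A + 1) * L) (z := s) (by positivity) (by rw [h3c, h2c]; linarith)
      ((H.hZd m).mono (hsub.trans (closedBall_sub_U hη0)))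
      (by
        intro z hz
        have h1 : ‖z - s0‖ < 3 * (c / L) := by rw [← h3c]; simpa [dist_eq_norm] using hz
        have h2 := (Complex.abs_re_le_norm _).trans_lt h1
        have h3 := (Complex.abs_im_le_norm _).trans_lt h1
        rw [sub_re, hs0re, abs_lt] at h2
        rw [sub_im, hs0im, abs_lt] at h3
        apply hzf' z
        · rw [abs_le] at him ⊢; constructor <;> linarith [him.1, him.2]
        · rw [h2c]; linarith
        · linarith)
      (by positivity)
      (fun z hz => hbb z (hsub hz))
      (by
        have : s - s0 = ((s.re - (1 + c / L) : ℝ) : ℂ) := by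
          apply Complex.ext <;> simp [hs0re, hs0im]
        rw [dist_eq_norm, this, Complex.norm_real, Real.norm_eq_abs, abs_le, h2c]
        constructor <;> linarith)
    refine hmain.trans ?_
    have h1 : 8 * ((H.A + 1) * L) * (3 * c / L) / (3 * c / L - 2 * c / L) ^ 2
       = 24 * (H.A + 1) / c * L ^ 2 := by
      have : 3 * c / L - 2 * c / L = c / L := by ring
      rw [this]; field_simp; ring
    rw [h1]
    have h2 : 24 * (H.A + 1) / c * L ^ 2 ≤ 24 * (H.A + 1) / c * T ^ 2 := by gcongr
    have h3 : 0 ≤ (2 / c + C0) * T ^ 2 := by positivity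
    rw [add_assoc, add_mul]
    linarith

end HeckeData
end

section
open Complex Set MeasureTheory Filter Topology

lemma norm_Gamma_le_re {s : ℂ} (hs : 0 < s.re) : ‖Complex.Gamma s‖ ≤ Real.Gamma s.re := by
  rw [Complex.Gamma_eq_integral hs, Real.Gamma_eq_integral hs, Complex.GammaIntegral]
  refine (norm_integral_le_integral_norm _).trans (le_of_eq ?_)
  apply setIntegral_congr_fun measurableSet_Ioi
  intro x hx
  have hx' : 0 < x := hx
  simp only [norm_mul]
  rw [Complex.norm_real, Real.norm_eq_abs, abs_of_pos (Real.exp_pos _),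
    Complex.norm_cpow_eq_rpow_re_of_pos hx']
  simp

lemma norm_Gamma_induct (n : ℕ) : ∀ s : ℂ, 0 < s.re → 2 * (s.re + n) ≤ |s.im| →
    ‖Complex.Gamma s‖ ≤ (1 / 2) ^ n * Real.Gamma s.re := by
  induction n with
  | zero => intro s hs _; simpa using norm_Gamma_le_re hs
  | succ n ih =>
    intro s hs h
    push_cast at h
    have hs0 : s ≠ 0 := by rintro rfl; simp at hs
    have h1 := ih (s + 1) (by simp; linarith) (by simp; linarith)
    rw [Complex.Gamma_add_one s hs0, norm_mul, add_re, one_re, Real.Gamma_add_one hs.ne'] at h1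
    have h2 : 2 * s.re ≤ ‖s‖ := by
      have := Complex.abs_im_le_norm s
      have : (0:ℝ) ≤ n := Nat.cast_nonneg n
      linarith
    have hG := Real.Gamma_pos_of_pos hs
    have h3 : 2 * s.re * ‖Complex.Gamma s‖ ≤ (1 / 2) ^ n * (s.re * Real.Gamma s.re) :=
      (mul_le_mul_of_nonneg_right h2 (norm_nonneg _)).trans h1
    have h4 : s.re * (2 * ‖Complex.Gamma s‖) ≤ s.re * ((1 / 2) ^ n * Real.Gamma s.re) := by
      linarith
    have h5 := le_of_mul_le_mul_left h4 hs
    rw [pow_succ]; linarith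

lemma norm_Gamma_decay {s : ℂ} (hs : 0 < s.re) (hs1 : s.re ≤ 1) :
    ‖Complex.Gamma s‖ ≤ 4 * Real.exp (-|s.im| / 4) * Real.Gamma s.re := by
  have hG := Real.Gamma_pos_of_pos hs
  by_cases h : |s.im| ≤ 4
  · refine (norm_Gamma_le_re hs).trans ?_
    have : 1 ≤ 4 * Real.exp (-|s.im| / 4) := by
      have h1 : Real.exp (-1) ≤ Real.exp (-|s.im| / 4) := Real.exp_le_exp.mpr (by linarith)
      have h2 : Real.exp 1 < 4 := by linarith [Real.exp_one_lt_d9]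
      have h3 : Real.exp (-1) * Real.exp 1 = 1 := by rw [← Real.exp_add]; simp
      nlinarith [Real.exp_pos (-1), Real.exp_pos 1]
    nlinarith
  push Not at h
  set n := ⌊|s.im| / 2 - 1⌋₊ with hn
  have h0 : 0 ≤ |s.im| / 2 - 1 := by linarith
  have h1 : (n : ℝ) ≤ |s.im| / 2 - 1 := Nat.floor_le h0
  have h2 : |s.im| / 2 - 1 < n + 1 := Nat.lt_floor_add_one _
  refine (norm_Gamma_induct n s hs (by linarith)).trans ?_
  gcongr
  have h3 : ((1:ℝ) / 2) ^ n = Real.exp (-(Real.log 2 * n)) := by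
    rw [Real.exp_neg, mul_comm, Real.exp_nat_mul, Real.exp_log two_pos]; simp
  have h4 : (4:ℝ) = Real.exp (2 * Real.log 2) := by
    rw [mul_comm, Real.exp_mul, Real.exp_log two_pos]; norm_num
  rw [h3]
  refine le_trans ?_ (le_of_eq (congrArg (· * Real.exp (-|s.im| / 4)) h4.symm))
  rw [← Real.exp_add]
  apply Real.exp_le_exp.mpr
  have := Real.log_two_gt_d9
  nlinarith

/-- the weight as a function of the square -/
noncomputable def phi (C : ℕ) (u : ℝ) : ℝ :=
  (Real.exp (-Real.pi * u) - Real.exp (-2 * Real.pi * u)) ^ C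

noncomputable def pcoef (C a : ℕ) : ℝ := (-1) ^ (a + C) * (C.choose (2 * C - a))

lemma phi_eq (C : ℕ) (u : ℝ) :
    phi C u = ∑ a ∈ Finset.Icc C (2 * C), pcoef C a * Real.exp (-(Real.pi * a) * u) := by
  rw [phi, sub_eq_add_neg, add_pow]
  symm
  apply Finset.sum_bij' (fun a _ => 2 * C - a) (fun j _ => 2 * C - j)
  · intro a ha; simp at ha ⊢; omega
  · intro a ha; simp at ha ⊢; omega
  · intro a ha; simp at ha ⊢; omega
  · intro a ha; simp at ha ⊢; omega
  · intro a ha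
    simp only [Finset.mem_Icc] at ha
    obtain ⟨j, rfl⟩ := Nat.exists_eq_add_of_le ha.1
    have hj : j ≤ C := by omega
    obtain ⟨i, rfl⟩ := Nat.exists_eq_add_of_le hj
    have e1 : 2 * (j + i) - (j + i + j) = i := by omega
    have e2 : j + i - i = j := by omega
    rw [e1, e2, pcoef, e1, neg_pow (Real.exp _), ← Real.exp_nat_mul, ← Real.exp_nat_mul]
    have e3 : ((-1:ℝ)) ^ (j + i + j + (j + i)) = (-1) ^ j := by
      have : j + i + j + (j + i) = j + 2 * (j + i) := by ring
      rw [this, pow_add, pow_mul]; simp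
    have e4 : Real.exp (-(Real.pi * ((j + i + j : ℕ):ℝ)) * u) =
      Real.exp (i * (-Real.pi * u)) * Real.exp (j * (-2 * Real.pi * u)) := by
      rw [← Real.exp_add]; congr 1; push_cast; ring
    rw [e3, e4]; ring

lemma phi_pos (C : ℕ) {u : ℝ} (hu : 0 < u) : 0 < phi C u := by
  apply pow_pos
  rw [sub_pos]
  apply Real.exp_lt_exp.mpr
  nlinarith [Real.pi_pos]

lemma phi_nonneg (C : ℕ) {u : ℝ} (hu : 0 ≤ u) : 0 ≤ phi C u := by
  apply pow_nonneg
  rw [sub_nonneg]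
  apply Real.exp_le_exp.mpr
  nlinarith [Real.pi_pos]

lemma phi_base_le {u : ℝ} (hu : 0 ≤ u) :
   0 ≤ Real.exp (-Real.pi * u) - Real.exp (-2 * Real.pi * u) ∧
   Real.exp (-Real.pi * u) - Real.exp (-2 * Real.pi * u) ≤ 1 ∧
   Real.exp (-Real.pi * u) - Real.exp (-2 * Real.pi * u) ≤ Real.pi * u := by
  have hp := Real.pi_pos
  have h0 : 0 ≤ Real.pi * u := by positivity
  have h1 : Real.exp (-Real.pi * u) ≤ 1 := by
    rw [Real.exp_le_one_iff]; linarith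
  have h2 : Real.exp (-2 * Real.pi * u) = Real.exp (-Real.pi * u) * Real.exp (-Real.pi * u) := by
    rw [← Real.exp_add]; congr 1; ring
  have h3 := Real.add_one_le_exp (-Real.pi * u)
  have h4 := Real.exp_pos (-Real.pi * u)
  rw [h2]
  refine ⟨by nlinarith, by nlinarith, by nlinarith⟩

lemma phi_le_one {C : ℕ} {u : ℝ} (hu : 0 ≤ u) : phi C u ≤ 1 :=
  pow_le_one₀ (phi_base_le hu).1 (phi_base_le hu).2.1

lemma phi_le {C : ℕ} (hC : 0 < C) {u : ℝ} (hu : 0 ≤ u) : phi C u ≤ Real.pi * u := by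
  have h := phi_base_le hu
  refine le_trans ?_ h.2.2
  have := pow_le_pow_of_le_one h.1 h.2.1 hC
  simpa [phi] using this

lemma continuous_phi (C : ℕ) : Continuous (phi C) := by
  unfold phi; fun_prop

/-- Mellin transform of `phi` in closed form. -/
noncomputable def Mphi (C : ℕ) (w : ℂ) : ℂ :=
  ∑ a ∈ Finset.Icc C (2 * C), (pcoef C a : ℂ) * ((1 / ((Real.pi * a : ℝ) : ℂ)) ^ w * Complex.Gamma w)

lemma mellin_exp {w : ℂ} (hw : 0 < w.re) {r : ℝ} (hr : 0 < r) :
    HasMellin (fun t : ℝ => ((Real.exp (-r * t) : ℝ) : ℂ)) w ((1 / (r : ℂ)) ^ w * Complex.Gamma w) := by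
  constructor
  · have h := integrableOn_rpow_mul_exp_neg_mul_rpow (s := w.re - 1) (p := 1) (b := r) (by linarith) one_pos hr
    rw [MellinConvergent]
    refine Integrable.mono' h ?_ ?_
    · apply ContinuousOn.aestronglyMeasurable _ measurableSet_Ioi
      apply ContinuousOn.fun_smul
      · intro t ht
        apply ContinuousAt.continuousWithinAt
        exact continuousAt_ofReal_cpow_const _ _ (Or.inr (ne_of_gt ht))
      · fun_prop
    · refine (ae_restrict_iff' measurableSet_Ioi).mpr (Eventually.of_forall fun t ht => ?_)
      have ht' : 0 < t := ht
      rw [norm_smul, Complex.norm_cpow_eq_rpow_re_of_pos ht', Complex.norm_real, Real.norm_eq_abs,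
        abs_of_pos (Real.exp_pos _)]
      simp
  · have := Complex.integral_cpow_mul_exp_neg_mul_Ioi hw hr
    rw [← this, mellin]
    apply setIntegral_congr_fun measurableSet_Ioi
    intro t _
    simp

lemma hasMellin_phi {C : ℕ} (hC : 0 < C) {w : ℂ} (hw : 0 < w.re) :
    HasMellin (fun t : ℝ => (phi C t : ℂ)) w (Mphi C w) := by
  have h : ∀ a ∈ Finset.Icc C (2 * C), HasMellin (fun t : ℝ => ((Real.exp (-(Real.pi * a) * t) : ℝ) : ℂ)) w
      ((1 / ((Real.pi * a : ℝ) : ℂ)) ^ w * Complex.Gamma w) := by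
    intro a ha
    apply mellin_exp hw
    have : 0 < a := by simp at ha; omega
    positivity
  have e : (fun t : ℝ => (phi C t : ℂ)) = fun t : ℝ => ∑ a ∈ Finset.Icc C (2 * C),
      (pcoef C a : ℂ) * ((Real.exp (-(Real.pi * a) * t) : ℝ) : ℂ) := by
    ext t; rw [phi_eq]; push_cast; rfl
  rw [e]
  have hi : ∀ a ∈ Finset.Icc C (2 * C), IntegrableOn (fun t : ℝ => (t : ℂ) ^ (w - 1) •
      ((pcoef C a : ℂ) * ((Real.exp (-(Real.pi * a) * t) : ℝ) : ℂ))) (Ioi 0) := by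
    intro a ha
    have := (h a ha).1.const_smul (pcoef C a : ℂ)
    simpa [MellinConvergent, smul_eq_mul] using this
  constructor
  · rw [MellinConvergent]
    simp_rw [Finset.smul_sum]
    exact integrable_finsetSum _ hi
  · rw [mellin]
    simp_rw [Finset.smul_sum]
    rw [integral_finsetSum _ hi, Mphi]
    apply Finset.sum_congr rfl
    intro a ha
    rw [← (h a ha).2, mellin, ← integral_const_mul]
    congr 1; ext t; simp only [smul_eq_mul]; ring

lemma Mphi_differentiableAt {C : ℕ} (hC : 0 < C) {w : ℂ} (hw : 0 < w.re) :
    DifferentiableAt ℂ (Mphi C) w := by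
  unfold Mphi
  apply DifferentiableAt.fun_sum
  intro a ha
  have : 0 < a := by simp at ha; omega
  have hne : (1 / ((Real.pi * a : ℝ) : ℂ)) ≠ 0 := by
    apply one_div_ne_zero; exact_mod_cast (by positivity : Real.pi * a ≠ 0)
  apply DifferentiableAt.const_mul
  apply DifferentiableAt.mul
  · exact DifferentiableAt.const_cpow differentiableAt_id (Or.inl hne)
  · apply Complex.differentiableAt_Gamma
    intro m hm
    rw [hm] at hw
    simp at hw
    have : (0:ℝ) ≤ m := Nat.cast_nonneg m
    linarith

lemma Mphi_bound {C : ℕ} (hC : 0 < C) : ∃ B : ℝ, 0 < B ∧ ∀ w : ℂ, 1 / 4 ≤ w.re → w.re ≤ 1 →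
    ‖Mphi C w‖ ≤ B * Real.exp (-|w.im| / 4) := by
  obtain ⟨G, hG⟩ : ∃ G : ℝ, ∀ σ ∈ Icc (1/4:ℝ) 1, ‖Real.Gamma σ‖ ≤ G := by
    apply isCompact_Icc.exists_bound_of_continuousOn
    intro σ hσ
    apply ContinuousAt.continuousWithinAt
    apply (Real.differentiableAt_Gamma _).continuousAt
    intro m
    have : (0:ℝ) ≤ m := Nat.cast_nonneg m
    have := hσ.1
    linarith
  refine ⟨(∑ a ∈ Finset.Icc C (2 * C), |pcoef C a|) * (4 * |G|) + 1, by positivity, ?_⟩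
  intro w h1 h2
  have hg := norm_Gamma_decay (s := w) (by linarith) h2
  have hG' : Real.Gamma w.re ≤ |G| := (Real.le_norm_self _).trans ((hG _ ⟨h1, h2⟩).trans (le_abs_self _))
  have hE := Real.exp_pos (-|w.im| / 4)
  have key : ‖Mphi C w‖ ≤ ∑ a ∈ Finset.Icc C (2 * C), |pcoef C a| * (4 * |G| * Real.exp (-|w.im| / 4)) := by
    refine (norm_sum_le _ _).trans (Finset.sum_le_sum ?_)
    intro a ha
    have ha' : 0 < a := by simp at ha; omega
    rw [norm_mul, norm_mul, Complex.norm_real, Real.norm_eq_abs]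
    apply mul_le_mul_of_nonneg_left _ (abs_nonneg _)
    have : (1 / ((Real.pi * a : ℝ) : ℂ)) = ((1 / (Real.pi * a) : ℝ) : ℂ) := by push_cast; rfl
    rw [this, Complex.norm_cpow_eq_rpow_re_of_pos (by positivity)]
    have h3 : (1 / (Real.pi * a)) ^ w.re ≤ 1 := by
      apply Real.rpow_le_one (by positivity) _ (by linarith)
      rw [div_le_one (by positivity)]
      have : (1:ℝ) ≤ a := by exact_mod_cast ha'
      nlinarith [Real.pi_gt_three]
    calc (1 / (Real.pi * a)) ^ w.re * ‖Complex.Gamma w‖ ≤ 1 * (4 * Real.exp (-|w.im| / 4) * |G|) := by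
          gcongr; exact hg.trans (by gcongr)
      _ = _ := by ring
  refine key.trans ?_
  rw [← Finset.sum_mul]
  nlinarith
end

section
open Complex Set MeasureTheory Filter Topology
open scoped FourierTransform

lemma integrable_exp_neg_abs {c : ℝ} (hc : 0 < c) :
    Integrable fun x : ℝ => Real.exp (-c * |x|) := by
  rw [← integrableOn_univ, ← Iic_union_Ioi (a := (0:ℝ))]
  apply IntegrableOn.union
  · refine (integrableOn_exp_mul_Iic hc 0).congr_fun ?_ measurableSet_Iic
    intro x hx
    simp only [abs_of_nonpos (show x ≤ 0 from hx)]; congr 1; ring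
  · refine (integrableOn_exp_mul_Ioi (a := -c) (by linarith) 0).congr_fun ?_ measurableSet_Ioi
    intro x hx
    simp only [abs_of_pos (show 0 < x from hx)]

lemma phi_exp_form {C : ℕ} (hC : 0 < C) {s : ℂ} (hs : 0 < s.re) :
    Integrable (fun u : ℝ => cexp (-s * u) * (phi C (Real.exp (-u)) : ℂ)) ∧
    ∫ u : ℝ, cexp (-s * u) * (phi C (Real.exp (-u)) : ℂ) = Mphi C s := by
  have hd : ∀ x ∈ univ, HasDerivWithinAt (fun x : ℝ => Real.exp (-x)) (-Real.exp (-x)) univ x := by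
    intro x _
    have := ((Real.hasDerivAt_exp (-x)).comp x (hasDerivAt_neg x)).hasDerivWithinAt (s := univ)
    simpa [Function.comp_def] using this
  have him : Set.image (fun x : ℝ => Real.exp (-x)) univ = Ioi 0 := by
    ext t
    simp only [image_univ, mem_range, mem_Ioi]
    constructor
    · rintro ⟨y, rfl⟩; positivity
    · intro ht; exact ⟨-Real.log t, by simp [Real.exp_log ht]⟩
  have hinj : univ.InjOn (fun x : ℝ => Real.exp (-x)) := by
    intro a _ b _ h
    simpa using h
  have hM := hasMellin_phi hC hs
  have e : ∀ u : ℝ, |-Real.exp (-u)| • (((Real.exp (-u) : ℝ) : ℂ) ^ (s - 1) • (phi C (Real.exp (-u)) : ℂ))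
      = cexp (-s * u) * (phi C (Real.exp (-u)) : ℂ) := by
    intro u
    rw [abs_neg, abs_of_pos (Real.exp_pos _)]
    have h1 : ((Real.exp (-u) : ℝ) : ℂ) ≠ 0 := by exact_mod_cast (Real.exp_pos _).ne'
    rw [Complex.cpow_def_of_ne_zero h1, ← Complex.ofReal_log (Real.exp_pos _).le, Real.log_exp]
    rw [Complex.real_smul, smul_eq_mul, ← mul_assoc, Complex.ofReal_exp, ← Complex.exp_add]
    congr 2; push_cast; ring
  have h1 := hM.1
  have h2 := hM.2
  rw [MellinConvergent, ← him, integrableOn_image_iff_integrableOn_abs_deriv_smul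
      MeasurableSet.univ hd hinj] at h1
  rw [mellin, ← him, integral_image_eq_integral_abs_deriv_smul MeasurableSet.univ hd hinj] at h2
  simp_rw [e] at h1 h2
  rw [integrableOn_univ] at h1
  rw [setIntegral_univ] at h2
  exact ⟨h1, h2⟩

lemma continuous_Mphi_vert {C : ℕ} (hC : 0 < C) {α : ℝ} (hα : 0 < α) (t : ℝ) :
    Continuous fun τ : ℝ => Mphi C (α + τ * I + t * I) := by
  rw [continuous_iff_continuousAt]
  intro τ
  have h : ContinuousAt (Mphi C) (α + τ * I + t * I) :=
    (Mphi_differentiableAt hC (by simp; exact hα)).continuousAt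
  have h2 : ContinuousAt (fun τ : ℝ => (α + τ * I + t * I : ℂ)) τ := by fun_prop
  exact ContinuousAt.comp' (f := fun τ : ℝ => (α + τ * I + t * I : ℂ)) h h2

lemma continuous_Mphi_vert' {C : ℕ} (hC : 0 < C) {α : ℝ} (hα : 0 < α) :
    Continuous fun τ : ℝ => Mphi C (α + τ * I) := by
  simpa using continuous_Mphi_vert hC hα 0

lemma integrable_Mphi_vert {C : ℕ} (hC : 0 < C) {α : ℝ} (h1 : 1 / 4 ≤ α) (h2 : α ≤ 1) :
    Integrable fun τ : ℝ => Mphi C (α + τ * I) := by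
  obtain ⟨B, hB, hb⟩ := Mphi_bound hC
  refine Integrable.mono' ((integrable_exp_neg_abs (c := 1 / 4) (by norm_num)).const_mul B)
    (continuous_Mphi_vert' hC (by linarith)).aestronglyMeasurable (Eventually.of_forall fun τ => ?_)
  have := hb (α + τ * I) (by simpa using h1) (by simpa using h2)
  refine this.trans (le_of_eq ?_)
  congr 2; simp; ring

lemma phi_inversion {C : ℕ} (hC : 0 < C) {α : ℝ} (h1 : 1 / 4 ≤ α) (h2 : α ≤ 1) {x : ℝ} (hx : 0 < x) :
    (phi C x : ℂ) = (1 / (2 * Real.pi)) * ∫ τ : ℝ, cexp (-(α + τ * I) * Real.log x) * Mphi C (α + τ * I) := by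
  have hM := hasMellin_phi hC (w := (α : ℂ)) (by simp; linarith)
  have hmel : ∀ τ : ℝ, mellin (fun t : ℝ => (phi C t : ℂ)) (α + τ * I) = Mphi C (α + τ * I) :=
    fun τ => (hasMellin_phi hC (by simp; linarith)).2
  have := mellinInv_mellin_eq α (fun t : ℝ => (phi C t : ℂ)) hx hM.1
    (by
      rw [VerticalIntegrable]
      simp_rw [hmel]
      exact integrable_Mphi_vert hC h1 h2)
    (by
      have := continuous_phi C
      fun_prop)
  rw [← this, mellinInv]
  simp_rw [hmel]
  rw [Complex.real_smul]
  push_cast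
  congr 2
  ext τ
  have hx' : (x : ℂ) ≠ 0 := by exact_mod_cast hx.ne'
  rw [Complex.cpow_def_of_ne_zero hx', smul_eq_mul, mul_comm (Complex.log _), Complex.ofReal_log hx.le]

noncomputable def hker (C : ℕ) (l x y : ℝ) : ℝ :=
  phi C (x * Real.exp (2 * l * y)) * phi C (x * Real.exp (-(2 * l * y)))

/-- Combined kernel on the Mellin side. -/
noncomputable def Kmel (C : ℕ) (l : ℝ) (m : ℤ) (w : ℂ) : ℂ :=
  Mphi C w * Mphi C (w + (Real.pi / l * m : ℝ) * I)

lemma Kmel_bound {C : ℕ} (hC : 0 < C) {l : ℝ} (hl : 0 < l) : ∃ B κ : ℝ, 0 < B ∧ 0 < κ ∧ κ ≤ 1 ∧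
    ∀ (m : ℤ) (w : ℂ), 1 / 4 ≤ w.re → w.re ≤ 1 →
    ‖Kmel C l m w‖ ≤ B * Real.exp (-κ * |w.im|) * Real.exp (-κ * |(m:ℝ)|) := by
  obtain ⟨B, hB, hb⟩ := Mphi_bound hC
  have hp := Real.pi_pos
  refine ⟨B * B, min (1 / 8) (Real.pi / l / 8), by positivity, lt_min (by norm_num) (by positivity),
    (min_le_left _ _).trans (by norm_num), ?_⟩
  intro m w h1 h2
  have e1 := hb w h1 h2
  have e2 := hb (w + (Real.pi / l * m : ℝ) * I) (by simpa using h1) (by simpa using h2)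
  rw [Kmel, norm_mul]
  refine (mul_le_mul e1 e2 (norm_nonneg _) (by positivity)).trans ?_
  have : B * Real.exp (-|w.im| / 4) * (B * Real.exp (-|(w + (Real.pi / l * m : ℝ) * I).im| / 4))
    = B * B * Real.exp (-|w.im| / 4 + (-|(w + (Real.pi / l * m : ℝ) * I).im| / 4)) := by
      rw [Real.exp_add]; ring
  rw [this, mul_assoc (B * B), ← Real.exp_add]
  apply mul_le_mul_of_nonneg_left _ (by positivity)
  apply Real.exp_le_exp.mpr
  have e3 : (w + (Real.pi / l * m : ℝ) * I).im = w.im + Real.pi / l * m := by simp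
  rw [e3]
  have e4 : Real.pi / l * |(m:ℝ)| ≤ |w.im + Real.pi / l * m| + |w.im| := by
    have : |Real.pi / l * (m:ℝ)| = Real.pi / l * |(m:ℝ)| := by
      rw [abs_mul, abs_of_pos (by positivity)]
    rw [← this]
    have := abs_sub (w.im + Real.pi / l * m) w.im
    rwa [add_sub_cancel_left] at this
  have e5 := min_le_left (1 / 8 : ℝ) (Real.pi / l / 8)
  have e6 := min_le_right (1 / 8 : ℝ) (Real.pi / l / 8)
  have e7 : min (1 / 8) (Real.pi / l / 8) * |w.im| ≤ 1 / 8 * |w.im| := by gcongr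
  have e8 : min (1 / 8) (Real.pi / l / 8) * |(m:ℝ)| ≤ Real.pi / l / 8 * |(m:ℝ)| := by gcongr
  have e9 := abs_nonneg (w.im + Real.pi / l * m)
  have e10 := abs_nonneg w.im
  linarith

lemma continuous_Kmel_vert {C : ℕ} (hC : 0 < C) (l : ℝ) (m : ℤ) {α : ℝ} (hα : 0 < α) :
    Continuous fun τ : ℝ => Kmel C l m (α + τ * I) := by
  unfold Kmel
  exact (continuous_Mphi_vert' hC hα).mul (continuous_Mphi_vert hC hα _)

lemma hker_fourier {C : ℕ} (hC : 0 < C) {l : ℝ} (hl : 0 < l) {x : ℝ} (hx : 0 < x) (m : ℤ)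
    {α : ℝ} (h1 : 1 / 4 ≤ α) (h2 : α ≤ 1) :
    ∫ y : ℝ, cexp (-(2 * Real.pi * m * y) * I) * (hker C l x y : ℂ) =
    (1 / (4 * Real.pi * l)) * ∫ τ : ℝ, Kmel C l m (α + τ * I) *
      cexp (-(2 * (α + τ * I) + (Real.pi / l * m : ℝ) * I) * Real.log x) := by
  have hα : 0 < α := by linarith
  set μ : ℝ := Real.pi / l * m with hμ
  -- the two-variable integrand
  set F : ℝ → ℝ → ℂ := fun y τ => (cexp (-(2 * Real.pi * m * y) * I) *
    (phi C (x * Real.exp (-(2 * l * y))) : ℂ)) *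
    (cexp (-(α + τ * I) * (Real.log x + 2 * l * y)) * Mphi C (α + τ * I)) with hF
  -- substituted integrand
  have sub : ∀ s : ℂ, 0 < s.re →
      Integrable (fun y : ℝ => cexp (-s * ((2 * l * y - Real.log x : ℝ) : ℂ)) * (phi C (x * Real.exp (-(2 * l * y))) : ℂ)) ∧
      ∫ y : ℝ, cexp (-s * ((2 * l * y - Real.log x : ℝ) : ℂ)) * (phi C (x * Real.exp (-(2 * l * y))) : ℂ) = (1 / (2 * l)) * Mphi C s := by
    intro s hs
    obtain ⟨hi, he⟩ := phi_exp_form hC hs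
    set G : ℝ → ℂ := fun u : ℝ => cexp (-s * u) * (phi C (Real.exp (-u)) : ℂ) with hG
    have e : (fun y : ℝ => cexp (-s * ((2 * l * y - Real.log x : ℝ) : ℂ)) * (phi C (x * Real.exp (-(2 * l * y))) : ℂ)) =
        fun y : ℝ => G ((2 * l) * y - Real.log x) := by
      ext y
      simp only [hG]
      congr 3
      rw [neg_sub, Real.exp_sub, Real.exp_log hx, Real.exp_neg, div_eq_mul_inv]
    rw [e]
    constructor
    · exact (hi.comp_sub_right (Real.log x)).comp_mul_left' (by positivity)
    · have := Measure.integral_comp_mul_left (fun u => G (u - Real.log x)) (2 * l)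
      rw [this, integral_sub_right_eq_self, he, abs_of_pos (by positivity), Complex.real_smul]
      push_cast; simp
  have step1 : ∀ y : ℝ, cexp (-(2 * Real.pi * m * y) * I) * (hker C l x y : ℂ)
      = (1 / (2 * Real.pi)) * ∫ τ, F y τ := by
    intro y
    have := phi_inversion hC h1 h2 (x := x * Real.exp (2 * l * y)) (by positivity)
    rw [Real.log_mul hx.ne' (Real.exp_pos _).ne', Real.log_exp] at this
    rw [hker, Complex.ofReal_mul, this]
    simp only [hF]
    rw [integral_const_mul]
    push_cast; ring
  have hnormexp : ∀ y τ : ℝ, ‖cexp (-(α + τ * I) * (Real.log x + 2 * l * y))‖ = Real.exp (-α * (Real.log x + 2 * l * y)) := by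
    intro y τ
    rw [Complex.norm_exp]
    congr 1
    simp
  have hFi : Integrable (Function.uncurry F) (volume.prod volume) := by
    have hy : Integrable fun y : ℝ => (phi C (x * Real.exp (-(2 * l * y)))) * Real.exp (-α * (Real.log x + 2 * l * y)) := by
      have := ((sub α (by simpa using hα)).1.norm).const_mul (Real.exp (-2 * α * Real.log x))
      refine this.congr (Eventually.of_forall fun y => ?_)
      simp only [norm_mul, Complex.norm_exp, Complex.norm_real, Real.norm_eq_abs]
      rw [abs_of_nonneg (phi_nonneg C (by positivity)), ← mul_assoc, ← Real.exp_add, mul_comm]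
      congr 2
      simp; ring
    have hprod := hy.mul_prod (integrable_Mphi_vert hC h1 h2).norm
    refine Integrable.mono' hprod ?_ (Eventually.of_forall ?_)
    · apply Continuous.aestronglyMeasurable
      have := continuous_Mphi_vert' hC hα
      have h3 := continuous_phi C
      have h4 : Continuous fun p : ℝ × ℝ => Mphi C (α + p.2 * I) := this.comp continuous_snd
      simp only [hF, Function.uncurry_def]
      refine Continuous.mul ?_ (Continuous.mul ?_ h4)
      · fun_prop
      · fun_prop
    · rintro ⟨y, τ⟩
      simp only [hF, Function.uncurry_apply_pair]
      rw [norm_mul, norm_mul, norm_mul, hnormexp, Complex.norm_real, Real.norm_eq_abs,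
        abs_of_nonneg (phi_nonneg C (by positivity)), Complex.norm_exp]
      have : (-(2 * Real.pi * m * y) * I : ℂ).re = 0 := by simp
      rw [this, Real.exp_zero, one_mul]
      exact le_of_eq (by ring)
  simp_rw [step1]
  rw [integral_const_mul, integral_integral_swap hFi]
  have step2 : ∀ τ : ℝ, ∫ y, F y τ = (1 / (2 * l)) * (Kmel C l m (α + τ * I) *
      cexp (-(2 * (α + τ * I) + μ * I) * Real.log x)) := by
    intro τ
    have hs := (sub (α + τ * I + μ * I) (by simpa using hα)).2
    have e : ∀ y, F y τ = (cexp (-(2 * (α + τ * I) + μ * I) * Real.log x) * Mphi C (α + τ * I)) *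
       (cexp (-(α + τ * I + μ * I) * ((2 * l * y - Real.log x : ℝ) : ℂ)) * (phi C (x * Real.exp (-(2 * l * y))) : ℂ)) := by
      intro y
      simp only [hF]
      have : cexp (-(2 * Real.pi * m * y) * I) * cexp (-(α + τ * I) * (Real.log x + 2 * l * y))
        = cexp (-(2 * (α + τ * I) + μ * I) * Real.log x) * cexp (-(α + τ * I + μ * I) * ((2 * l * y - Real.log x : ℝ) : ℂ)) := by
        rw [← Complex.exp_add, ← Complex.exp_add]
        congr 1
        rw [hμ]; push_cast
        have : (l : ℂ) ≠ 0 := by exact_mod_cast hl.ne'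
        field_simp; ring
      linear_combination (phi C (x * Real.exp (-(2 * l * y))) : ℂ) * Mphi C (α + τ * I) * this
    simp_rw [e]
    rw [integral_const_mul, hs, Kmel]
    ring
  simp_rw [step2]
  rw [integral_const_mul, ← mul_assoc]
  congr 1
  have : (l : ℂ) ≠ 0 := by exact_mod_cast hl.ne'
  have : (Real.pi : ℂ) ≠ 0 := by exact_mod_cast Real.pi_ne_zero
  field_simp; ring
end

section
open Complex Set MeasureTheory Filter Topology
open scoped FourierTransform

noncomputable def Acoef (C : ℕ) (l x : ℝ) (m : ℤ) : ℂ :=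
  ∫ y : ℝ, cexp (-(2 * Real.pi * m * y) * I) * (hker C l x y : ℂ)

lemma hker_nonneg {C : ℕ} {l x y : ℝ} (hx : 0 ≤ x) : 0 ≤ hker C l x y :=
  mul_nonneg (phi_nonneg C (by positivity)) (phi_nonneg C (by positivity))

lemma hker_pos {C : ℕ} {l x y : ℝ} (hx : 0 < x) : 0 < hker C l x y :=
  mul_pos (phi_pos C (by positivity)) (phi_pos C (by positivity))

lemma hker_le {C : ℕ} (hC : 0 < C) {l x y : ℝ} (hl : 0 < l) (hx : 0 ≤ x) :
    hker C l x y ≤ Real.pi * x * Real.exp (-(2 * l) * |y|) := by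
  rcases le_total 0 y with h | h
  · rw [abs_of_nonneg h, hker]
    calc _ ≤ 1 * (Real.pi * (x * Real.exp (-(2 * l * y)))) := by
          apply mul_le_mul (phi_le_one (by positivity)) (phi_le hC (by positivity))
            (phi_nonneg C (by positivity)) zero_le_one
      _ = _ := by rw [neg_mul]; ring
  · rw [abs_of_nonpos h, hker]
    calc _ ≤ (Real.pi * (x * Real.exp (2 * l * y))) * 1 := by
          apply mul_le_mul (phi_le hC (by positivity)) (phi_le_one (by positivity))
            (phi_nonneg C (by positivity)) (by positivity)
      _ = _ := by rw [neg_mul_neg]; ring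

lemma continuous_hker (C : ℕ) (l x : ℝ) : Continuous (hker C l x) := by
  unfold hker
  have := continuous_phi C
  fun_prop

lemma integrable_hker {C : ℕ} (hC : 0 < C) {l x : ℝ} (hl : 0 < l) (hx : 0 ≤ x) :
    Integrable (hker C l x) := by
  refine Integrable.mono' ((integrable_exp_neg_abs (c := 2 * l) (by positivity)).const_mul (Real.pi * x))
    (continuous_hker C l x).aestronglyMeasurable (Eventually.of_forall fun y => ?_)
  rw [Real.norm_eq_abs, abs_of_nonneg (hker_nonneg hx)]
  exact hker_le hC hl hx

lemma Acoef_eq {C : ℕ} (hC : 0 < C) {l : ℝ} (hl : 0 < l) {x : ℝ} (hx : 0 < x) (m : ℤ)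
    {α : ℝ} (h1 : 1 / 4 ≤ α) (h2 : α ≤ 1) :
    Acoef C l x m = (1 / (4 * Real.pi * l)) * ∫ τ : ℝ, Kmel C l m (α + τ * I) *
      cexp (-(2 * (α + τ * I) + (Real.pi / l * m : ℝ) * I) * Real.log x) :=
  hker_fourier hC hl hx m h1 h2

lemma norm_cexp_aux (α τ μ x : ℝ) (hx : 0 < x) :
    ‖cexp (-(2 * (α + τ * I) + μ * I) * Real.log x)‖ = x ^ (-(2 * α)) := by
  rw [Complex.norm_exp, Real.rpow_def_of_pos hx]
  congr 1
  simp; ring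

lemma Acoef_bound {C : ℕ} (hC : 0 < C) {l : ℝ} (hl : 0 < l) : ∃ B κ : ℝ, 0 < B ∧ 0 < κ ∧
    ∀ (m : ℤ) (x α : ℝ), 0 < x → 1 / 4 ≤ α → α ≤ 1 →
    ‖Acoef C l x m‖ ≤ B * x ^ (-(2 * α)) * Real.exp (-κ * |(m:ℝ)|) := by
  obtain ⟨B, κ, hB, hκ, _, hb⟩ := Kmel_bound hC hl
  have hi := integrable_exp_neg_abs hκ
  set J := ∫ τ : ℝ, Real.exp (-κ * |τ|) with hJ
  have hJ0 : 0 ≤ J := integral_nonneg fun τ => (Real.exp_pos _).le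
  have hp := Real.pi_pos
  refine ⟨1 / (4 * Real.pi * l) * B * J + 1, κ, by positivity, hκ, ?_⟩
  intro m x α hx h1 h2
  rw [Acoef_eq hC hl hx m h1 h2, norm_mul]
  have e1 : ‖(1 / (4 * Real.pi * l) : ℂ)‖ = 1 / (4 * Real.pi * l) := by
    have : (1 / (4 * Real.pi * l) : ℂ) = ((1 / (4 * Real.pi * l) : ℝ) : ℂ) := by push_cast; rfl
    rw [this, Complex.norm_real, Real.norm_eq_abs, abs_of_pos (by positivity)]
  have e2 : ‖∫ τ : ℝ, Kmel C l m (α + τ * I) *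
      cexp (-(2 * (α + τ * I) + (Real.pi / l * m : ℝ) * I) * Real.log x)‖ ≤
      ∫ τ : ℝ, (B * x ^ (-(2 * α)) * Real.exp (-κ * |(m:ℝ)|)) * Real.exp (-κ * |τ|) := by
    apply norm_integral_le_of_norm_le (hi.const_mul _)
    refine Eventually.of_forall fun τ => ?_
    rw [norm_mul, norm_cexp_aux _ _ _ _ hx]
    have := hb m (α + τ * I) (by simpa using h1) (by simpa using h2)
    have e3 : (α + τ * I : ℂ).im = τ := by simp
    rw [e3] at this
    have hx2 : 0 < x ^ (-(2 * α)) := Real.rpow_pos_of_pos hx _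
    calc _ ≤ (B * Real.exp (-κ * |τ|) * Real.exp (-κ * |(m:ℝ)|)) * x ^ (-(2 * α)) := by gcongr
      _ = _ := by ring
  rw [integral_const_mul] at e2
  rw [e1]
  have hx2 : 0 < x ^ (-(2 * α)) := Real.rpow_pos_of_pos hx _
  have hE := Real.exp_pos (-κ * |(m:ℝ)|)
  have h0 : 0 < x ^ (-(2 * α)) * Real.exp (-κ * |(m:ℝ)|) := by positivity
  calc _ ≤ 1 / (4 * Real.pi * l) * (B * x ^ (-(2 * α)) * Real.exp (-κ * |(m:ℝ)|) * J) := by gcongr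
    _ = (1 / (4 * Real.pi * l) * B * J) * (x ^ (-(2 * α)) * Real.exp (-κ * |(m:ℝ)|)) := by ring
    _ ≤ (1 / (4 * Real.pi * l) * B * J + 1) * (x ^ (-(2 * α)) * Real.exp (-κ * |(m:ℝ)|)) := by
        gcongr; linarith
    _ = _ := by ring

lemma summable_exp_neg_abs_int {κ : ℝ} (hκ : 0 < κ) : Summable fun m : ℤ => Real.exp (-κ * |(m:ℝ)|) := by
  have h : Summable fun n : ℕ => Real.exp (-κ * n) := by
    have := Real.summable_exp_nat_mul_iff (a := -κ)
    refine (this.mpr (by linarith)).congr fun n => ?_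
    rw [mul_comm]
  apply Summable.of_nat_of_neg
  · simpa using h
  · simpa using h

lemma poisson_hker {C : ℕ} (hC : 0 < C) {l : ℝ} (hl : 0 < l) {x : ℝ} (hx : 0 < x) (y : ℝ) :
    ((∑' j : ℤ, hker C l x (y + j) : ℝ) : ℂ) = ∑' m : ℤ, Acoef C l x m * cexp (2 * Real.pi * I * m * y) := by
  obtain ⟨B, κ, hB, hκ, hb⟩ := Acoef_bound hC hl
  have hF : ∀ m : ℤ, 𝓕 (fun y : ℝ => (hker C l x y : ℂ)) m = Acoef C l x m := by
    intro m
    rw [Real.fourier_real_eq_integral_exp_smul, Acoef]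
    congr 1; ext v
    rw [smul_eq_mul]; congr 2; push_cast; ring
  have hc : Continuous fun y : ℝ => (hker C l x y : ℂ) := by
    have := continuous_hker C l x
    fun_prop
  have := Real.tsum_eq_tsum_fourier_of_rpow_decay_of_summable hc (b := 2) (by norm_num) ?_ ?_ y
  · rw [Complex.ofReal_tsum, this]
    apply tsum_congr
    intro m
    rw [hF, fourier_coe_apply]
    congr 2; simp
  · have hO : (fun y : ℝ => Real.exp (-(2 * l) * |y|)) =O[cocompact ℝ] fun y : ℝ => |y| ^ (-2 : ℝ) := by
      have h := (isLittleO_exp_neg_mul_rpow_atTop (a := 2 * l) (by positivity) (-2)).isBigO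
      exact h.comp_tendsto (tendsto_norm_cocompact_atTop (E := ℝ))
    refine Asymptotics.IsBigO.trans ?_ hO
    refine Asymptotics.IsBigO.of_bound (Real.pi * x) (Eventually.of_forall fun y => ?_)
    rw [Complex.norm_real, Real.norm_eq_abs, abs_of_nonneg (hker_nonneg hx.le), Real.norm_eq_abs,
      abs_of_pos (Real.exp_pos _)]
    exact hker_le hC hl hx.le
  · simp_rw [hF]
    apply Summable.of_norm_bounded ((summable_exp_neg_abs_int hκ).mul_left (B * x ^ (-(2 * (1:ℝ)))))
    intro m
    exact hb m x 1 hx (by norm_num) le_rfl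

lemma hker_eq_sum (C : ℕ) (l v y : ℝ) : hker C l v y = ∑ a ∈ Finset.Icc C (2 * C), ∑ b ∈ Finset.Icc C (2 * C),
    (pcoef C a * pcoef C b) * Real.exp (-(Real.pi * (a * Real.exp (2 * l * y) + b * Real.exp (-(2 * l * y)))) * v) := by
  rw [hker, phi_eq, phi_eq, Finset.sum_mul_sum]
  refine Finset.sum_congr rfl fun a _ => Finset.sum_congr rfl fun b _ => ?_
  rw [mul_mul_mul_comm, ← Real.exp_add]
  congr 2; ring

lemma R_lower {l y : ℝ} {a b : ℕ} (ha : 0 < a) (hb : 0 < b) :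
    Real.exp (2 * l * |y|) ≤ a * Real.exp (2 * l * y) + b * Real.exp (-(2 * l * y)) := by
  have ha' : (1:ℝ) ≤ a := by exact_mod_cast ha
  have hb' : (1:ℝ) ≤ b := by exact_mod_cast hb
  have h1 := Real.exp_pos (2 * l * y)
  have h2 := Real.exp_pos (-(2 * l * y))
  rcases abs_cases y with ⟨h, _⟩ | ⟨h, _⟩
  · rw [h]; nlinarith
  · rw [h]
    have : 2 * l * -y = -(2 * l * y) := by ring
    rw [this]; nlinarith

lemma term_prod {l : ℝ} (hl : 0 < l) {a b : ℕ} (ha : 0 < a) (hb : 0 < b) :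
    Integrable (Function.uncurry fun (v y : ℝ) =>
      Real.exp (-(Real.pi * (a * Real.exp (2 * l * y) + b * Real.exp (-(2 * l * y)))) * v))
      ((volume.restrict (Ioi 0)).prod volume) ∧
    ∫ v in Ioi (0:ℝ), ∫ y : ℝ, Real.exp (-(Real.pi * (a * Real.exp (2 * l * y) + b * Real.exp (-(2 * l * y)))) * v)
      = (1 / Real.pi) * ∫ y : ℝ, (a * Real.exp (2 * l * y) + b * Real.exp (-(2 * l * y)))⁻¹ := by
  have hp := Real.pi_pos
  have ha' : (0:ℝ) < a := by exact_mod_cast ha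
  have hb' : (0:ℝ) < b := by exact_mod_cast hb
  set R : ℝ → ℝ := fun y => a * Real.exp (2 * l * y) + b * Real.exp (-(2 * l * y)) with hR
  have hRp : ∀ y, 0 < R y := fun y => by simp only [hR]; positivity
  have hRc : Continuous R := by simp only [hR]; fun_prop
  have hintg : ∀ y, ∫ v in Ioi (0:ℝ), Real.exp (-(Real.pi * R y) * v) = (1 / Real.pi) * (R y)⁻¹ := by
    intro y
    rw [integral_exp_mul_Ioi (by nlinarith [hRp y, mul_pos hp (hRp y)])]
    have := hRp y
    simp
    field_simp
  have hI : Integrable (Function.uncurry fun (v y : ℝ) => Real.exp (-(Real.pi * R y) * v))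
      ((volume.restrict (Ioi 0)).prod volume) := by
    rw [integrable_prod_iff']
    · constructor
      · refine Eventually.of_forall fun y => ?_
        exact integrableOn_exp_mul_Ioi (a := -(Real.pi * R y)) (by nlinarith [hRp y, mul_pos hp (hRp y)]) 0
      · simp only [Function.uncurry_apply_pair, Real.norm_eq_abs, Real.abs_exp]
        simp_rw [hintg]
        apply Integrable.const_mul
        refine Integrable.mono' (integrable_exp_neg_abs (c := 2 * l) (by positivity)) ?_ ?_
        · exact (hRc.inv₀ fun y => (hRp y).ne').aestronglyMeasurable
        · refine Eventually.of_forall fun y => ?_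
          rw [Real.norm_eq_abs, abs_of_pos (inv_pos.mpr (hRp y)), neg_mul, Real.exp_neg]
          exact inv_anti₀ (Real.exp_pos _) (R_lower ha hb)
    · apply Continuous.aestronglyMeasurable
      simp only [Function.uncurry_def]
      fun_prop
  refine ⟨hI, ?_⟩
  rw [integral_integral_swap hI]
  simp_rw [hintg]
  rw [integral_const_mul]

noncomputable def Hint (C : ℕ) (l v : ℝ) : ℝ := ∫ y : ℝ, hker C l v y

lemma Hint_main {C : ℕ} (hC : 0 < C) {l : ℝ} (hl : 0 < l) :
    IntegrableOn (Hint C l) (Ioi 0) ∧ 2 * ∫ v in Ioi (0:ℝ), Hint C l v = sieveConst C (Real.exp l) := by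
  have hpos : ∀ a ∈ Finset.Icc C (2 * C), 0 < a := fun a ha => by simp at ha; omega
  have hI : Integrable (Function.uncurry fun (v y : ℝ) => hker C l v y)
      ((volume.restrict (Ioi 0)).prod volume) := by
    have e : (Function.uncurry fun (v y : ℝ) => hker C l v y) = fun p : ℝ × ℝ =>
        ∑ a ∈ Finset.Icc C (2 * C), ∑ b ∈ Finset.Icc C (2 * C), (pcoef C a * pcoef C b) *
        (Function.uncurry fun (v y : ℝ) =>
      Real.exp (-(Real.pi * (a * Real.exp (2 * l * y) + b * Real.exp (-(2 * l * y)))) * v)) p := by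
      ext ⟨v, y⟩
      simp only [Function.uncurry_apply_pair]
      exact hker_eq_sum C l v y
    rw [e]
    refine integrable_finsetSum _ fun a ha => integrable_finsetSum _ fun b hb => ?_
    exact (term_prod hl (hpos a ha) (hpos b hb)).1.const_mul _
  refine ⟨hI.integral_prod_left, ?_⟩
  have e1 : ∫ v in Ioi (0:ℝ), Hint C l v = ∑ a ∈ Finset.Icc C (2 * C), ∑ b ∈ Finset.Icc C (2 * C),
      (pcoef C a * pcoef C b) * ((1 / Real.pi) * ∫ y : ℝ, (a * Real.exp (2 * l * y) + b * Real.exp (-(2 * l * y)))⁻¹) := by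
    have e0 : ∫ v in Ioi (0:ℝ), Hint C l v = ∫ z, Function.uncurry (fun (v y : ℝ) => hker C l v y) z
        ∂((volume.restrict (Ioi 0)).prod volume) := (integral_prod _ hI).symm
    rw [e0]
    have e : (fun z : ℝ × ℝ => Function.uncurry (fun (v y : ℝ) => hker C l v y) z) = fun p : ℝ × ℝ =>
        ∑ a ∈ Finset.Icc C (2 * C), ∑ b ∈ Finset.Icc C (2 * C), (pcoef C a * pcoef C b) *
        (Function.uncurry fun (v y : ℝ) =>
      Real.exp (-(Real.pi * (a * Real.exp (2 * l * y) + b * Real.exp (-(2 * l * y)))) * v)) p := by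
      ext ⟨v, y⟩
      simp only [Function.uncurry_apply_pair]
      exact hker_eq_sum C l v y
    rw [e, integral_finsetSum _ fun a ha => integrable_finsetSum _ fun b hb =>
      (term_prod hl (hpos a ha) (hpos b hb)).1.const_mul _]
    refine Finset.sum_congr rfl fun a ha => ?_
    rw [integral_finsetSum _ fun b hb => (term_prod hl (hpos a ha) (hpos b hb)).1.const_mul _]
    refine Finset.sum_congr rfl fun b hb => ?_
    rw [integral_const_mul, ← (term_prod hl (hpos a ha) (hpos b hb)).2,
      integral_prod _ (term_prod hl (hpos a ha) (hpos b hb)).1]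
    rfl
  rw [e1, sieveConst, Finset.mul_sum, Finset.mul_sum]
  refine Finset.sum_congr rfl fun a ha => ?_
  rw [Finset.mul_sum, Finset.mul_sum]
  refine Finset.sum_congr rfl fun b hb => ?_
  have e2 : ∀ y : ℝ, Real.exp l ^ (2 * y) = Real.exp (2 * l * y) := by
    intro y; rw [← Real.exp_mul]; congr 1; ring
  have e3 : ∀ y : ℝ, Real.exp l ^ (-(2 * y)) = Real.exp (-(2 * l * y)) := by
    intro y; rw [← Real.exp_mul]; congr 1; ring
  simp_rw [e2, e3]
  have e4 : pcoef C a * pcoef C b = (-1 : ℝ)^(a+b) * (C.choose (2*C - a)) * (C.choose (2*C - b)) := by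
    rw [pcoef, pcoef]
    have : (-1:ℝ) ^ (a + C) * (-1) ^ (b + C) = (-1) ^ (a + b) := by
      rw [← pow_add]
      have : a + C + (b + C) = (a + b) + 2 * C := by ring
      rw [this, pow_add, pow_mul]; simp
    rw [← this]; ring
  rw [e4]; ring

lemma Hint_pos {C : ℕ} (hC : 0 < C) {l : ℝ} (hl : 0 < l) {v : ℝ} (hv : 0 < v) : 0 < Hint C l v := by
  unfold Hint
  rw [integral_pos_iff_support_of_nonneg (fun y => hker_nonneg hv.le) (integrable_hker hC hl hv.le)]
  have : Function.support (hker C l v) = univ := by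
    ext y; simp [(hker_pos (C := C) (l := l) (y := y) hv).ne']
  rw [this]; simp

lemma sieveConst_pos {C : ℕ} (hC : 0 < C) {l : ℝ} (hl : 0 < l) : 0 < sieveConst C (Real.exp l) := by
  obtain ⟨h1, h2⟩ := Hint_main hC hl
  rw [← h2]
  apply mul_pos two_pos
  rw [setIntegral_pos_iff_support_of_nonneg_ae _ h1]
  · have : Ioi (0:ℝ) ⊆ Function.support (Hint C l) ∩ Ioi 0 :=
      fun v hv => ⟨(Hint_pos hC hl hv).ne', hv⟩
    refine lt_of_lt_of_le ?_ (measure_mono this)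
    simp
  · exact (ae_restrict_iff' measurableSet_Ioi).mpr (Eventually.of_forall fun v hv => (Hint_pos hC hl hv).le)
end

section
open Complex Set MeasureTheory Filter Topology

lemma Hint_eq_Acoef (C : ℕ) (l x : ℝ) : ((Hint C l x : ℝ) : ℂ) = Acoef C l x 0 := by
  rw [Hint, Acoef, ← integral_complex_ofReal]
  congr 1; ext y; simp

lemma integrable_Kmel {C : ℕ} (hC : 0 < C) {l : ℝ} (hl : 0 < l) (m : ℤ) {α : ℝ} (h1 : 1 / 4 ≤ α) (h2 : α ≤ 1) :
    Integrable fun τ : ℝ => Kmel C l m (α + τ * I) := by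
  obtain ⟨B, κ, hB, hκ, _, hb⟩ := Kmel_bound hC hl
  refine Integrable.mono' ((integrable_exp_neg_abs hκ).const_mul (B * Real.exp (-κ * |(m:ℝ)|)))
    (continuous_Kmel_vert hC l m (by linarith)).aestronglyMeasurable (Eventually.of_forall fun τ => ?_)
  have := hb m (α + τ * I) (by simpa using h1) (by simpa using h2)
  have e3 : (α + τ * I : ℂ).im = τ := by simp
  rw [e3] at this
  refine this.trans (le_of_eq (by ring))

noncomputable def poleTerm (C : ℕ) (l N : ℝ) : ℂ :=
  (1 / (2 * Real.pi * l)) * ∫ τ : ℝ, Kmel C l 0 ((1:ℝ) + τ * I) *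
    cexp ((2 * ((1:ℝ) + τ * I)) * Real.log N) * (1 / (2 * ((1:ℝ) + τ * I) - 1))

lemma poleTerm_eq {C : ℕ} (hC : 0 < C) {l : ℝ} (hl : 0 < l) {N : ℝ} (hN : 0 < N) :
    poleTerm C l N = ((2 * ∫ u in Ioi (1:ℝ), Hint C l (u / N) : ℝ) : ℂ) := by
  set F : ℝ → ℝ → ℂ := fun u τ => (Kmel C l 0 ((1:ℝ) + τ * I) *
    cexp ((2 * ((1:ℝ) + τ * I)) * Real.log N)) * (u : ℂ) ^ (-(2 * ((1:ℝ) + τ * I))) with hF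
  have hN2 : ∀ τ : ℝ, ‖cexp ((2 * ((1:ℝ) + τ * I)) * Real.log N)‖ = Real.exp (2 * Real.log N) := by
    intro τ; rw [Complex.norm_exp]; congr 1; simp
  have hI : Integrable (Function.uncurry F) ((volume.restrict (Ioi 1)).prod volume) := by
    have h1 : Integrable (fun u : ℝ => u ^ (-2 : ℝ)) (volume.restrict (Ioi 1)) :=
      integrableOn_Ioi_rpow_of_lt (by norm_num) one_pos
    have h2 := ((integrable_Kmel hC hl 0 (α := 1) (by norm_num) le_rfl).norm).mul_const (Real.exp (2 * Real.log N))
    have h3 := h1.mul_prod h2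
    refine Integrable.mono' h3 ?_ ?_
    · have hm : Measurable (Function.uncurry F) := by
        have hk := (continuous_Kmel_vert hC l 0 (α := 1) one_pos).measurable
        have hk2 : Measurable fun p : ℝ × ℝ => Kmel C l 0 ((1:ℝ) + p.2 * I) := hk.comp measurable_snd
        simp only [hF, Function.uncurry_def]
        refine (hk2.mul ?_).mul ?_
        · fun_prop
        · fun_prop
      exact hm.aestronglyMeasurable
    · have : ∀ᵐ p : ℝ × ℝ ∂((volume.restrict (Ioi 1)).prod volume), p.1 ∈ Ioi (1:ℝ) := by
        have h0 : ∀ᵐ u : ℝ ∂(volume.restrict (Ioi 1)), u ∈ Ioi (1:ℝ) := ae_restrict_mem measurableSet_Ioi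
        exact Measure.quasiMeasurePreserving_fst.ae h0
      filter_upwards [this]
      rintro ⟨u, τ⟩ hu
      have hu' : 0 < u := lt_trans one_pos hu
      simp only [hF, Function.uncurry_apply_pair]
      rw [norm_mul, norm_mul, hN2, Complex.norm_cpow_eq_rpow_re_of_pos hu']
      simp
      rw [mul_comm]
  have step1 : ∀ u ∈ Ioi (1:ℝ), ((Hint C l (u / N) : ℝ) : ℂ) = (1 / (4 * Real.pi * l)) * ∫ τ, F u τ := by
    intro u hu
    have hu' : 0 < u := lt_trans one_pos hu
    rw [Hint_eq_Acoef, Acoef_eq hC hl (div_pos hu' hN) 0 (α := 1) (by norm_num) le_rfl]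
    congr 2; ext τ
    simp only [hF]
    have hu0 : (u : ℂ) ≠ 0 := by exact_mod_cast hu'.ne'
    rw [Complex.cpow_def_of_ne_zero hu0, ← Complex.ofReal_log hu'.le, mul_assoc, ← Complex.exp_add,
      Real.log_div hu'.ne' hN.ne']
    congr 2
    push_cast; simp; ring
  have step2 : ((∫ u in Ioi (1:ℝ), Hint C l (u / N) : ℝ) : ℂ) = (1 / (4 * Real.pi * l)) * ∫ u in Ioi (1:ℝ), ∫ τ, F u τ := by
    rw [← integral_complex_ofReal, ← integral_const_mul]
    exact setIntegral_congr_fun measurableSet_Ioi step1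
  rw [Complex.ofReal_mul, step2, integral_integral_swap hI, poleTerm]
  have step3 : ∀ τ : ℝ, ∫ u in Ioi (1:ℝ), F u τ = Kmel C l 0 ((1:ℝ) + τ * I) *
    cexp ((2 * ((1:ℝ) + τ * I)) * Real.log N) * (1 / (2 * ((1:ℝ) + τ * I) - 1)) := by
    intro τ
    simp only [hF]
    rw [integral_const_mul]
    congr 1
    rw [integral_Ioi_cpow_of_lt (by simp) one_pos]
    have hne : (2 * ((1:ℝ) + τ * I) - 1 : ℂ) ≠ 0 := by
      intro h
      have := congrArg Complex.re h
      simp at this; norm_num at this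
    have hne2 : (-(2 * ((1:ℝ) + τ * I)) + 1 : ℂ) ≠ 0 := by
      intro h; apply hne; linear_combination -h
    rw [Complex.ofReal_one, Complex.one_cpow]
    rw [Complex.ofReal_one] at hne hne2
    field_simp
    ring
  simp_rw [step3]
  rw [← mul_assoc]
  congr 1
  have : (l : ℂ) ≠ 0 := by exact_mod_cast hl.ne'
  have : (Real.pi : ℂ) ≠ 0 := by exact_mod_cast Real.pi_ne_zero
  push_cast
  field_simp; ring

lemma Hint_le {C : ℕ} (hC : 0 < C) {l : ℝ} (hl : 0 < l) : ∃ B : ℝ, 0 < B ∧ ∀ v, 0 < v → Hint C l v ≤ B * v ^ (-(1/2) : ℝ) := by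
  obtain ⟨B, κ, hB, hκ, hb⟩ := Acoef_bound hC hl
  refine ⟨B, hB, fun v hv => ?_⟩
  have := hb 0 v (1/4) hv le_rfl (by norm_num)
  rw [← Hint_eq_Acoef, Complex.norm_real, Real.norm_eq_abs] at this
  refine (le_abs_self _).trans (this.trans (le_of_eq ?_))
  simp; left; norm_num

lemma poleTerm_asymp {C : ℕ} (hC : 0 < C) {l : ℝ} (hl : 0 < l) : ∃ B : ℝ, 0 < B ∧ ∀ N : ℝ, 1 ≤ N →
    ‖poleTerm C l N - ((sieveConst C (Real.exp l) * N : ℝ) : ℂ)‖ ≤ B * N ^ (1 / 2 : ℝ) := by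
  obtain ⟨B, hB, hb⟩ := Hint_le hC hl
  obtain ⟨hI, hc⟩ := Hint_main hC hl
  refine ⟨4 * B, by positivity, fun N hN => ?_⟩
  have hN0 : 0 < N := by linarith
  rw [poleTerm_eq hC hl hN0, ← Complex.ofReal_sub, Complex.norm_real, Real.norm_eq_abs]
  have e1 : ∫ u in Ioi (1:ℝ), Hint C l (u / N) = N * ∫ v in Ioi (1 / N), Hint C l v := by
    have := integral_comp_mul_left_Ioi (Hint C l) 1 (b := N⁻¹) (by positivity)
    simp only [inv_inv, mul_one, smul_eq_mul] at this
    rw [one_div, ← this]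
    congr 1; ext u; rw [div_eq_inv_mul]
  have hd : (0:ℝ) ≤ 1 / N := by positivity
  have e2 : ∫ v in Ioi (0:ℝ), Hint C l v = (∫ v in Ioc 0 (1 / N), Hint C l v) + ∫ v in Ioi (1 / N), Hint C l v := by
    rw [← Ioc_union_Ioi_eq_Ioi hd, setIntegral_union Ioc_disjoint_Ioi_same measurableSet_Ioi]
    · exact hI.mono_set Ioc_subset_Ioi_self
    · exact hI.mono_set (Ioi_subset_Ioi hd)
  have hrp : IntegrableOn (fun v : ℝ => B * v ^ (-(1/2) : ℝ)) (Ioc 0 (1 / N)) := by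
    have := (intervalIntegral.intervalIntegrable_rpow' (a := 0) (b := 1 / N) (r := -(1/2)) (by norm_num)).const_mul B
    rwa [intervalIntegrable_iff_integrableOn_Ioc_of_le hd] at this
  have e3 : ∫ v in Ioc 0 (1 / N), Hint C l v ≤ ∫ v in Ioc 0 (1 / N), B * v ^ (-(1/2) : ℝ) := by
    apply setIntegral_mono_on (hI.mono_set Ioc_subset_Ioi_self) hrp measurableSet_Ioc
    intro v hv; exact hb v hv.1
  have e4 : ∫ v in Ioc 0 (1 / N), B * v ^ (-(1/2) : ℝ) = 2 * B * (1 / N) ^ (1/2 : ℝ) := by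
    rw [← intervalIntegral.integral_of_le hd, intervalIntegral.integral_const_mul, integral_rpow (by norm_num)]
    norm_num; ring
  have e5 : 0 ≤ ∫ v in Ioc 0 (1 / N), Hint C l v :=
    setIntegral_nonneg measurableSet_Ioc fun v hv => (Hint_pos hC hl hv.1).le
  have e6 : N * (1 / N) ^ (1/2 : ℝ) = N ^ (1/2 : ℝ) := by
    rw [Real.div_rpow zero_le_one hN0.le, Real.one_rpow]
    have h1 : N = N ^ (1/2:ℝ) * N ^ (1/2:ℝ) := by
      rw [← Real.rpow_add hN0]; norm_num
    have h2 : 0 < N ^ (1/2:ℝ) := by positivity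
    field_simp
    linarith
  rw [← hc, e1, e2]
  have e7 : 2 * (N * ∫ v in Ioi (1 / N), Hint C l v) - 2 * ((∫ v in Ioc 0 (1 / N), Hint C l v) + ∫ v in Ioi (1 / N), Hint C l v) * N
    = - (2 * N * ∫ v in Ioc 0 (1 / N), Hint C l v) := by ring
  rw [e7, abs_neg, abs_of_nonneg (by positivity), ← e6]
  rw [e4] at e3
  calc 2 * N * ∫ v in Ioc 0 (1 / N), Hint C l v ≤ 2 * N * (2 * B * (1 / N) ^ (1/2 : ℝ)) := by gcongr
    _ = _ := by ring
end

section
open Complex Set MeasureTheory Filter Topology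

/-- the smoothed sum. -/
noncomputable def HeckeData.S {ι : Type} (H : HeckeData ι) (C : ℕ) (l N : ℝ) : ℝ :=
  ∑' i, H.Lam i * (2 * ∑' j : ℤ, hker C l (H.X i / N) (H.y i + j))

/-- the argument of the Dirichlet series. -/
noncomputable def sarg (l : ℝ) (m : ℤ) (w : ℂ) : ℂ := 2 * w + (Real.pi / l * m : ℝ) * I

noncomputable def HeckeData.J {ι : Type} (H : HeckeData ι) (C : ℕ) (l N : ℝ) (m : ℤ) : ℂ :=
  (1 / (2 * Real.pi * l)) * ∫ τ : ℝ, Kmel C l m ((1:ℝ) + τ * I) *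
    cexp (sarg l m ((1:ℝ) + τ * I) * Real.log N) *
    Dser H.X H.y H.Lam m (sarg l m ((1:ℝ) + τ * I))

namespace HeckeData
variable {ι : Type} (H : HeckeData ι)

lemma J_eq [Countable ι] {C : ℕ} (hC : 0 < C) {l : ℝ} (hl : 0 < l) {N : ℝ} (hN : 0 < N) (m : ℤ) :
    H.J C l N m = ∑' i, (H.Lam i : ℂ) * (2 * (Acoef C l (H.X i / N) m * cexp (2 * Real.pi * I * m * H.y i))) := by
  have hs : ∀ τ : ℝ, (sarg l m ((1:ℝ) + τ * I)).re = 2 := by intro τ; simp [sarg]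
  set F : ι → ℝ → ℂ := fun i τ => Kmel C l m ((1:ℝ) + τ * I) *
    cexp (sarg l m ((1:ℝ) + τ * I) * Real.log N) *
    ((H.Lam i : ℂ) * cexp (2 * Real.pi * I * m * H.y i) * (H.X i : ℂ) ^ (-(sarg l m ((1:ℝ) + τ * I)))) with hF
  have hnF : ∀ i τ, ‖F i τ‖ = ‖Kmel C l m ((1:ℝ) + τ * I)‖ * (N ^ (2:ℝ) * (H.Lam i * H.X i ^ (-2:ℝ))) := by
    intro i τ
    simp only [hF]
    rw [norm_mul, norm_mul, H.norm_term, hs, Complex.norm_exp]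
    have : (sarg l m ((1:ℝ) + τ * I) * (Real.log N : ℂ)).re = Real.log N * 2 := by
      rw [Complex.re_mul_ofReal, hs]; ring
    rw [this, Real.rpow_def_of_pos hN]; ring
  have hK := integrable_Kmel hC hl m (α := 1) (by norm_num) le_rfl
  have hcK := continuous_Kmel_vert hC l m (α := 1) (by norm_num)
  have hFi : ∀ i, Integrable (F i) := by
    intro i
    have hX : (H.X i : ℂ) ≠ 0 := by
      have := H.hX i
      exact_mod_cast (by linarith : (0:ℝ) < H.X i).ne'
    refine Integrable.mono' (hK.norm.mul_const (N ^ (2:ℝ) * (H.Lam i * H.X i ^ (-2:ℝ)))) ?_ (Eventually.of_forall fun τ => (hnF i τ).le)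
    refine Continuous.aestronglyMeasurable ?_
    simp only [hF, sarg]
    refine (hcK.mul (by fun_prop)).mul (Continuous.mul continuous_const ?_)
    refine Continuous.const_cpow (by fun_prop) (Or.inl hX)
  have hFs : Summable fun i => ∫ τ, ‖F i τ‖ := by
    simp_rw [hnF, integral_mul_const]
    exact ((H.hsum 2 (by norm_num)).mul_left _).mul_left _
  have key := integral_tsum_of_summable_integral_norm hFi hFs
  rw [J]
  have e1 : ∀ τ : ℝ, Kmel C l m ((1:ℝ) + τ * I) * cexp (sarg l m ((1:ℝ) + τ * I) * Real.log N) *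
    Dser H.X H.y H.Lam m (sarg l m ((1:ℝ) + τ * I)) = ∑' i, F i τ := by
    intro τ; rw [Dser, ← tsum_mul_left]
  simp_rw [e1]
  rw [← key, ← tsum_mul_left]
  congr 1; ext i
  have hX : 0 < H.X i := by linarith [H.hX i]
  have hX' : (H.X i : ℂ) ≠ 0 := by exact_mod_cast hX.ne'
  rw [Acoef_eq hC hl (div_pos hX hN) m (α := 1) (by norm_num) le_rfl]
  have e2 : ∀ τ : ℝ, F i τ = (H.Lam i : ℂ) * cexp (2 * Real.pi * I * m * H.y i) * (Kmel C l m ((1:ℝ) + τ * I) *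
     cexp (-(2 * ((1:ℝ) + τ * I) + (Real.pi / l * m : ℝ) * I) * Real.log (H.X i / N))) := by
    intro τ
    simp only [hF]
    rw [Complex.cpow_def_of_ne_zero hX', ← Complex.ofReal_log hX.le, Real.log_div hX.ne' hN.ne']
    have : cexp (-(2 * ((1:ℝ) + τ * I) + (Real.pi / l * m : ℝ) * I) * ((Real.log (H.X i) - Real.log N : ℝ):ℂ))
      = cexp (sarg l m ((1:ℝ) + τ * I) * Real.log N) * cexp (Real.log (H.X i) * -(sarg l m ((1:ℝ) + τ * I))) := by
      rw [← Complex.exp_add]; congr 1; simp only [sarg]; push_cast; ring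
    rw [this]; ring
  simp_rw [e2]
  rw [integral_const_mul]
  generalize (∫ τ : ℝ, _ : ℂ) = W
  have : (l : ℂ) ≠ 0 := by exact_mod_cast hl.ne'
  have : (Real.pi : ℂ) ≠ 0 := by exact_mod_cast Real.pi_ne_zero
  field_simp
  ring

lemma S_eq [Countable ι] {C : ℕ} (hC : 0 < C) {l : ℝ} (hl : 0 < l) {N : ℝ} (hN : 0 < N) :
    Summable (fun i => H.Lam i * (2 * ∑' j : ℤ, hker C l (H.X i / N) (H.y i + j))) ∧
    Summable (H.J C l N) ∧ ((H.S C l N : ℝ) : ℂ) = ∑' m : ℤ, H.J C l N m := by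
  obtain ⟨B, κ, hB, hκ, hb⟩ := Acoef_bound hC hl
  set G : ι → ℤ → ℂ := fun i m => (H.Lam i : ℂ) * (2 * (Acoef C l (H.X i / N) m * cexp (2 * Real.pi * I * m * H.y i))) with hG
  have hGb : ∀ i m, ‖G i m‖ ≤ (2 * B * N ^ (2:ℝ) * (H.Lam i * H.X i ^ (-2:ℝ))) * Real.exp (-κ * |(m:ℝ)|) := by
    intro i m
    have hX : 0 < H.X i := by linarith [H.hX i]
    simp only [hG]
    have : (2 * Real.pi * I * m * H.y i : ℂ) = ((2 * Real.pi * m * H.y i : ℝ) : ℂ) * I := by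
      push_cast; ring
    rw [norm_mul, norm_mul, norm_mul, this, Complex.norm_exp_ofReal_mul_I, Complex.norm_real,
      Real.norm_eq_abs, abs_of_nonneg (H.hLam i)]
    have h := hb m (H.X i / N) 1 (div_pos hX hN) (by norm_num) le_rfl
    have e : (H.X i / N) ^ (-(2 * 1) : ℝ) = H.X i ^ (-2:ℝ) * N ^ (2:ℝ) := by
      rw [Real.div_rpow hX.le hN.le, mul_one, Real.rpow_neg hN.le, div_inv_eq_mul]
    rw [e] at h
    have := mul_le_mul_of_nonneg_left h (H.hLam i)
    norm_num
    norm_num at this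
    nlinarith
  have hsum : Summable (Function.uncurry G) := by
    refine Summable.of_norm_bounded (g := fun p : ι × ℤ => (2 * B * N ^ (2:ℝ) * (H.Lam p.1 * H.X p.1 ^ (-2:ℝ))) * Real.exp (-κ * |(p.2:ℝ)|)) ?_ ?_
    · refine Summable.mul_of_nonneg ((H.hsum 2 (by norm_num)).mul_left (2 * B * N ^ (2:ℝ))) (summable_exp_neg_abs_int hκ) ?_ ?_
      · intro i
        have := H.hLam i
        have hX : 0 < H.X i := by linarith [H.hX i]
        simp only [Pi.zero_apply]; positivity
      · intro m; simp only [Pi.zero_apply]; positivity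
    · rintro ⟨i, m⟩; exact hGb i m
  have e1 : ∀ i, (((H.Lam i * (2 * ∑' j : ℤ, hker C l (H.X i / N) (H.y i + j)) : ℝ)) : ℂ) = ∑' m, G i m := by
    intro i
    have hX : 0 < H.X i := by linarith [H.hX i]
    have := poisson_hker hC hl (div_pos hX hN) (H.y i)
    simp only [hG]
    rw [tsum_mul_left, tsum_mul_left, ← this]
    push_cast; ring
  refine ⟨?_, ?_, ?_⟩
  · have := hsum.prod
    rw [← Complex.summable_ofReal]
    refine this.congr fun i => ?_
    rw [e1]; rfl
  · have := hsum.prod_symm.prod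
    refine this.congr fun m => ?_
    rw [H.J_eq hC hl hN]; rfl
  · rw [S, Complex.ofReal_tsum]
    simp_rw [e1]
    rw [← hsum.tsum_comm]
    congr 1; ext m
    rw [H.J_eq hC hl hN]

end HeckeData
end

section
open Complex Set MeasureTheory Filter Topology

namespace HeckeData
variable {ι : Type} (H : HeckeData ι)

/-- the regular part of the integrand. -/
noncomputable def Gint (C : ℕ) (l N : ℝ) (m : ℤ) (w : ℂ) : ℂ :=
  Kmel C l m w * cexp (sarg l m w * Real.log N) * (-(deriv (H.Z m) (sarg l m w) / H.Z m (sarg l m w)))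

lemma sarg_re (l : ℝ) (m : ℤ) (w : ℂ) : (sarg l m w).re = 2 * w.re := by simp [sarg]

lemma norm_cexp_sarg (l : ℝ) (m : ℤ) (w : ℂ) {N : ℝ} (hN : 0 < N) :
    ‖cexp (sarg l m w * Real.log N)‖ = N ^ (2 * w.re) := by
  rw [Complex.norm_exp, Complex.re_mul_ofReal, sarg_re, Real.rpow_def_of_pos hN, mul_comm]

lemma E1_bound (m : ℤ) {s : ℂ} (hs : s.re = 2) :
    ‖deriv (H.Z m) s / H.Z m s‖ ≤ (∑' i, H.Lam i * H.X i ^ (-2:ℝ)) + 1 := by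
  have h := H.D_eq m (s := s) (by linarith) (by linarith)
  have h2 := H.norm_D_le m (s := s) (by linarith)
  rw [hs] at h2
  have : deriv (H.Z m) s / H.Z m s = - Dser H.X H.y H.Lam m s + if m = 0 then 1 / (s - 1) else 0 := by
    rw [h]; ring
  rw [this]
  refine (norm_add_le _ _).trans ?_
  rw [norm_neg]
  refine add_le_add h2 ?_
  split_ifs
  · rw [norm_div, norm_one]
    have h1 : 1 ≤ ‖s - 1‖ := by
      have := Complex.abs_re_le_norm (s - 1)
      have e : (s - 1).re = 1 := by simp [hs]; norm_num
      rw [e] at this; simpa using this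
    rw [div_le_one (by linarith)]; exact h1
  · simp

lemma G_cont_one {C : ℕ} (hC : 0 < C) (l N : ℝ) (m : ℤ) :
    Continuous fun τ : ℝ => H.Gint C l N m ((1:ℝ) + τ * I) := by
  have hcK := continuous_Kmel_vert hC l m (α := 1) (by norm_num)
  have hs : Continuous fun τ : ℝ => sarg l m ((1:ℝ) + τ * I) := by unfold sarg; fun_prop
  have hm : ∀ τ : ℝ, sarg l m ((1:ℝ) + τ * I) ∈ {s : ℂ | 1 / 2 < s.re} := by
    intro τ; rw [mem_ofPred_eq, sarg_re]; norm_num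
  unfold Gint
  refine (hcK.mul (Complex.continuous_exp.comp (hs.mul continuous_const))).mul (Continuous.neg (Continuous.div ?_ ?_ ?_))
  · exact ((H.hZd m).deriv isOpen_U).continuousOn.comp_continuous hs hm
  · exact (H.hZd m).continuousOn.comp_continuous hs hm
  · intro τ
    exact H.Z_ne m (by rw [sarg_re]; norm_num) (by rw [sarg_re]; norm_num)

lemma J_sub {C : ℕ} (hC : 0 < C) {l : ℝ} (hl : 0 < l) {N : ℝ} (hN : 0 < N) (m : ℤ)
    (hG : Integrable fun τ : ℝ => H.Gint C l N m ((1:ℝ) + τ * I)) :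
    H.J C l N m - (if m = 0 then poleTerm C l N else 0) =
      (1 / (2 * Real.pi * l)) * ∫ τ : ℝ, H.Gint C l N m ((1:ℝ) + τ * I) := by
  have e : ∀ τ : ℝ, Kmel C l m ((1:ℝ) + τ * I) *
    cexp (sarg l m ((1:ℝ) + τ * I) * Real.log N) *
    Dser H.X H.y H.Lam m (sarg l m ((1:ℝ) + τ * I)) = H.Gint C l N m ((1:ℝ) + τ * I) +
     Kmel C l m ((1:ℝ) + τ * I) * cexp (sarg l m ((1:ℝ) + τ * I) * Real.log N) *
     (if m = 0 then 1 / (sarg l m ((1:ℝ) + τ * I) - 1) else 0) := by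
    intro τ
    rw [H.D_eq m (by rw [sarg_re]; norm_num) (by rw [sarg_re]; norm_num), Gint]; ring
  rw [J]
  simp_rw [e]
  by_cases hm : m = 0
  · subst hm
    simp only [if_true]
    rw [integral_add hG, mul_add, poleTerm]
    · simp [sarg]
    · have hK := integrable_Kmel hC hl 0 (α := 1) (by norm_num) le_rfl
      have hs : Continuous fun τ : ℝ => sarg l 0 ((1:ℝ) + τ * I) := by unfold sarg; fun_prop
      have hre : ∀ τ : ℝ, (sarg l 0 ((1:ℝ) + τ * I) - 1).re = 1 := by
        intro τ; rw [Complex.sub_re, sarg_re]; norm_num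
      have h1 : ∀ τ : ℝ, 1 ≤ ‖sarg l 0 ((1:ℝ) + τ * I) - 1‖ := by
        intro τ
        have := Complex.abs_re_le_norm (sarg l 0 ((1:ℝ) + τ * I) - 1)
        rw [hre] at this; simpa using this
      have hcK := continuous_Kmel_vert hC l 0 (α := 1) (by norm_num)
      refine Integrable.mono' (hK.norm.mul_const (N ^ (2:ℝ))) ?_ (Eventually.of_forall fun τ => ?_)
      · refine Continuous.aestronglyMeasurable ?_
        refine (hcK.mul (Complex.continuous_exp.comp (hs.mul continuous_const))).mul (Continuous.div continuous_const (hs.sub continuous_const) ?_)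
        intro τ h0
        have := h1 τ
        rw [h0, norm_zero] at this; linarith
      · rw [norm_mul, norm_mul, norm_cexp_sarg _ _ _ hN, norm_div, norm_one]
        have e2 : 2 * ((1:ℝ) + τ * I : ℂ).re = 2 := by simp
        rw [e2]
        refine mul_le_of_le_one_right (by positivity) ?_
        rw [div_le_one (by linarith [h1 τ])]; exact h1 τ
  · simp [hm]

lemma integral_exp_neg_abs_le {κ : ℝ} (hκ : 0 < κ) : ∫ x : ℝ, Real.exp (-κ * |x|) = 2 / κ := by
  have h := integral_comp_abs (f := fun x => Real.exp (-κ * x))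
  rw [h, integral_exp_mul_Ioi (by linarith : -κ < 0)]
  simp; field_simp

/-- trivial bound. -/
lemma G_one_bound {C : ℕ} {l : ℝ} {N : ℝ} (hN : 0 < N) (m : ℤ) {B κ E : ℝ}
    (hb : ∀ (m : ℤ) (w : ℂ), 1 / 4 ≤ w.re → w.re ≤ 1 →
      ‖Kmel C l m w‖ ≤ B * Real.exp (-κ * |w.im|) * Real.exp (-κ * |(m:ℝ)|))
    (hE : ∀ (m : ℤ) (s : ℂ), s.re = 2 → ‖deriv (H.Z m) s / H.Z m s‖ ≤ E) (τ : ℝ) (hB : 0 < B) :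
    ‖H.Gint C l N m ((1:ℝ) + τ * I)‖ ≤ (B * Real.exp (-κ * |(m:ℝ)|) * N ^ (2:ℝ) * E) * Real.exp (-κ * |τ|) := by
  have h1 := hb m ((1:ℝ) + τ * I) (by simp; norm_num) (by simp)
  have h2 := hE m (sarg l m ((1:ℝ) + τ * I)) (by rw [sarg_re]; simp)
  have e2 : 2 * ((1:ℝ) + τ * I : ℂ).re = 2 := by simp
  have e3 : ((1:ℝ) + τ * I : ℂ).im = τ := by simp
  rw [e3] at h1
  rw [Gint, norm_mul, norm_mul, norm_cexp_sarg _ _ _ hN, e2, norm_neg]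
  calc _ ≤ (B * Real.exp (-κ * |τ|) * Real.exp (-κ * |(m:ℝ)|)) * N ^ (2:ℝ) * E := by gcongr
    _ = _ := by ring

lemma G_int {C : ℕ} (hC : 0 < C) {l : ℝ} {N : ℝ} (hN : 0 < N) (m : ℤ) {B κ E : ℝ} (hκ : 0 < κ)
    (hb : ∀ (m : ℤ) (w : ℂ), 1 / 4 ≤ w.re → w.re ≤ 1 →
      ‖Kmel C l m w‖ ≤ B * Real.exp (-κ * |w.im|) * Real.exp (-κ * |(m:ℝ)|))
    (hE : ∀ (m : ℤ) (s : ℂ), s.re = 2 → ‖deriv (H.Z m) s / H.Z m s‖ ≤ E) (hB : 0 < B) :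
    Integrable (fun τ : ℝ => H.Gint C l N m ((1:ℝ) + τ * I)) :=
  Integrable.mono' ((integrable_exp_neg_abs hκ).const_mul _) (H.G_cont_one hC l N m).aestronglyMeasurable
    (Eventually.of_forall fun τ => H.G_one_bound hN m hb hE τ hB)

lemma G_triv {C : ℕ} {l : ℝ} {N : ℝ} (hN : 0 < N) (m : ℤ) {B κ E : ℝ} (hκ : 0 < κ)
    (hb : ∀ (m : ℤ) (w : ℂ), 1 / 4 ≤ w.re → w.re ≤ 1 →
      ‖Kmel C l m w‖ ≤ B * Real.exp (-κ * |w.im|) * Real.exp (-κ * |(m:ℝ)|))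
    (hE : ∀ (m : ℤ) (s : ℂ), s.re = 2 → ‖deriv (H.Z m) s / H.Z m s‖ ≤ E) (hB : 0 < B) :
    ‖∫ τ : ℝ, H.Gint C l N m ((1:ℝ) + τ * I)‖ ≤ (B * Real.exp (-κ * |(m:ℝ)|) * N ^ (2:ℝ) * E) * (2 / κ) := by
  refine (norm_integral_le_of_norm_le ((integrable_exp_neg_abs hκ).const_mul _)
    (Eventually.of_forall fun τ => H.G_one_bound hN m hb hE τ hB)).trans ?_
  rw [integral_const_mul, integral_exp_neg_abs_le hκ]

lemma G_tail {C : ℕ} (hC : 0 < C) {l : ℝ} {N : ℝ} (hN : 0 < N) (m : ℤ) {B κ E T : ℝ} (hκ : 0 < κ) (hT : 0 < T)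
    (hb : ∀ (m : ℤ) (w : ℂ), 1 / 4 ≤ w.re → w.re ≤ 1 →
      ‖Kmel C l m w‖ ≤ B * Real.exp (-κ * |w.im|) * Real.exp (-κ * |(m:ℝ)|))
    (hE : ∀ (m : ℤ) (s : ℂ), s.re = 2 → ‖deriv (H.Z m) s / H.Z m s‖ ≤ E) (hB : 0 < B) (hE0 : 0 ≤ E) :
    ‖(∫ τ : ℝ, H.Gint C l N m ((1:ℝ) + τ * I)) - ∫ τ in (-T)..T, H.Gint C l N m ((1:ℝ) + τ * I)‖ ≤
      (B * Real.exp (-κ * |(m:ℝ)|) * N ^ (2:ℝ) * E) * Real.exp (-(κ * T / 2)) * (4 / κ) := by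
  have hI := H.G_int hC (l := l) hN m hκ hb hE hB
  rw [intervalIntegral.integral_of_le (by linarith), ← integral_add_compl measurableSet_Ioc hI, add_sub_cancel_left]
  have hI2 := (integrable_exp_neg_abs (half_pos hκ)).const_mul ((B * Real.exp (-κ * |(m:ℝ)|) * N ^ (2:ℝ) * E) * Real.exp (-(κ * T / 2)))
  have hnn : 0 ≤ B * Real.exp (-κ * |(m:ℝ)|) * N ^ (2:ℝ) * E := by positivity
  refine (norm_integral_le_of_norm_le hI2.integrableOn ?_).trans ?_
  · refine (ae_restrict_iff' measurableSet_Ioc.compl).mpr (Eventually.of_forall fun τ hτ => ?_)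
    refine (H.G_one_bound hN m hb hE τ hB).trans ?_
    rw [mul_assoc (_ * E)]
    refine mul_le_mul_of_nonneg_left ?_ hnn
    rw [← Real.exp_add]
    apply Real.exp_le_exp.mpr
    have : T ≤ |τ| := by
      by_contra hlt
      push Not at hlt
      rw [abs_lt] at hlt
      exact hτ ⟨hlt.1, hlt.2.le⟩
    nlinarith
  · refine (setIntegral_le_integral hI2 (Eventually.of_forall fun τ => by simp only [Pi.zero_apply]; positivity)).trans ?_
    rw [integral_const_mul, integral_exp_neg_abs_le (half_pos hκ)]
    apply le_of_eq; congr 1; field_simp; norm_num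

end HeckeData
end

section
open Complex Set MeasureTheory Filter Topology

namespace HeckeData
variable {ι : Type} (H : HeckeData ι)

lemma Kmel_diff {C : ℕ} (hC : 0 < C) (l : ℝ) (m : ℤ) {w : ℂ} (hw : 0 < w.re) :
    DifferentiableAt ℂ (Kmel C l m) w := by
  unfold Kmel
  refine (Mphi_differentiableAt hC hw).mul ?_
  have h2 : DifferentiableAt ℂ (Mphi C) (w + (Real.pi / l * m : ℝ) * I) :=
    Mphi_differentiableAt hC (by simpa using hw)
  exact DifferentiableAt.comp (g := Mphi C) (f := fun w : ℂ => w + (Real.pi / l * m : ℝ) * I) w h2 (by fun_prop)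

lemma G_mid {C : ℕ} (hC : 0 < C) {l : ℝ} (hl : 0 < l) {N : ℝ} (hN : 1 ≤ N) (m : ℤ) {B κ T a W P : ℝ}
    (hκ : 0 < κ) (hT : 0 < T) (hB : 0 < B) (ha : 1 / 4 < a) (ha1 : a ≤ 1) (hP : 0 ≤ P)
    (hb : ∀ (m : ℤ) (w : ℂ), 1 / 4 ≤ w.re → w.re ≤ 1 →
      ‖Kmel C l m w‖ ≤ B * Real.exp (-κ * |w.im|) * Real.exp (-κ * |(m:ℝ)|))
    (hm : |(m:ℝ)| ≤ T) (hW : W = (2 + Real.pi / l) * T)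
    (hZ : ∀ s : ℂ, |s.im| ≤ W → 2 * a ≤ s.re → s.re ≤ 3 → H.Z m s ≠ 0 ∧ ‖deriv (H.Z m) s / H.Z m s‖ ≤ P) :
    ‖∫ τ in (-T)..T, H.Gint C l N m ((1:ℝ) + τ * I)‖ ≤
      B * Real.exp (-κ * |(m:ℝ)|) * P * (2 * (N ^ (2:ℝ) * Real.exp (-(κ * T))) + N ^ (2 * a) * (2 * T)) := by
  have hN0 : 0 < N := by linarith
  have him : ∀ w : ℂ, |w.im| ≤ T → |(sarg l m w).im| ≤ W := by
    intro w hw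
    have e : (sarg l m w).im = 2 * w.im + Real.pi / l * m := by simp [sarg]
    rw [e, hW]
    refine (abs_add_le _ _).trans ?_
    rw [abs_mul, abs_mul, abs_two, abs_of_pos (div_pos Real.pi_pos hl)]
    have : 0 < Real.pi / l := div_pos Real.pi_pos hl
    nlinarith
  have hd : DifferentiableOn ℂ (H.Gint C l N m) (Set.uIcc a 1 ×ℂ Set.uIcc (-T) T) := by
    intro w hw
    rw [Set.uIcc_of_le ha1, Set.uIcc_of_le (by linarith)] at hw
    obtain ⟨hw1, hw2⟩ := hw
    simp only [mem_preimage, mem_Icc] at hw1 hw2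
    have hz := hZ (sarg l m w) (him w (abs_le.mpr hw2)) (by rw [sarg_re]; linarith) (by rw [sarg_re]; linarith)
    have hmem : {s : ℂ | 1 / 2 < s.re} ∈ 𝓝 (sarg l m w) := isOpen_U.mem_nhds (by rw [mem_ofPred_eq, sarg_re]; linarith)
    have hsd : DifferentiableAt ℂ (sarg l m) w := by unfold sarg; fun_prop
    have h1 := ((H.hZd m).differentiableAt hmem)
    have h2 := (((H.hZd m).deriv isOpen_U).differentiableAt hmem)
    refine DifferentiableAt.differentiableWithinAt ?_
    unfold Gint
    refine ((Kmel_diff hC l m (by linarith)).mul ((hsd.mul (by fun_prop)).cexp)).mul (((h2.comp w hsd).div (h1.comp w hsd) hz.1).neg)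
  have hbd : ∀ w : ℂ, a ≤ w.re → w.re ≤ 1 → |w.im| ≤ T → ‖H.Gint C l N m w‖ ≤
      B * Real.exp (-κ * |w.im|) * Real.exp (-κ * |(m:ℝ)|) * N ^ (2 * w.re) * P := by
    intro w h1 h2 h3
    have hz := (hZ (sarg l m w) (him w h3) (by rw [sarg_re]; linarith) (by rw [sarg_re]; linarith)).2
    have hk := hb m w (by linarith) h2
    rw [Gint, norm_mul, norm_mul, norm_cexp_sarg _ _ _ hN0, norm_neg]
    gcongr
  have key := Complex.integral_boundary_rect_eq_zero_of_differentiableOn (H.Gint C l N m) ((a:ℂ) + (-T:ℝ) * I) ((1:ℝ) + (T:ℝ) * I)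
    (by simpa using hd)
  simp only [add_re, ofReal_re, mul_re, I_re, mul_zero, ofReal_im, I_im, mul_one, sub_self, add_zero,
    add_im, mul_im, zero_add] at key
  have hhor : ∀ t : ℝ, |t| = T → ‖∫ x in a..1, H.Gint C l N m (x + t * I)‖ ≤
      B * Real.exp (-κ * |(m:ℝ)|) * P * (N ^ (2:ℝ) * Real.exp (-(κ * T))) := by
    intro t ht
    refine (intervalIntegral.norm_integral_le_of_norm_le_const (C := B * Real.exp (-κ * |(m:ℝ)|) * P * (N ^ (2:ℝ) * Real.exp (-(κ * T)))) ?_).trans ?_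
    · intro x hx
      rw [Set.uIoc_of_le ha1] at hx
      have h := hbd (x + t * I) (by simpa using hx.1.le) (by simpa using hx.2) (by simp [ht])
      have e1 : (x + t * I : ℂ).im = t := by simp
      have e2 : (x + t * I : ℂ).re = x := by simp
      rw [e1, e2, ht] at h
      refine h.trans ?_
      have : N ^ (2 * x) ≤ N ^ (2:ℝ) := Real.rpow_le_rpow_of_exponent_le hN (by linarith [hx.2])
      calc _ ≤ B * Real.exp (-κ * T) * Real.exp (-κ * |(m:ℝ)|) * N ^ (2:ℝ) * P := by gcongr
        _ = _ := by rw [neg_mul κ T]; ring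
    · refine mul_le_of_le_one_right (by positivity) ?_
      rw [abs_of_nonneg (by linarith)]; linarith
  have hver : ‖∫ τ in (-T)..T, H.Gint C l N m (a + τ * I)‖ ≤
      B * Real.exp (-κ * |(m:ℝ)|) * P * (N ^ (2 * a) * (2 * T)) := by
    refine (intervalIntegral.norm_integral_le_of_norm_le_const (C := B * Real.exp (-κ * |(m:ℝ)|) * P * N ^ (2 * a)) ?_).trans ?_
    · intro x hx
      rw [Set.uIoc_of_le (by linarith)] at hx
      have h := hbd (a + x * I) (by simp) (by simpa using ha1) (by simpa using abs_le.mpr ⟨hx.1.le, hx.2⟩)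
      have e1 : (a + x * I : ℂ).im = x := by simp
      have e2 : (a + x * I : ℂ).re = a := by simp
      rw [e1, e2] at h
      refine h.trans ?_
      have : Real.exp (-κ * |x|) ≤ 1 := by
        rw [Real.exp_le_one_iff]; have := abs_nonneg x; nlinarith
      calc _ ≤ B * 1 * Real.exp (-κ * |(m:ℝ)|) * N ^ (2 * a) * P := by gcongr
        _ = _ := by ring
    · rw [abs_of_nonneg (by linarith : 0 ≤ T - -T)]
      apply le_of_eq; ring
  have h1 := hhor (-T) (by rw [abs_neg, abs_of_pos hT])
  have h2 := hhor T (abs_of_pos hT)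
  set A1 := ∫ x in a..1, H.Gint C l N m (x + (-T : ℝ) * I)
  set A2 := ∫ x in a..1, H.Gint C l N m (x + T * I)
  set A3 := ∫ τ in (-T)..T, H.Gint C l N m ((1:ℝ) + τ * I)
  set A4 := ∫ τ in (-T)..T, H.Gint C l N m (a + τ * I)
  have e : A3 = A4 + I * (A1 - A2) := by
    simp only [smul_eq_mul] at key
    have h : A1 - A2 + I * A3 - I * A4 = 0 := key
    linear_combination (-I) * h + (A3 - A4) * I_mul_I
  rw [e]
  refine (norm_add_le _ _).trans ?_
  have := norm_sub_le A1 A2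
  rw [norm_mul, norm_I, one_mul]
  linarith

end HeckeData
end

section
open Complex Set MeasureTheory Filter Topology

set_option maxHeartbeats 1000000
namespace HeckeData
variable {ι : Type} (H : HeckeData ι)

lemma J_bound {C : ℕ} (hC : 0 < C) {l : ℝ} (hl : 0 < l) :
    ∃ Q κ c T0 : ℝ, 0 < Q ∧ 0 < κ ∧ 0 < c ∧ c ≤ 1 / 8 ∧ Real.exp 1 ≤ T0 ∧ ∀ N T W : ℝ, 1 ≤ N → 0 < T →
      W = (2 + Real.pi / l) * T → T0 ≤ W → ∀ m : ℤ,
      ‖H.J C l N m - (if m = 0 then poleTerm C l N else 0)‖ ≤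
        Q * W ^ 3 * (N ^ (2:ℝ) * Real.exp (-(κ * T / 2)) + N ^ (1 - c / Real.log W)) * Real.exp (-(κ/2) * |(m:ℝ)|) := by
  obtain ⟨B, κ, hB, hκ, -, hb⟩ := Kmel_bound hC hl
  obtain ⟨c, C1, T0, hc, hc8, hC1, hT0, hZ⟩ := H.logDeriv_bound
  set E : ℝ := (∑' i, H.Lam i * H.X i ^ (-2:ℝ)) + 1 with hE
  have hE0 : 0 < E := by
    have : 0 ≤ ∑' i, H.Lam i * H.X i ^ (-2:ℝ) := tsum_nonneg fun i =>
      mul_nonneg (H.hLam i) (Real.rpow_nonneg (by linarith [H.hX i]) _)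
    linarith
  have hEb : ∀ (m : ℤ) (s : ℂ), s.re = 2 → ‖deriv (H.Z m) s / H.Z m s‖ ≤ E := fun m s hs => H.E1_bound m hs
  have hpi : 0 < Real.pi / l := div_pos Real.pi_pos hl
  refine ⟨(1 / (2 * Real.pi * l)) * (B * (4 * E / κ + 2 * C1)), κ, c, T0, ?_, hκ, hc, hc8, hT0, ?_⟩
  · have := Real.pi_pos; positivity
  intro N T W hN hT hW hTW m
  have hN0 : 0 < N := by linarith
  rw [H.J_sub hC hl hN0 m (H.G_int hC hN0 m hκ hb hEb hB), norm_mul]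
  have e1 : ‖(1 / (2 * Real.pi * l) : ℂ)‖ = 1 / (2 * Real.pi * l) := by
    have : (1 / (2 * Real.pi * l) : ℂ) = ((1 / (2 * Real.pi * l) : ℝ) : ℂ) := by push_cast; rfl
    rw [this, Complex.norm_real, Real.norm_eq_abs, abs_of_pos]; have := Real.pi_pos; positivity
  have hW1 : 1 ≤ W := by have := Real.add_one_le_exp 1; linarith
  have hlog : 1 ≤ Real.log W := by
    rw [Real.le_log_iff_exp_le (by linarith)]; linarith
  set Y := N ^ (2:ℝ) * Real.exp (-(κ * T / 2)) with hY
  set V := N ^ (1 - c / Real.log W) with hV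
  have hY0 : 0 ≤ Y := by positivity
  have hV0 : 0 ≤ V := by positivity
  have hW2 : 0 ≤ W ^ 2 := by positivity
  have hW3 : W ^ 2 ≤ W ^ 3 := pow_le_pow_right₀ hW1 (by norm_num)
  have hW31 : 1 ≤ W ^ 3 := one_le_pow₀ hW1
  have hem : Real.exp (-κ * |(m:ℝ)|) ≤ Real.exp (-(κ/2) * |(m:ℝ)|) := by
    apply Real.exp_le_exp.mpr
    have := abs_nonneg (m:ℝ); nlinarith
  suffices h : ‖∫ τ : ℝ, H.Gint C l N m ((1:ℝ) + τ * I)‖ ≤ B * (4 * E / κ + 2 * C1) * W ^ 3 * (Y + V) * Real.exp (-(κ/2) * |(m:ℝ)|) by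
    rw [e1]
    refine (mul_le_mul_of_nonneg_left h (by have := Real.pi_pos; positivity)).trans (le_of_eq (by ring))
  by_cases hm : |(m:ℝ)| ≤ T
  · have ht := H.G_tail hC (l := l) hN0 m hκ hT hb hEb hB hE0.le
    have hcl : c / Real.log W ≤ 1 / 8 := by
      rw [div_le_iff₀ (by linarith)]; nlinarith
    have hcl0 : 0 < c / Real.log W := by positivity
    have hmW : |(m:ℝ)| ≤ W := by rw [hW]; nlinarith
    have h2 := H.G_mid hC hl hN m (W := W) (a := 1 / 2 - c / Real.log W / 2) (P := C1 * W ^ 2) hκ hT hB (by linarith) (by linarith) (by positivity) hb hm hW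
      (fun s h1 h2 h3 => hZ W hTW m hmW s h1 (by linarith) h3)
    have e2 : 2 * (1 / 2 - c / Real.log W / 2) = 1 - c / Real.log W := by ring
    rw [e2, ← hV] at h2
    have e3 : N ^ (2:ℝ) * Real.exp (-(κ * T)) ≤ Y := by
      rw [hY]; gcongr; nlinarith
    have e4 : 2 * T ≤ W := by rw [hW]; nlinarith
    have h3 : ‖∫ τ : ℝ, H.Gint C l N m ((1:ℝ) + τ * I)‖ ≤
       (B * Real.exp (-κ * |(m:ℝ)|) * N ^ (2:ℝ) * E) * Real.exp (-(κ * T / 2)) * (4 / κ) +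
       B * Real.exp (-κ * |(m:ℝ)|) * (C1 * W ^ 2) * (2 * (N ^ (2:ℝ) * Real.exp (-(κ * T))) + V * (2 * T)) := by
      have := norm_sub_norm_le (∫ τ : ℝ, H.Gint C l N m ((1:ℝ) + τ * I)) (∫ τ in (-T)..T, H.Gint C l N m ((1:ℝ) + τ * I))
      linarith
    refine h3.trans ?_
    calc _ = Real.exp (-κ * |(m:ℝ)|) * (B * ((4 * E / κ) * Y + (C1 * W ^ 2) * (2 * (N ^ (2:ℝ) * Real.exp (-(κ * T))) + V * (2 * T)))) := by
          rw [hY]; ring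
      _ ≤ Real.exp (-κ * |(m:ℝ)|) * (B * ((4 * E / κ) * (W ^ 3 * (Y + V)) + 2 * C1 * (W ^ 3 * (Y + V)))) := by
          have i1 : Y ≤ W ^ 3 * (Y + V) :=
            (le_add_of_nonneg_right hV0).trans (le_mul_of_one_le_left (by linarith) hW31)
          have i2 : (C1 * W ^ 2) * (2 * (N ^ (2:ℝ) * Real.exp (-(κ * T))) + V * (2 * T)) ≤ 2 * C1 * (W ^ 3 * (Y + V)) := by
            have j1 : N ^ (2:ℝ) * Real.exp (-(κ * T)) ≤ Y * W := e3.trans (le_mul_of_one_le_right hY0 hW1)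
            have j2 : V * (2 * T) ≤ 2 * (V * W) := by
              have := mul_le_mul_of_nonneg_left e4 hV0
              have := mul_nonneg hV0 (by linarith : 0 ≤ W)
              linarith
            calc _ ≤ (C1 * W ^ 2) * (2 * (Y * W) + 2 * (V * W)) :=
                  mul_le_mul_of_nonneg_left (by linarith) (by positivity)
              _ = _ := by ring
          gcongr
      _ ≤ Real.exp (-(κ/2) * |(m:ℝ)|) * (B * ((4 * E / κ) * (W ^ 3 * (Y + V)) + 2 * C1 * (W ^ 3 * (Y + V)))) := by
          gcongr
      _ = _ := by ring
  · push Not at hm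
    refine (H.G_triv hN0 m hκ hb hEb hB).trans ?_
    have i1 : Y ≤ W ^ 3 * (Y + V) :=
            (le_add_of_nonneg_right hV0).trans (le_mul_of_one_le_left (by linarith) hW31)
    have e3 : Real.exp (-κ * |(m:ℝ)|) ≤ Real.exp (-(κ * T / 2)) * Real.exp (-(κ/2) * |(m:ℝ)|) := by
      rw [← Real.exp_add]; apply Real.exp_le_exp.mpr; nlinarith
    calc _ ≤ (B * (Real.exp (-(κ * T / 2)) * Real.exp (-(κ/2) * |(m:ℝ)|)) * N ^ (2:ℝ) * E) * (2 / κ) := by gcongr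
      _ = B * (2 * E / κ) * Y * Real.exp (-(κ/2) * |(m:ℝ)|) := by rw [hY]; ring
      _ ≤ B * (4 * E / κ + 2 * C1) * (W ^ 3 * (Y + V)) * Real.exp (-(κ/2) * |(m:ℝ)|) := by
          have : 2 * E / κ ≤ 4 * E / κ + 2 * C1 := by
            have : 2 * E / κ ≤ 4 * E / κ := by gcongr; norm_num
            linarith
          gcongr
      _ = _ := by ring

theorem asymptotic [Countable ι] {C : ℕ} (hC : 0 < C) {l : ℝ} (hl : 0 < l) :
    ∃ ε₀ : ℝ, 0 < ε₀ ∧ ∃ M : ℝ, ∃ N₀ : ℝ, ∀ N : ℝ, N₀ ≤ N →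
      |H.S C l N - sieveConst C (Real.exp l) * N| ≤ M * N ^ (1 - ε₀ / Real.log (Real.log N)) := by
  obtain ⟨Q, κ, c, T0, hQ, hκ, hc, hc8, hT0, hJ⟩ := H.J_bound hC hl
  obtain ⟨B2, hB2, hpole⟩ := poleTerm_asymp hC hl
  set Sg : ℝ := ∑' m : ℤ, Real.exp (-(κ/2) * |(m:ℝ)|) with hSg
  have hsm := summable_exp_neg_abs_int (half_pos hκ)
  have hSgn : 0 ≤ Sg := tsum_nonneg fun m => by positivity
  have hpi : 0 < Real.pi / l := div_pos Real.pi_pos hl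
  set b : ℝ := (2 + Real.pi / l) * (4 / κ) with hb
  have hb0 : 0 < b := by positivity
  have hev : ∀ᶠ u : ℝ in atTop, 24 * (Real.log u) ^ 2 ≤ c * u ∧ 1 ≤ Real.log u ∧ T0 ≤ b * u ∧ b ≤ u := by
    have h1 : (fun u : ℝ => Real.log u ^ 2) =o[atTop] (fun u => u) := Real.isLittleO_pow_log_id_atTop
    have h1' := h1.bound (c := c / 24) (by positivity)
    filter_upwards [h1', Real.tendsto_log_atTop.eventually_ge_atTop 1, eventually_ge_atTop (T0 / b), eventually_ge_atTop b, eventually_ge_atTop 0] with u h1 h2 h3 h4 h5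
    refine ⟨?_, h2, ?_, h4⟩
    · rw [Real.norm_eq_abs, Real.norm_eq_abs, abs_of_nonneg (by positivity), abs_of_nonneg h5] at h1
      linarith
    · rw [div_le_iff₀ hb0] at h3; linarith
  have hev2 := Real.tendsto_log_atTop.eventually hev
  obtain ⟨N₀, hN₀⟩ := eventually_atTop.mp hev2
  refine ⟨c / 4, by positivity, 2 * Q * Sg + B2, max N₀ 1, fun N hN => ?_⟩
  obtain ⟨h24, hLL, hT0b, hbL⟩ := hN₀ N ((le_max_left _ _).trans hN)
  have hN1 : 1 ≤ N := (le_max_right _ _).trans hN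
  have hN0 : 0 < N := by linarith
  set L := Real.log N with hL
  set LL := Real.log L with hLLd
  have hL0 : 0 < L := by
    by_contra h
    have h0 : 0 ≤ L := Real.log_nonneg hN1
    have : L = 0 := le_antisymm (not_lt.mp h) h0
    rw [hLLd, this, Real.log_zero] at hLL; linarith
  have hT : 0 < 4 / κ * L := by positivity
  set W := b * L with hW
  have hWT : W = (2 + Real.pi / l) * (4 / κ * L) := by rw [hW, hb]; ring
  have hW1 : 1 ≤ W := by have := Real.add_one_le_exp 1; linarith
  have hlogW1 : 1 ≤ Real.log W := by
    rw [Real.le_log_iff_exp_le (by linarith)]; linarith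
  have hlogW : Real.log W ≤ 2 * LL := by
    have : Real.log (L ^ 2) = 2 * LL := by rw [Real.log_pow]; push_cast; rfl
    rw [← this]
    apply Real.log_le_log (by linarith)
    rw [hW]; nlinarith
  set R := N ^ (1 - c / (2 * LL)) with hR
  have hcLL : c / (2 * LL) ≤ 1 / 2 := by
    rw [div_le_iff₀ (by linarith)]; nlinarith
  have hR1 : N ^ (1/2 : ℝ) ≤ R := Real.rpow_le_rpow_of_exponent_le hN1 (by linarith)
  have hR2 : 1 ≤ R := Real.one_le_rpow hN1 (by linarith)
  have hV : N ^ (1 - c / Real.log W) ≤ R := by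
    apply Real.rpow_le_rpow_of_exponent_le hN1
    have : c / (2 * LL) ≤ c / Real.log W := by gcongr
    linarith
  have hY : N ^ (2:ℝ) * Real.exp (-(κ * (4 / κ * L) / 2)) = 1 := by
    rw [Real.rpow_def_of_pos hN0, ← Real.exp_add, ← hL]
    have : L * 2 + -(κ * (4 / κ * L) / 2) = 0 := by field_simp; ring
    rw [this, Real.exp_zero]
  obtain ⟨-, hsJ, hSeq⟩ := H.S_eq hC hl hN0
  have hJb := hJ N (4 / κ * L) W hN1 hT hWT hT0b
  rw [hY] at hJb
  have hmain : ‖((H.S C l N : ℝ) : ℂ) - poleTerm C l N‖ ≤ Q * W ^ 3 * (1 + N ^ (1 - c / Real.log W)) * Sg := by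
    have hs2 : HasSum (fun m : ℤ => if m = 0 then poleTerm C l N else 0) (poleTerm C l N) := hasSum_ite_eq 0 _
    have hs3 := hsJ.hasSum.sub hs2
    rw [← hSeq] at hs3
    rw [← hs3.tsum_eq, hSg, ← tsum_mul_left]
    exact tsum_of_norm_bounded (hsm.mul_left _).hasSum hJb
  have hfin : |H.S C l N - sieveConst C (Real.exp l) * N| ≤ Q * W ^ 3 * (1 + N ^ (1 - c / Real.log W)) * Sg + B2 * N ^ (1/2:ℝ) := by
    rw [← Real.norm_eq_abs, ← Complex.norm_real]
    have e : ((H.S C l N - sieveConst C (Real.exp l) * N : ℝ) : ℂ) = (((H.S C l N : ℝ) : ℂ) - poleTerm C l N) +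
      (poleTerm C l N - ((sieveConst C (Real.exp l) * N : ℝ) : ℂ)) := by push_cast; ring
    rw [e]
    exact (norm_add_le _ _).trans (add_le_add hmain (hpole N hN1))
  have hW6 : W ^ 3 ≤ N ^ (c / (4 * LL)) := by
    have i1 : W ≤ L ^ 2 := by rw [hW]; nlinarith
    have i2 : L ^ 2 = Real.exp (2 * LL) := by
      rw [two_mul, Real.exp_add, hLLd, Real.exp_log hL0]; ring
    calc W ^ 3 ≤ (Real.exp (2 * LL)) ^ 3 := by rw [← i2]; gcongr
      _ = Real.exp (6 * LL) := by rw [← Real.exp_nat_mul]; congr 1; push_cast; ring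
      _ ≤ _ := by
        rw [Real.rpow_def_of_pos hN0, ← hL]
        apply Real.exp_le_exp.mpr
        rw [mul_div_assoc', le_div_iff₀ (by linarith)]
        nlinarith
  have hone : 1 ≤ N ^ (c / (4 * LL)) := (one_le_pow₀ hW1).trans hW6
  have hcomb : N ^ (c / (4 * LL)) * R = N ^ (1 - c / 4 / LL) := by
    rw [hR, ← Real.rpow_add hN0]; congr 1; field_simp; ring
  refine hfin.trans ?_
  rw [← hcomb]
  calc _ ≤ Q * N ^ (c / (4 * LL)) * (R + R) * Sg + B2 * (N ^ (c / (4 * LL)) * R) := by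
        gcongr
        nlinarith
    _ = _ := by ring

end HeckeData
end

section
open Complex Set Filter Topology

/-- the tent function. -/
noncomputable def tent (x : ℝ) : ℝ := max 0 (1 - |x|)

lemma tent_nonneg (x : ℝ) : 0 ≤ tent x := le_max_left _ _
lemma tent_le_one (x : ℝ) : tent x ≤ 1 := max_le (by norm_num) (by linarith [abs_nonneg x])
lemma tent_eq_zero {x : ℝ} (h : 1 ≤ |x|) : tent x = 0 := max_eq_left (by linarith)
lemma tent_lip (x y : ℝ) : |tent x - tent y| ≤ |x - y| := by
  unfold tent
  refine (abs_max_sub_max_le_max 0 (1 - |x|) 0 (1 - |y|)).trans ?_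
  rw [sub_self, abs_zero]
  apply max_le (abs_nonneg _)
  have : 1 - |x| - (1 - |y|) = -(|x| - |y|) := by ring
  rw [this, abs_neg]
  exact abs_abs_sub_abs_le x y

lemma hasSum_tent (y : ℝ) : HasSum (fun j : ℤ => tent (y + j)) 1 := by
  have h := hasSum_sum_of_ne_finset_zero (L := .unconditional ℤ) (f := fun j : ℤ => tent (y + j)) (s := {-⌊y⌋, -⌊y⌋ - 1}) ?_
  · convert h using 1
    rw [Finset.sum_pair (by omega)]
    push_cast
    have h0 := Int.fract_nonneg y
    have h1 := Int.fract_lt_one y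
    have e : y - ⌊y⌋ = Int.fract y := rfl
    have e1 : y + -(⌊y⌋:ℝ) = Int.fract y := by rw [← e]; ring
    have e2 : y + (-(⌊y⌋:ℝ) - 1) = Int.fract y - 1 := by rw [← e]; ring
    rw [e1, e2, tent, tent, abs_of_nonneg h0, abs_of_neg (by linarith), max_eq_right (by linarith), max_eq_right (by linarith)]
    ring
  · intro j hj
    simp only [Finset.mem_insert, Finset.mem_singleton, not_or] at hj
    apply tent_eq_zero
    have h0 := Int.floor_le y
    have h1 := Int.lt_floor_add_one y
    rcases lt_or_ge j (-⌊y⌋ - 1) with h | h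
    · have : (j:ℝ) ≤ -⌊y⌋ - 2 := by
        have : j ≤ -⌊y⌋ - 2 := by omega
        exact_mod_cast this
      rw [abs_of_neg (by linarith)]; linarith
    · have : (-⌊y⌋ + 1 : ℝ) ≤ j := by
        have : -⌊y⌋ + 1 ≤ j := by omega
        exact_mod_cast this
      rw [abs_of_nonneg (by linarith)]; linarith

/-- the kernel in logarithmic coordinates. -/
noncomputable def Fker (l : ℝ) (m : ℤ) (s : ℂ) (a b : ℝ) : ℂ :=
  (tent ((a - b) / (2 * l)) : ℂ) * cexp ((2 * Real.pi * m * ((a - b) / (2 * l)) : ℝ) * I - s * ((a + b : ℝ) : ℂ))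

lemma Fker_exp_norm (l : ℝ) (m : ℤ) (s : ℂ) (a b : ℝ) :
    ‖cexp ((2 * Real.pi * m * ((a - b) / (2 * l)) : ℝ) * I - s * ((a + b : ℝ) : ℂ))‖ = Real.exp (-(s.re * (a + b))) := by
  rw [Complex.norm_exp]
  congr 1
  rw [Complex.sub_re, Complex.re_mul_ofReal, Complex.re_ofReal_mul]; simp

lemma Fker_norm_le (l : ℝ) (m : ℤ) (s : ℂ) (a b : ℝ) :
    ‖Fker l m s a b‖ ≤ Real.exp (-(s.re * (a + b))) := by
  rw [Fker, norm_mul, Fker_exp_norm, Complex.norm_real, Real.norm_eq_abs, abs_of_nonneg (tent_nonneg _)]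
  exact mul_le_of_le_one_left (by positivity) (tent_le_one _)

lemma cexp_sub_le (z w : ℂ) : ‖cexp z - cexp w‖ ≤ ‖z - w‖ * (Real.exp z.re + Real.exp w.re) := by
  have h := (convex_halfSpace_re_le (max z.re w.re)).norm_image_sub_le_of_norm_deriv_le (f := cexp)
    (C := Real.exp z.re + Real.exp w.re) (x := w) (y := z)
    (fun x _ => Complex.differentiable_exp.differentiableAt) ?_ (show w.re ≤ _ from le_max_right _ _) (show z.re ≤ _ from le_max_left _ _)
  · linarith
  · intro x hx
    rw [Complex.deriv_exp, Complex.norm_exp]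
    have hx' : x.re ≤ max z.re w.re := hx
    refine (Real.exp_le_exp.mpr hx').trans ?_
    have := Real.exp_pos z.re
    have := Real.exp_pos w.re
    rcases max_cases z.re w.re with h | h <;> rw [h.1] <;> linarith

lemma Fker_lip {l : ℝ} (hl : 0 < l) (m : ℤ) (s : ℂ) (a b a' b' : ℝ) :
    ‖Fker l m s a b - Fker l m s a' b'‖ ≤ (1 + 4 / l) * (1 + ‖s‖ + |(m:ℝ)|) * (|a - a'| + |b - b'|) *
      (Real.exp (-(s.re * (a + b))) + Real.exp (-(s.re * (a' + b')))) := by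
  set z : ℂ := (2 * Real.pi * m * ((a - b) / (2 * l)) : ℝ) * I - s * ((a + b : ℝ) : ℂ) with hz
  set z' : ℂ := (2 * Real.pi * m * ((a' - b') / (2 * l)) : ℝ) * I - s * ((a' + b' : ℝ) : ℂ) with hz'
  have hn : Real.exp z.re = Real.exp (-(s.re * (a + b))) := by
    rw [← Complex.norm_exp, hz, Fker_exp_norm]
  have hn' : Real.exp z'.re = Real.exp (-(s.re * (a' + b'))) := by
    rw [← Complex.norm_exp, hz', Fker_exp_norm]
  rw [← hn, ← hn']
  set t := tent ((a - b) / (2 * l)) with ht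
  set t' := tent ((a' - b') / (2 * l)) with ht'
  have e : Fker l m s a b - Fker l m s a' b' = ((t - t' : ℝ) : ℂ) * cexp z + (t' : ℂ) * (cexp z - cexp z') := by
    simp only [Fker, ← hz, ← hz', ← ht, ← ht']; push_cast; ring
  set δ := |a - a'| + |b - b'| with hδ
  have hδ1 : |(a - b) - (a' - b')| ≤ δ := by
    have : (a - b) - (a' - b') = (a - a') - (b - b') := by ring
    rw [this]; exact abs_sub _ _
  have hδ2 : |(a + b) - (a' + b')| ≤ δ := by
    have : (a + b) - (a' + b') = (a - a') + (b - b') := by ring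
    rw [this]; exact abs_add_le _ _
  have hδ0 : 0 ≤ δ := by positivity
  have hl2 : 1 / (2 * l) ≤ 4 / l := by
    rw [div_le_div_iff₀ (by positivity) hl]; nlinarith
  have h1 : |t - t'| ≤ 4 / l * δ := by
    refine (tent_lip _ _).trans ?_
    rw [← sub_div, abs_div, abs_of_pos (by linarith : 0 < 2 * l)]
    calc |(a - b) - (a' - b')| / (2 * l) ≤ δ / (2 * l) := by gcongr
      _ = 1 / (2 * l) * δ := by ring
      _ ≤ _ := by gcongr
  have h2 : ‖z - z'‖ ≤ (4 / l * |(m:ℝ)| + ‖s‖) * δ := by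
    have e2 : z - z' = ((Real.pi / l * m * ((a - b) - (a' - b')) : ℝ) : ℂ) * I - s * (((a + b) - (a' + b') : ℝ) : ℂ) := by
      rw [hz, hz']
      have : (l : ℂ) ≠ 0 := by exact_mod_cast hl.ne'
      push_cast; field_simp; ring
    rw [e2]
    refine (norm_sub_le _ _).trans ?_
    rw [norm_mul, norm_I, mul_one, norm_mul, Complex.norm_real, Complex.norm_real, Real.norm_eq_abs, Real.norm_eq_abs,
      abs_mul, abs_mul, abs_of_pos (div_pos Real.pi_pos hl), add_mul]
    have : Real.pi ≤ 4 := Real.pi_le_four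
    gcongr
  have ht'1 : |t'| ≤ 1 := by rw [abs_of_nonneg (tent_nonneg _)]; exact tent_le_one _
  rw [e]
  refine (norm_add_le _ _).trans ?_
  rw [norm_mul, norm_mul, Complex.norm_real, Complex.norm_real, Real.norm_eq_abs, Real.norm_eq_abs, Complex.norm_exp]
  have h3 := cexp_sub_le z z'
  have p1 := Real.exp_pos z.re
  have p2 := Real.exp_pos z'.re
  set P := Real.exp z.re + Real.exp z'.re with hP
  have hl4 : 0 < 4 / l := by positivity
  calc |t - t'| * Real.exp z.re + |t'| * ‖cexp z - cexp z'‖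
      ≤ (4 / l * δ) * P + 1 * (((4 / l * |(m:ℝ)| + ‖s‖) * δ) * P) := by
        gcongr
        · linarith
        · exact h3.trans (by gcongr)
    _ = (4 / l + 4 / l * |(m:ℝ)| + ‖s‖) * δ * P := by ring
    _ ≤ _ := by
        gcongr
        have := norm_nonneg s
        have := abs_nonneg (m:ℝ)
        nlinarith [mul_nonneg hl4.le (norm_nonneg s)]

/-- data of a real quadratic ring. -/
structure QD (O : Type) [CommRing O] where
  s1 : O →+* ℝ
  s2 : O →+* ℝ
  l : ℝ
  hl : 0 < l
  h1 : ∀ k, k ≠ 0 → 1 ≤ |s1 k| * |s2 k|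
  hsum : ∀ p : ℝ, 2 < p → Summable fun k : O => (1 + max |s1 k| |s2 k|) ^ (-p)
  hcard : ∀ k, k ≠ 0 → (Nat.card (O ⧸ Ideal.span {k}) : ℝ) = |s1 k| * |s2 k|
  ε : Oˣ
  hε1 : |s1 ε| = Real.exp l
  hε2 : |s2 ε| = Real.exp (-l)
  hgen : ∀ u : Oˣ, ∃ n : ℤ, u = ε ^ n ∨ u = -ε ^ n

namespace QD
variable {O : Type} [CommRing O] (Q : QD O)

noncomputable def la (k : O) : ℝ := Real.log |Q.s1 k|
noncomputable def lb (k : O) : ℝ := Real.log |Q.s2 k|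
noncomputable def y (k : O) : ℝ := (Q.la k - Q.lb k) / (2 * Q.l)
noncomputable def X (k : O) : ℝ := |Q.s1 k| * |Q.s2 k|
noncomputable def M (k : O) : ℝ := max |Q.s1 k| |Q.s2 k|
noncomputable def Phi (m : ℤ) (s : ℂ) (k : O) : ℂ :=
  open Classical in if k = 0 then 0 else Fker Q.l m s (Q.la k) (Q.lb k)

lemma s1_pos {k : O} (hk : k ≠ 0) : 0 < |Q.s1 k| := by
  refine (abs_nonneg _).lt_of_ne fun h => ?_
  have := Q.h1 k hk; rw [← h] at this; linarith
lemma s2_pos {k : O} (hk : k ≠ 0) : 0 < |Q.s2 k| := by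
  refine (abs_nonneg _).lt_of_ne fun h => ?_
  have := Q.h1 k hk; rw [← h] at this; linarith
lemma X_ge {k : O} (hk : k ≠ 0) : 1 ≤ Q.X k := Q.h1 k hk
lemma exp_la {k : O} (hk : k ≠ 0) : Real.exp (Q.la k) = |Q.s1 k| := Real.exp_log (Q.s1_pos hk)
lemma exp_lb {k : O} (hk : k ≠ 0) : Real.exp (Q.lb k) = |Q.s2 k| := Real.exp_log (Q.s2_pos hk)
lemma la_add_lb {k : O} (hk : k ≠ 0) : Q.la k + Q.lb k = Real.log (Q.X k) := by
  rw [X, Real.log_mul (Q.s1_pos hk).ne' (Q.s2_pos hk).ne']; rfl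
lemma exp_neg_eq {k : O} (hk : k ≠ 0) (σ : ℝ) : Real.exp (-(σ * (Q.la k + Q.lb k))) = Q.X k ^ (-σ) := by
  rw [Q.la_add_lb hk, Real.rpow_def_of_pos (by linarith [Q.X_ge hk])]; congr 1; ring
lemma M_nonneg (k : O) : 0 ≤ Q.M k := (abs_nonneg _).trans (le_max_left _ _)

lemma M_ge_one {k : O} (hk : k ≠ 0) : 1 ≤ Q.M k := by
  by_contra h
  push Not at h
  have h1 := (le_max_left _ _).trans_lt h
  have h2 := (le_max_right _ _).trans_lt h
  have := Q.h1 k hk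
  have := Q.s1_pos hk
  have := Q.s2_pos hk
  nlinarith

lemma Phi_zero (m : ℤ) (s : ℂ) : Q.Phi m s 0 = 0 := by simp [Phi]
lemma Phi_of_ne (m : ℤ) (s : ℂ) {k : O} (hk : k ≠ 0) : Q.Phi m s k = Fker Q.l m s (Q.la k) (Q.lb k) := by
  simp [Phi, hk]

lemma Phi_norm_le_X (m : ℤ) (s : ℂ) {k : O} (hk : k ≠ 0) : ‖Q.Phi m s k‖ ≤ Q.X k ^ (-s.re) := by
  rw [Q.Phi_of_ne m s hk, ← Q.exp_neg_eq hk]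
  exact Fker_norm_le _ _ _ _ _

lemma Phi_norm_le_one (m : ℤ) {s : ℂ} (hs : 0 ≤ s.re) (k : O) : ‖Q.Phi m s k‖ ≤ 1 := by
  by_cases hk : k = 0
  · rw [hk, Phi_zero, norm_zero]; norm_num
  · refine (Q.Phi_norm_le_X m s hk).trans ?_
    exact Real.rpow_le_one_of_one_le_of_nonpos (Q.X_ge hk) (by linarith)

/-- on the support, both coordinates are comparable to `M`. -/
lemma supp_lower {m : ℤ} {s : ℂ} {k : O} (h : Q.Phi m s k ≠ 0) :
    k ≠ 0 ∧ Real.exp (-(2 * Q.l)) * Q.M k ≤ |Q.s1 k| ∧ Real.exp (-(2 * Q.l)) * Q.M k ≤ |Q.s2 k| := by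
  have hk : k ≠ 0 := by rintro rfl; exact h (Q.Phi_zero m s)
  rw [Q.Phi_of_ne m s hk, Fker] at h
  have ht : tent ((Q.la k - Q.lb k) / (2 * Q.l)) ≠ 0 := by
    intro h0; apply h; rw [h0]; simp
  have hlt : |(Q.la k - Q.lb k) / (2 * Q.l)| < 1 := by
    by_contra h0; exact ht (tent_eq_zero (not_lt.mp h0))
  have hl := Q.hl
  rw [abs_div, abs_of_pos (by linarith : 0 < 2 * Q.l), div_lt_one (by linarith), abs_lt] at hlt
  have e1 : Real.exp (-(2 * Q.l)) * |Q.s1 k| ≤ |Q.s2 k| := by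
    rw [← Q.exp_la hk, ← Q.exp_lb hk, ← Real.exp_add]; apply Real.exp_le_exp.mpr; linarith
  have e2 : Real.exp (-(2 * Q.l)) * |Q.s2 k| ≤ |Q.s1 k| := by
    rw [← Q.exp_la hk, ← Q.exp_lb hk, ← Real.exp_add]; apply Real.exp_le_exp.mpr; linarith
  have e3 : Real.exp (-(2 * Q.l)) ≤ 1 := by rw [Real.exp_le_one_iff]; linarith
  have p1 := Q.s1_pos hk
  have p2 := Q.s2_pos hk
  refine ⟨hk, ?_, ?_⟩
  · rw [M]; rcases max_cases |Q.s1 k| |Q.s2 k| with h | h <;> rw [h.1]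
    · nlinarith
    · exact e2
  · rw [M]; rcases max_cases |Q.s1 k| |Q.s2 k| with h | h <;> rw [h.1]
    · exact e1
    · nlinarith

lemma Phi_bound (m : ℤ) {s : ℂ} (hs : 0 ≤ s.re) (k : O) :
    ‖Q.Phi m s k‖ ≤ (Real.exp (-(2 * Q.l)) / 2) ^ (-(2 * s.re)) * (1 + Q.M k) ^ (-(2 * s.re)) := by
  have hM := Q.M_nonneg k
  by_cases h : Q.Phi m s k = 0
  · rw [h, norm_zero]; positivity
  obtain ⟨hk, h1, h2⟩ := Q.supp_lower h
  refine (Q.Phi_norm_le_X m s hk).trans ?_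
  have hM1 := Q.M_ge_one hk
  set c := Real.exp (-(2 * Q.l)) with hc
  have hc0 : 0 < c := Real.exp_pos _
  rw [← Real.mul_rpow (by positivity) (by linarith)]
  have e : (c / 2 * (1 + Q.M k)) ^ (-(2 * s.re)) = ((c / 2 * (1 + Q.M k)) ^ 2) ^ (-s.re) := by
    rw [← Real.rpow_natCast, ← Real.rpow_mul (by positivity)]; congr 1; push_cast; ring
  rw [e]
  apply Real.rpow_le_rpow_of_nonpos (by positivity) _ (by linarith)
  rw [X, sq]
  have : c / 2 * (1 + Q.M k) ≤ c * Q.M k := by nlinarith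
  exact mul_le_mul (this.trans h1) (this.trans h2) (by positivity) (abs_nonneg _)

lemma Phi_summable (m : ℤ) {s : ℂ} (hs : 1 < s.re) : Summable fun k => Q.Phi m s k := by
  refine Summable.of_norm_bounded ((Q.hsum (2 * s.re) (by linarith)).mul_left _) fun k => Q.Phi_bound m (by linarith) k

lemma log_abs_sub_le {x r c : ℝ} (hc : 0 < c) (h1 : c ≤ |x|) (h2 : c ≤ |x + r|) :
    abs (Real.log |x + r| - Real.log |x|) ≤ |r| / c := by
  have key : ∀ u v : ℝ, c ≤ u → c ≤ v → Real.log u - Real.log v ≤ |u - v| / c := by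
    intro u v hu hv
    have hv0 : 0 < v := by linarith
    have hu0 : 0 < u := by linarith
    rw [← Real.log_div hu0.ne' hv0.ne']
    refine (Real.log_le_sub_one_of_pos (div_pos hu0 hv0)).trans ?_
    have : u / v - 1 = (u - v) / v := by field_simp
    rw [this]
    calc (u - v) / v ≤ |u - v| / v := by gcongr; exact le_abs_self _
      _ ≤ _ := by gcongr
  have h3 : abs (|x + r| - |x|) ≤ |r| := by
    have := abs_abs_sub_abs_le (x + r) x
    simpa using this
  rw [abs_le]
  constructor
  · have := key _ _ h1 h2
    rw [abs_sub_comm] at this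
    have : abs (|x + r| - |x|) / c ≤ |r| / c := by gcongr
    linarith
  · have := key _ _ h2 h1
    have : abs (|x + r| - |x|) / c ≤ |r| / c := by gcongr
    linarith

end QD
end

section
open Complex Set Filter Topology

namespace QD
variable {O : Type} [CommRing O] (Q : QD O)

set_option maxHeartbeats 1000000 in
lemma Phi_lip (R0 S : ℝ) (hR : 0 < R0) : ∃ D : ℝ, 0 < D ∧ ∀ v r : O, |Q.s1 r| ≤ R0 → |Q.s2 r| ≤ R0 →
    ∀ (m : ℤ) (s : ℂ), 0 ≤ s.re → s.re ≤ S →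
    ‖Q.Phi m s (v + r) - Q.Phi m s v‖ ≤ D * (1 + ‖s‖ + |(m:ℝ)|) * (1 + Q.M v) ^ (-(2 * s.re + 1)) := by
  have hl := Q.hl
  set e := Real.exp (-(2 * Q.l)) with he
  have he0 : 0 < e := Real.exp_pos _
  have he1 : e ≤ 1 := by rw [he, Real.exp_le_one_iff]; linarith
  set M0 : ℝ := max 1 (4 * R0 / e) with hM0
  have hM01 : 1 ≤ M0 := le_max_left _ _
  set D1 : ℝ := 2 * (1 + M0) ^ (2 * S + 1) with hD1
  set D2 : ℝ := (1 + 4 / Q.l) * 4 * R0 * (e / 8) ^ (-(2 * S + 1)) with hD2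
  have hD1p : 0 < D1 := by positivity
  have hD2p : 0 < D2 := by positivity
  refine ⟨D1 + D2, by positivity, ?_⟩
  intro v r h1 h2 m s hs0 hsS
  have hMv := Q.M_nonneg v
  have hfac : 1 ≤ 1 + ‖s‖ + |(m:ℝ)| := by have := norm_nonneg s; have := abs_nonneg (m:ℝ); linarith
  have hpow : 0 < (1 + Q.M v) ^ (-(2 * s.re + 1)) := by positivity
  by_cases hz : Q.Phi m s (v + r) = 0 ∧ Q.Phi m s v = 0
  · rw [hz.1, hz.2, sub_zero, norm_zero]; positivity
  rcases lt_or_ge (Q.M v) M0 with hlt | hge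
  · have i1 : ‖Q.Phi m s (v + r) - Q.Phi m s v‖ ≤ 2 := by
      refine (norm_sub_le _ _).trans ?_
      linarith [Q.Phi_norm_le_one m hs0 (v + r), Q.Phi_norm_le_one m hs0 v]
    have i2 : 2 ≤ D1 * (1 + Q.M v) ^ (-(2 * s.re + 1)) := by
      have j1 : (1 + M0) ^ (-(2 * S + 1)) ≤ (1 + Q.M v) ^ (-(2 * s.re + 1)) := by
        calc (1 + M0) ^ (-(2 * S + 1)) ≤ (1 + M0) ^ (-(2 * s.re + 1)) :=
              Real.rpow_le_rpow_of_exponent_le (by linarith) (by linarith)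
          _ ≤ _ := Real.rpow_le_rpow_of_nonpos (by linarith) (by linarith) (by linarith)
      have j2 : D1 * (1 + M0) ^ (-(2 * S + 1)) = 2 := by
        rw [hD1, mul_assoc, ← Real.rpow_add (by linarith)]; simp
      calc 2 = D1 * (1 + M0) ^ (-(2 * S + 1)) := j2.symm
        _ ≤ _ := by gcongr
    refine i1.trans (i2.trans ?_)
    gcongr
    calc D1 ≤ D1 + D2 := by linarith
      _ ≤ _ := le_mul_of_one_le_right (by positivity) hfac
  · have hM1 : 1 ≤ Q.M v := hM01.trans hge
    have hM4 : 4 * R0 ≤ e * Q.M v := by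
      have : 4 * R0 / e ≤ Q.M v := (le_max_right _ _).trans hge
      rw [div_le_iff₀ he0] at this; linarith
    have hs1 : Q.s1 (v + r) = Q.s1 v + Q.s1 r := map_add _ _ _
    have hs2 : Q.s2 (v + r) = Q.s2 v + Q.s2 r := map_add _ _ _
    have t1 : |Q.s1 v| - R0 ≤ |Q.s1 (v + r)| := by
      rw [hs1]; have := abs_sub_abs_le_abs_sub (Q.s1 v) (-Q.s1 r); rw [abs_neg, sub_neg_eq_add] at this; linarith
    have t2 : |Q.s2 v| - R0 ≤ |Q.s2 (v + r)| := by
      rw [hs2]; have := abs_sub_abs_le_abs_sub (Q.s2 v) (-Q.s2 r); rw [abs_neg, sub_neg_eq_add] at this; linarith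
    have t1' : |Q.s1 (v + r)| ≤ |Q.s1 v| + R0 := by
      rw [hs1]; exact (abs_add_le _ _).trans (by linarith)
    have t2' : |Q.s2 (v + r)| ≤ |Q.s2 v| + R0 := by
      rw [hs2]; exact (abs_add_le _ _).trans (by linarith)
    have t3 : Q.M v - R0 ≤ Q.M (v + r) := by
      unfold M; rcases max_cases |Q.s1 v| |Q.s2 v| with h | h <;> rw [h.1]
      · exact t1.trans (le_max_left _ _)
      · exact t2.trans (le_max_right _ _)
    set c := e * Q.M v / 4 with hc
    have hc0 : 0 < c := by positivity
    have hco : c ≤ |Q.s1 v| ∧ c ≤ |Q.s2 v| ∧ c ≤ |Q.s1 (v + r)| ∧ c ≤ |Q.s2 (v + r)| := by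
      by_cases hv : Q.Phi m s v = 0
      · have hvr : Q.Phi m s (v + r) ≠ 0 := fun h => hz ⟨h, hv⟩
        obtain ⟨-, a1, a2⟩ := Q.supp_lower hvr
        rw [← he] at a1 a2
        have : e * Q.M v - e * R0 ≤ e * Q.M (v + r) := by nlinarith
        have : e * R0 ≤ R0 := by nlinarith
        refine ⟨?_, ?_, ?_, ?_⟩ <;> linarith
      · obtain ⟨-, a1, a2⟩ := Q.supp_lower hv
        rw [← he] at a1 a2
        refine ⟨?_, ?_, ?_, ?_⟩ <;> linarith
    obtain ⟨c1, c2, c3, c4⟩ := hco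
    have hv0 : v ≠ 0 := by rintro rfl; simp at c1; linarith
    have hvr0 : v + r ≠ 0 := by intro h; rw [h] at c3; simp at c3; linarith
    rw [Q.Phi_of_ne m s hv0, Q.Phi_of_ne m s hvr0]
    refine (Fker_lip hl m s _ _ _ _).trans ?_
    rw [Q.exp_neg_eq hv0, Q.exp_neg_eq hvr0]
    have d1 : |Q.la (v + r) - Q.la v| ≤ R0 / c := by
      have := log_abs_sub_le (r := Q.s1 r) hc0 c1 (by rw [← hs1]; exact c3)
      rw [← hs1] at this
      exact this.trans (by gcongr)
    have d2 : |Q.lb (v + r) - Q.lb v| ≤ R0 / c := by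
      have := log_abs_sub_le (r := Q.s2 r) hc0 c2 (by rw [← hs2]; exact c4)
      rw [← hs2] at this
      exact this.trans (by gcongr)
    have x1 : Q.X v ^ (-s.re) ≤ (c * c) ^ (-s.re) := by
      apply Real.rpow_le_rpow_of_nonpos (by positivity) _ (by linarith)
      exact mul_le_mul c1 c2 hc0.le (abs_nonneg _)
    have x2 : Q.X (v + r) ^ (-s.re) ≤ (c * c) ^ (-s.re) := by
      apply Real.rpow_le_rpow_of_nonpos (by positivity) _ (by linarith)
      exact mul_le_mul c3 c4 hc0.le (abs_nonneg _)
    have hX0 : 0 ≤ Q.X v ^ (-s.re) := by have := Q.X_ge hv0; positivity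
    have hX0' : 0 ≤ Q.X (v + r) ^ (-s.re) := by have := Q.X_ge hvr0; positivity
    have ecc : 1 / c * (c * c) ^ (-s.re) = c ^ (-(2 * s.re + 1)) := by
      rw [one_div, ← Real.rpow_neg_one, ← pow_two, ← Real.rpow_natCast, ← Real.rpow_mul hc0.le, ← Real.rpow_add hc0]
      congr 1; push_cast; ring
    have hcc : c ^ (-(2 * s.re + 1)) ≤ (e / 8) ^ (-(2 * S + 1)) * (1 + Q.M v) ^ (-(2 * s.re + 1)) := by
      calc c ^ (-(2 * s.re + 1)) ≤ (e / 8 * (1 + Q.M v)) ^ (-(2 * s.re + 1)) := by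
            apply Real.rpow_le_rpow_of_nonpos (by positivity) _ (by linarith)
            rw [hc]; nlinarith
        _ = (e / 8) ^ (-(2 * s.re + 1)) * (1 + Q.M v) ^ (-(2 * s.re + 1)) := Real.mul_rpow (by positivity) (by positivity)
        _ ≤ (e / 8) ^ (-(2 * S + 1)) * (1 + Q.M v) ^ (-(2 * s.re + 1)) :=
            mul_le_mul_of_nonneg_right (Real.rpow_le_rpow_of_exponent_ge (by positivity) (by linarith) (by linarith)) hpow.le
    calc (1 + 4 / Q.l) * (1 + ‖s‖ + |(m:ℝ)|) * (|Q.la (v + r) - Q.la v| + |Q.lb (v + r) - Q.lb v|) *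
          (Q.X (v + r) ^ (-s.re) + Q.X v ^ (-s.re))
        ≤ (1 + 4 / Q.l) * (1 + ‖s‖ + |(m:ℝ)|) * (R0 / c + R0 / c) * ((c * c) ^ (-s.re) + (c * c) ^ (-s.re)) := by
          gcongr
      _ = (1 + 4 / Q.l) * 4 * R0 * (1 + ‖s‖ + |(m:ℝ)|) * (1 / c * (c * c) ^ (-s.re)) := by ring
      _ ≤ (1 + 4 / Q.l) * 4 * R0 * (1 + ‖s‖ + |(m:ℝ)|) * ((e / 8) ^ (-(2 * S + 1)) * (1 + Q.M v) ^ (-(2 * s.re + 1))) := by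
          rw [ecc]; exact mul_le_mul_of_nonneg_left hcc (by positivity)
      _ = D2 * (1 + ‖s‖ + |(m:ℝ)|) * (1 + Q.M v) ^ (-(2 * s.re + 1)) := by rw [hD2]; ring
      _ ≤ (D1 + D2) * (1 + ‖s‖ + |(m:ℝ)|) * (1 + Q.M v) ^ (-(2 * s.re + 1)) :=
          mul_le_mul_of_nonneg_right (mul_le_mul_of_nonneg_right (by linarith) (by linarith)) hpow.le

lemma finite_quot (Q : QD O) {α : O} (hα : α ≠ 0) : Finite (O ⧸ Ideal.span {α}) := by
  apply Nat.finite_of_card_ne_zero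
  intro h
  have h1 := Q.hcard α hα
  have h2 := Q.h1 α hα
  rw [← h1, h] at h2
  norm_num at h2

/-- difference terms. -/
noncomputable def dterm (α : O) (m : ℤ) (s : ℂ) (k : O) : ℂ :=
  ∑ᶠ q : O ⧸ Ideal.span {α}, (Q.Phi m s (α * k + q.out) - Q.Phi m s (α * k))

noncomputable def Hs (α : O) (m : ℤ) (s : ℂ) : ℂ := ∑' k, Q.dterm α m s k

lemma dterm_bound {α : O} (hα : α ≠ 0) (S : ℝ) : ∃ D : ℝ, 0 < D ∧ ∀ (k : O) (m : ℤ) (s : ℂ), 0 ≤ s.re → s.re ≤ S →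
    ‖Q.dterm α m s k‖ ≤ D * (1 + ‖s‖ + |(m:ℝ)|) * (1 + Q.M k) ^ (-(2 * s.re + 1)) := by
  have := Q.finite_quot hα
  have := Fintype.ofFinite (O ⧸ Ideal.span {α})
  set R0 : ℝ := 1 + ∑ q : O ⧸ Ideal.span {α}, (|Q.s1 q.out| + |Q.s2 q.out|) with hR0
  have hR0p : 0 < R0 := by positivity
  obtain ⟨D, hD, hb⟩ := Q.Phi_lip R0 S hR0p
  set A := min 1 (min |Q.s1 α| |Q.s2 α|) with hA
  have hA0 : 0 < A := lt_min one_pos (lt_min (Q.s1_pos hα) (Q.s2_pos hα))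
  have hA1 : A ≤ 1 := min_le_left _ _
  set n : ℝ := (Fintype.card (O ⧸ Ideal.span {α}) : ℝ) with hn
  have hn0 : 0 < n := by
    rw [hn]; exact_mod_cast Fintype.card_pos
  refine ⟨n * D * A ^ (-(2 * S + 1)), by positivity, fun k m s h0 hS => ?_⟩
  rw [dterm, finsum_eq_sum_of_fintype]
  have hMk := Q.M_nonneg k
  have hfac : 0 ≤ 1 + ‖s‖ + |(m:ℝ)| := by positivity
  have hMa : A * (1 + Q.M k) ≤ 1 + Q.M (α * k) := by
    have : A * Q.M k ≤ Q.M (α * k) := by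
      unfold M; rw [map_mul, map_mul, abs_mul, abs_mul]
      rcases max_cases |Q.s1 k| |Q.s2 k| with h | h <;> rw [h.1]
      · refine le_trans ?_ (le_max_left _ _)
        gcongr; exact (min_le_right _ _).trans (min_le_left _ _)
      · refine le_trans ?_ (le_max_right _ _)
        gcongr; exact (min_le_right _ _).trans (min_le_right _ _)
    linarith
  have hpow : (1 + Q.M (α * k)) ^ (-(2 * s.re + 1)) ≤ A ^ (-(2 * S + 1)) * (1 + Q.M k) ^ (-(2 * s.re + 1)) := by
    calc (1 + Q.M (α * k)) ^ (-(2 * s.re + 1)) ≤ (A * (1 + Q.M k)) ^ (-(2 * s.re + 1)) :=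
          Real.rpow_le_rpow_of_nonpos (by positivity) hMa (by linarith)
      _ = A ^ (-(2 * s.re + 1)) * (1 + Q.M k) ^ (-(2 * s.re + 1)) := Real.mul_rpow (by positivity) (by positivity)
      _ ≤ A ^ (-(2 * S + 1)) * (1 + Q.M k) ^ (-(2 * s.re + 1)) :=
          mul_le_mul_of_nonneg_right (Real.rpow_le_rpow_of_exponent_ge hA0 hA1 (by linarith)) (by positivity)
  refine (norm_sum_le_of_le (f := fun q : O ⧸ Ideal.span {α} => Q.Phi m s (α * k + q.out) - Q.Phi m s (α * k)) _
    (n := fun _ => D * (1 + ‖s‖ + |(m:ℝ)|) * (A ^ (-(2 * S + 1)) * (1 + Q.M k) ^ (-(2 * s.re + 1)))) ?_).trans ?_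
  · intro q _
    have hq : |Q.s1 q.out| + |Q.s2 q.out| ≤ R0 := by
      have := Finset.single_le_sum (f := fun q : O ⧸ Ideal.span {α} => |Q.s1 q.out| + |Q.s2 q.out|)
        (fun i _ => by positivity) (Finset.mem_univ q)
      linarith
    have a1 := abs_nonneg (Q.s1 q.out)
    have a2 := abs_nonneg (Q.s2 q.out)
    refine (hb (α * k) q.out (by linarith) (by linarith) m s h0 hS).trans ?_
    gcongr
  · rw [Finset.sum_const, Finset.card_univ, nsmul_eq_mul]
    apply le_of_eq; rw [hn]; ring

lemma Phi_diff (m : ℤ) (k : O) : Differentiable ℂ fun s => Q.Phi m s k := by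
  by_cases hk : k = 0
  · subst hk; simp only [Phi_zero]; fun_prop
  · simp only [Q.Phi_of_ne m _ hk, Fker]; fun_prop

lemma dterm_diff {α : O} (hα : α ≠ 0) (m : ℤ) (k : O) : Differentiable ℂ fun s => Q.dterm α m s k := by
  have := Q.finite_quot hα
  have := Fintype.ofFinite (O ⧸ Ideal.span {α})
  simp only [dterm, finsum_eq_sum_of_fintype]
  exact Differentiable.fun_sum fun q _ => (Q.Phi_diff m _).sub (Q.Phi_diff m _)

lemma Hs_diff {α : O} (hα : α ≠ 0) (m : ℤ) : DifferentiableOn ℂ (Q.Hs α m) {s | 1 / 2 < s.re} := by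
  intro s hs
  have hs' : 1 / 2 < s.re := hs
  set δ := (s.re + 1 / 2) / 2 with hδ
  set U : Set ℂ := {w | δ < w.re} ∩ Metric.ball s 1 with hU
  have hUo : IsOpen U := (isOpen_lt continuous_const continuous_re).inter Metric.isOpen_ball
  have hsU : s ∈ U := ⟨by change δ < s.re; linarith, Metric.mem_ball_self one_pos⟩
  obtain ⟨D, hD, hb⟩ := Q.dterm_bound hα (s.re + 1)
  have h := differentiableOn_tsum_of_summable_norm (F := fun k w => Q.dterm α m w k) (U := U)
    (u := fun k => D * (2 + ‖s‖ + |(m:ℝ)|) * (1 + Q.M k) ^ (-(2 * δ + 1)))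
    ((Q.hsum (2 * δ + 1) (by linarith)).mul_left _)
    (fun k => (Q.dterm_diff hα m k).differentiableOn) hUo ?_
  · exact (h.differentiableAt (hUo.mem_nhds hsU)).differentiableWithinAt
  · intro k w hw
    have h1 : δ < w.re := hw.1
    have h2 : ‖w - s‖ < 1 := by simpa [dist_eq_norm] using hw.2
    have h3 : w.re ≤ s.re + 1 := by
      have := (le_abs_self _).trans (Complex.abs_re_le_norm (w - s)); rw [Complex.sub_re] at this; linarith
    have h4 : ‖w‖ ≤ ‖s‖ + 1 := by have := norm_sub_norm_le w s; linarith
    have hM := Q.M_nonneg k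
    refine (hb k m w (by linarith) h3).trans ?_
    refine mul_le_mul ?_ ?_ (by positivity) (by positivity)
    · exact mul_le_mul_of_nonneg_left (by linarith) hD.le
    · exact Real.rpow_le_rpow_of_exponent_le (by linarith) (by linarith)

lemma Hs_bound {α : O} (hα : α ≠ 0) (S : ℝ) : ∃ D : ℝ, 0 < D ∧ ∀ (m : ℤ) (s : ℂ), 3 / 4 ≤ s.re → s.re ≤ S →
    ‖Q.Hs α m s‖ ≤ D * (1 + ‖s‖ + |(m:ℝ)|) := by
  obtain ⟨D, hD, hb⟩ := Q.dterm_bound hα S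
  have hs := Q.hsum (5 / 2) (by norm_num)
  have hnn : 0 ≤ ∑' k, (1 + Q.M k) ^ (-(5/2) : ℝ) := tsum_nonneg fun k => by have := Q.M_nonneg k; positivity
  refine ⟨D * ((∑' k, (1 + Q.M k) ^ (-(5/2) : ℝ)) + 1), by positivity, fun m s h1 h2 => ?_⟩
  have hle : ∀ k, ‖Q.dterm α m s k‖ ≤ D * (1 + ‖s‖ + |(m:ℝ)|) * (1 + Q.M k) ^ (-(5/2) : ℝ) := by
    intro k
    have hM := Q.M_nonneg k
    refine (hb k m s (by linarith) h2).trans ?_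
    exact mul_le_mul_of_nonneg_left (Real.rpow_le_rpow_of_exponent_le (by linarith) (by linarith)) (by positivity)
  refine (tsum_of_norm_bounded (hs.mul_left (D * (1 + ‖s‖ + |(m:ℝ)|))).hasSum hle).trans ?_
  rw [tsum_mul_left]
  have hfac : 0 ≤ 1 + ‖s‖ + |(m:ℝ)| := by positivity
  have : D * (1 + ‖s‖ + |(m:ℝ)|) * (∑' k, (1 + max |Q.s1 k| |Q.s2 k|) ^ (-(5/2) : ℝ)) = D * (∑' k, (1 + Q.M k) ^ (-(5/2) : ℝ)) * (1 + ‖s‖ + |(m:ℝ)|) := by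
    unfold M; ring
  rw [this]
  gcongr
  linarith

set_option maxHeartbeats 1000000 in
/-- the sublattice identity. -/
lemma Hs_eq [IsDomain O] {α : O} (hα : α ≠ 0) (m : ℤ) {s : ℂ} (hs : 1 < s.re) :
    Q.Hs α m s = (∑' k, Q.Phi m s k) - (Q.X α : ℂ) * ∑' k, Q.Phi m s (α * k) := by
  have := Q.finite_quot hα
  have := Fintype.ofFinite (O ⧸ Ideal.span {α})
  have hsum := Q.Phi_summable m hs
  set f : (O ⧸ Ideal.span {α}) × O → O := fun p => α * p.2 + p.1.out with hf
  have hmk : ∀ p, (Ideal.Quotient.mk (Ideal.span {α}) (f p)) = p.1 := by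
    rintro ⟨q, k⟩
    simp only [hf, map_add, map_mul]
    have h0 : Ideal.Quotient.mk (Ideal.span {α}) α = 0 := by
      rw [Ideal.Quotient.eq_zero_iff_mem]; exact Ideal.mem_span_singleton_self α
    rw [h0, zero_mul, zero_add]
    exact Quotient.out_eq q
  have hbij : Function.Bijective f := by
    constructor
    · rintro ⟨q, k⟩ ⟨q', k'⟩ h
      have hq : q = q' := (hmk (q, k)).symm.trans ((congrArg _ h).trans (hmk (q', k')))
      subst hq
      simp only [hf, add_left_inj] at h
      rw [mul_left_cancel₀ hα h]
    · intro k
      set q := Ideal.Quotient.mk (Ideal.span {α}) k with hq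
      have : k - q.out ∈ Ideal.span {α} := by
        rw [← Ideal.Quotient.eq]
        exact (Quotient.out_eq q).symm
      obtain ⟨c, hc⟩ := Ideal.mem_span_singleton.mp this
      exact ⟨(q, c), by simp only [hf]; rw [← hc]; ring⟩
  set e := Equiv.ofBijective f hbij with he
  have hs1 : Summable fun p : (O ⧸ Ideal.span {α}) × O => Q.Phi m s (f p) := (e.summable_iff).mpr hsum
  have hs2 : ∀ q : O ⧸ Ideal.span {α}, Summable fun k => Q.Phi m s (α * k + q.out) := fun q => hs1.prod_factor q
  have hs3 : Summable fun k => Q.Phi m s (α * k) := hsum.comp_injective (mul_right_injective₀ hα)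
  have e1 : ∑' k, Q.Phi m s k = ∑ q : O ⧸ Ideal.span {α}, ∑' k, Q.Phi m s (α * k + q.out) := by
    rw [← e.tsum_eq, ← tsum_fintype (L := .unconditional _)]
    exact hs1.tsum_prod
  rw [Hs, e1]
  simp only [dterm, finsum_eq_sum_of_fintype]
  rw [Summable.tsum_finsetSum fun q _ => (hs2 q).sub hs3]
  have : ∀ q : O ⧸ Ideal.span {α}, ∑' k, (Q.Phi m s (α * k + q.out) - Q.Phi m s (α * k)) =
      (∑' k, Q.Phi m s (α * k + q.out)) - ∑' k, Q.Phi m s (α * k) := fun q => (hs2 q).tsum_sub hs3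
  simp_rw [this]
  rw [Finset.sum_sub_distrib, Finset.sum_const, Finset.card_univ, nsmul_eq_mul]
  congr 2
  have := Q.hcard α hα
  rw [Nat.card_eq_fintype_card] at this
  unfold X
  rw [← this]; simp

end QD
end

section
open Complex Set Filter Topology

namespace QD
variable {O : Type} [CommRing O] (Q : QD O)

/-- the twisted norm character. -/
noncomputable def T0 (m : ℤ) (s : ℂ) (k : O) : ℂ :=
  open Classical in if k = 0 then 0 else cexp ((2 * Real.pi * m * Q.y k : ℝ) * I - s * ((Q.la k + Q.lb k : ℝ) : ℂ))

lemma T0_zero (m : ℤ) (s : ℂ) : Q.T0 m s 0 = 0 := by simp [T0]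
lemma T0_of_ne (m : ℤ) (s : ℂ) {k : O} (hk : k ≠ 0) :
    Q.T0 m s k = cexp ((2 * Real.pi * m * Q.y k : ℝ) * I - s * ((Q.la k + Q.lb k : ℝ) : ℂ)) := by simp [T0, hk]

lemma Phi_eq_T0 (m : ℤ) (s : ℂ) (k : O) : Q.Phi m s k = (tent (Q.y k) : ℂ) * Q.T0 m s k := by
  by_cases hk : k = 0
  · rw [hk, Phi_zero, T0_zero, mul_zero]
  · rw [Phi_of_ne _ _ _ hk, T0_of_ne _ _ _ hk]; rfl

lemma la_mul {k k' : O} (hk : k ≠ 0) (hk' : k' ≠ 0) : Q.la (k * k') = Q.la k + Q.la k' := by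
  unfold la; rw [map_mul, abs_mul, Real.log_mul (Q.s1_pos hk).ne' (Q.s1_pos hk').ne']
lemma lb_mul {k k' : O} (hk : k ≠ 0) (hk' : k' ≠ 0) : Q.lb (k * k') = Q.lb k + Q.lb k' := by
  unfold lb; rw [map_mul, abs_mul, Real.log_mul (Q.s2_pos hk).ne' (Q.s2_pos hk').ne']
lemma y_mul {k k' : O} (hk : k ≠ 0) (hk' : k' ≠ 0) : Q.y (k * k') = Q.y k + Q.y k' := by
  unfold y; rw [la_mul Q hk hk', lb_mul Q hk hk']; ring
lemma X_mul (k k' : O) : Q.X (k * k') = Q.X k * Q.X k' := by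
  unfold X; rw [map_mul, map_mul, abs_mul, abs_mul]; ring

lemma T0_mul [IsDomain O] (m : ℤ) (s : ℂ) (k k' : O) : Q.T0 m s (k * k') = Q.T0 m s k * Q.T0 m s k' := by
  by_cases hk : k = 0
  · rw [hk, zero_mul, T0_zero, zero_mul]
  by_cases hk' : k' = 0
  · rw [hk', mul_zero, T0_zero, mul_zero]
  rw [T0_of_ne _ _ _ hk, T0_of_ne _ _ _ hk', T0_of_ne _ _ _ (mul_ne_zero hk hk'), la_mul Q hk hk', lb_mul Q hk hk',
    y_mul Q hk hk', ← Complex.exp_add]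
  congr 1; push_cast; ring

lemma exp_int_mul_aux (x : ℝ) (j : ℤ) : Real.exp (j * x) = Real.exp x ^ j := by
  rw [mul_comm, Real.exp_mul, Real.rpow_intCast]

lemma s1_zpow (j : ℤ) : |Q.s1 ((Q.ε ^ j : Oˣ) : O)| = Real.exp (j * Q.l) := by
  have : Q.s1 ((Q.ε ^ j : Oˣ) : O) = (Q.s1 (Q.ε : O)) ^ j := by
    have h : ((Units.map (Q.s1 : O →* ℝ) (Q.ε ^ j) : ℝˣ) : ℝ) = (((Units.map (Q.s1 : O →* ℝ) Q.ε) ^ j : ℝˣ) : ℝ) := by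
      rw [map_zpow]
    rw [Units.val_zpow_eq_zpow_val] at h
    exact h
  rw [this, abs_zpow, Q.hε1, exp_int_mul_aux]
lemma s2_zpow (j : ℤ) : |Q.s2 ((Q.ε ^ j : Oˣ) : O)| = Real.exp (-(j * Q.l)) := by
  have : Q.s2 ((Q.ε ^ j : Oˣ) : O) = (Q.s2 (Q.ε : O)) ^ j := by
    have h : ((Units.map (Q.s2 : O →* ℝ) (Q.ε ^ j) : ℝˣ) : ℝ) = (((Units.map (Q.s2 : O →* ℝ) Q.ε) ^ j : ℝˣ) : ℝ) := by
      rw [map_zpow]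
    rw [Units.val_zpow_eq_zpow_val] at h
    exact h
  rw [this, abs_zpow, Q.hε2, ← mul_neg, exp_int_mul_aux]

/-- parametrization of a fibre. -/
noncomputable def fibf (g : O) : ℤ ⊕ ℤ → O := Sum.elim (fun j => ((Q.ε ^ j : Oˣ) : O) * g) (fun j => -((Q.ε ^ j : Oˣ) : O) * g)

def fibj : ℤ ⊕ ℤ → ℤ := Sum.elim id id

lemma fib_abs1 (g : O) (t : ℤ ⊕ ℤ) : |Q.s1 (Q.fibf g t)| = Real.exp (fibj t * Q.l) * |Q.s1 g| := by
  rcases t with j | j <;> simp [fibf, fibj, abs_mul, s1_zpow]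
lemma fib_abs2 (g : O) (t : ℤ ⊕ ℤ) : |Q.s2 (Q.fibf g t)| = Real.exp (-(fibj t * Q.l)) * |Q.s2 g| := by
  rcases t with j | j <;> simp [fibf, fibj, abs_mul, s2_zpow]

lemma fib_X (g : O) (t : ℤ ⊕ ℤ) : Q.X (Q.fibf g t) = Q.X g := by
  unfold X; rw [fib_abs1, fib_abs2, Real.exp_neg]
  have := Real.exp_pos (fibj t * Q.l)
  field_simp

lemma fib_la {g : O} (hg : g ≠ 0) (t : ℤ ⊕ ℤ) : Q.la (Q.fibf g t) = fibj t * Q.l + Q.la g := by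
  unfold la; rw [fib_abs1, Real.log_mul (Real.exp_pos _).ne' (Q.s1_pos hg).ne', Real.log_exp]
lemma fib_lb {g : O} (hg : g ≠ 0) (t : ℤ ⊕ ℤ) : Q.lb (Q.fibf g t) = -(fibj t * Q.l) + Q.lb g := by
  unfold lb; rw [fib_abs2, Real.log_mul (Real.exp_pos _).ne' (Q.s2_pos hg).ne', Real.log_exp]

lemma fib_y {g : O} (hg : g ≠ 0) (t : ℤ ⊕ ℤ) : Q.y (Q.fibf g t) = Q.y g + fibj t := by
  unfold y; rw [fib_la Q hg, fib_lb Q hg]; have := Q.hl; field_simp; ring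

lemma fib_ne {g : O} (hg : g ≠ 0) (t : ℤ ⊕ ℤ) : Q.fibf g t ≠ 0 := by
  intro h
  have h1 := Q.fib_abs1 g t
  rw [h, map_zero, abs_zero] at h1
  have := Q.s1_pos hg
  have := Real.exp_pos (fibj t * Q.l)
  nlinarith [mul_pos this (Q.s1_pos hg)]

lemma fib_T0 {g : O} (hg : g ≠ 0) (m : ℤ) (s : ℂ) (t : ℤ ⊕ ℤ) : Q.T0 m s (Q.fibf g t) = Q.T0 m s g := by
  rw [T0_of_ne _ _ _ hg, T0_of_ne _ _ _ (Q.fib_ne hg t), fib_la Q hg, fib_lb Q hg, fib_y Q hg, Complex.exp_eq_exp_iff_exists_int]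
  exact ⟨m * fibj t, by push_cast; ring⟩

lemma fib_inj [IsDomain O] {g : O} (hg : g ≠ 0) : Function.Injective (Q.fibf g) := by
  intro t t' h
  have hj : fibj t = fibj t' := by
    have h1 := Q.fib_y hg t
    rw [h, Q.fib_y hg t'] at h1
    have : (fibj t : ℝ) = fibj t' := by linarith
    exact_mod_cast this
  have key : ∀ j : ℤ, ((Q.ε ^ j : Oˣ) : O) * g ≠ -((Q.ε ^ j : Oˣ) : O) * g := by
    intro j hh
    have h2 := congrArg Q.s1 hh
    have h3 := Q.s1_pos (k := ((Q.ε ^ j : Oˣ) : O) * g) (mul_ne_zero (Units.ne_zero _) hg)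
    rw [neg_mul, map_neg] at h2
    have : Q.s1 (((Q.ε ^ j : Oˣ) : O) * g) = 0 := by linarith
    rw [this] at h3; simp at h3
  rcases t with j | j <;> rcases t' with j' | j' <;> simp only [fibj, Sum.elim_inl, Sum.elim_inr, id] at hj <;> subst hj
  · rfl
  · exact absurd h (key j)
  · exact absurd h.symm (key j)
  · rfl

lemma fib_range [IsDomain O] (g : O) : Set.range (Q.fibf g) = {k | Ideal.span {k} = Ideal.span {g}} := by
  ext k
  simp only [Set.mem_range, mem_ofPred_eq]
  constructor
  · rintro ⟨t, rfl⟩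
    rw [Ideal.span_singleton_eq_span_singleton]
    rcases t with j | j
    · exact (associated_unit_mul_left g _ (Units.isUnit (Q.ε ^ j)))
    · have : IsUnit (-((Q.ε ^ j : Oˣ) : O)) := (Units.isUnit (Q.ε ^ j)).neg
      exact (associated_unit_mul_left g _ this)
  · intro h
    rw [Ideal.span_singleton_eq_span_singleton] at h
    obtain ⟨u, hu⟩ := h.symm
    obtain ⟨j, hj | hj⟩ := Q.hgen u
    · exact ⟨.inl j, by simp only [fibf, Sum.elim_inl]; rw [← hj, mul_comm]; exact hu⟩
    · exact ⟨.inr j, by simp only [fibf, Sum.elim_inr]; rw [← Units.val_neg, ← hj, mul_comm]; exact hu⟩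

lemma hasSum_fibj {E : Type*} [NormedAddCommGroup E] {f : ℤ → E} {a : E} (h : HasSum f a) :
    HasSum (fun t : ℤ ⊕ ℤ => f (fibj t)) (a + a) := by
  exact HasSum.sum h h

/-- sum over a fibre. -/
lemma hasSum_fib [IsDomain O] {g : O} (hg : g ≠ 0) {E : Type*} [NormedAddCommGroup E] {F : O → E} {f : ℤ → E} {a : E}
    (hF : ∀ t, F (Q.fibf g t) = f (fibj t)) (h : HasSum f a) :
    HasSum (fun k : {k : O // Ideal.span {k} = Ideal.span {g}} => F k) (a + a) := by
  have h1 := hasSum_fibj h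
  simp only [← hF] at h1
  have h2 := ((Q.fib_inj hg).hasSum_range_iff (f := F)).mpr h1
  rw [Q.fib_range g] at h2
  exact h2

variable [IsDomain O] [IsPrincipalIdealRing O]

noncomputable def gen (n : Ideal O) : O := Submodule.IsPrincipal.generator n
lemma span_gen (n : Ideal O) : Ideal.span {gen n} = n := Ideal.span_singleton_generator n
lemma gen_ne {n : Ideal O} (h : n ≠ ⊥) : gen n ≠ 0 := by
  intro h0; apply h; rw [← span_gen n, h0, Ideal.span_singleton_eq_bot]
lemma gen_bot : gen (⊥ : Ideal O) = 0 := by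
  rw [← Ideal.span_singleton_eq_bot, span_gen]

noncomputable def T (m : ℤ) (s : ℂ) (n : Ideal O) : ℂ := Q.T0 m s (gen n)
noncomputable def L (m : ℤ) (s : ℂ) : ℂ := ∑' n, Q.T m s n

lemma T_span (m : ℤ) (s : ℂ) (k : O) : Q.T m s (Ideal.span {k}) = Q.T0 m s k := by
  by_cases hk : k = 0
  · subst hk; rw [T, Set.singleton_zero, Ideal.span_zero, gen_bot]
  · have : gen (Ideal.span {k}) ∈ Set.range (Q.fibf k) := by rw [Q.fib_range]; exact span_gen _
    obtain ⟨t, ht⟩ := this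
    rw [T, ← ht, Q.fib_T0 hk]

lemma T_mul (m : ℤ) (s : ℂ) (a b : Ideal O) : Q.T m s (a * b) = Q.T m s a * Q.T m s b := by
  conv_lhs => rw [← span_gen a, ← span_gen b, Ideal.span_singleton_mul_span_singleton, T_span, T0_mul]
  rfl

lemma fold {α : O} (hα : α ≠ 0) (m : ℤ) {s : ℂ} (hs : 1 < s.re) :
    HasSum (fun n => 2 * Q.T0 m s α * Q.T m s n) (∑' k, Q.Phi m s (α * k)) := by
  have hsum : Summable fun k => Q.Phi m s (α * k) := (Q.Phi_summable m hs).comp_injective (mul_right_injective₀ hα)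
  have h1 := ((Equiv.sigmaFiberEquiv fun k : O => Ideal.span {k}).hasSum_iff).mpr hsum.hasSum
  refine HasSum.sigma h1 fun n => ?_
  by_cases hn : n = ⊥
  · subst hn
    rw [T, gen_bot, T0_zero, mul_zero]
    convert hasSum_zero using 1
    ext k
    have := k.2
    rw [Ideal.span_singleton_eq_bot] at this
    simp [this, Phi_zero]
  · have hg := gen_ne hn
    have h2 : HasSum (fun j : ℤ => (tent (Q.y (α * gen n) + j) : ℂ) * Q.T0 m s (α * gen n)) (Q.T0 m s (α * gen n)) := by
      have := (Complex.hasSum_ofReal.mpr (hasSum_tent (Q.y (α * gen n)))).mul_right (Q.T0 m s (α * gen n))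
      simpa using this
    have h3 := Q.hasSum_fib hg (F := fun k => Q.Phi m s (α * k)) ?_ h2
    · rw [span_gen n] at h3
      have e : 2 * Q.T0 m s α * Q.T m s n = Q.T0 m s (α * gen n) + Q.T0 m s (α * gen n) := by rw [T0_mul, T]; ring
      rw [e]; exact h3
    · intro t
      rw [Phi_eq_T0, T0_mul, Q.fib_T0 hg, y_mul Q hα (Q.fib_ne hg t), Q.fib_y hg, T0_mul, y_mul Q hα hg, add_assoc]

lemma T0_one (m : ℤ) (s : ℂ) : Q.T0 m s 1 = 1 := by
  rw [T0_of_ne _ _ _ one_ne_zero]; simp [y, la, lb]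

lemma T_summable (m : ℤ) {s : ℂ} (hs : 1 < s.re) : Summable fun n => Q.T m s n := by
  have := (Q.fold one_ne_zero m hs).summable.mul_left (1/2)
  refine this.congr fun n => ?_
  rw [T0_one]; ring

lemma fold_eq {α : O} (hα : α ≠ 0) (m : ℤ) {s : ℂ} (hs : 1 < s.re) :
    ∑' k, Q.Phi m s (α * k) = 2 * Q.T0 m s α * Q.L m s := by
  rw [← (Q.fold hα m hs).tsum_eq, tsum_mul_left]; rfl

/-- the Euler-type factor. -/
noncomputable def hh (α : O) (m : ℤ) (s : ℂ) : ℂ := 1 - cexp ((2 * Real.pi * m * Q.y α : ℝ) * I + (1 - s) * (Real.log (Q.X α) : ℂ))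

lemma key_identity {α : O} (hα : α ≠ 0) (m : ℤ) {s : ℂ} (hs : 1 < s.re) :
    Q.hh α m s * (2 * Q.L m s) = Q.Hs α m s := by
  rw [Q.Hs_eq hα m hs, Q.fold_eq hα m hs]
  have h1 := Q.fold_eq one_ne_zero m hs
  simp only [one_mul, T0_one] at h1
  rw [h1]
  have : (Q.X α : ℂ) * Q.T0 m s α = cexp ((2 * Real.pi * m * Q.y α : ℝ) * I + (1 - s) * (Real.log (Q.X α) : ℂ)) := by
    have hX : 0 < Q.X α := by linarith [Q.X_ge hα]
    have e : (Q.X α : ℂ) = cexp (Real.log (Q.X α) : ℂ) := by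
      rw [← Complex.ofReal_exp, Real.exp_log hX]
    rw [T0_of_ne _ _ _ hα, Q.la_add_lb hα]
    conv_lhs => rw [e]
    rw [← Complex.exp_add]; congr 1; ring
  rw [hh, ← this]; ring

end QD
end

section
open Complex Set Filter Topology

lemma glue {A : Type} {U V : Set ℂ} (hU : IsOpen U) (hUp : IsPreconnected U) (hV : IsOpen V) (hVU : V ⊆ U) (hVn : V.Nonempty)
    (num den : A → ℂ → ℂ) (f : ℂ → ℂ) (hn : ∀ a, DifferentiableOn ℂ (num a) U) (hd : ∀ a, DifferentiableOn ℂ (den a) U)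
    (hf : ∀ a, ∀ s ∈ V, den a s * f s = num a s) (hne : ∀ s ∈ U, ∃ a, den a s ≠ 0) :
    ∃ Z : ℂ → ℂ, DifferentiableOn ℂ Z U ∧ (∀ s ∈ V, Z s = f s) ∧ ∀ a, ∀ s ∈ U, den a s * Z s = num a s := by
  have cross : ∀ a b, ∀ s ∈ U, num a s * den b s = num b s * den a s := by
    intro a b
    obtain ⟨z, hz⟩ := hVn
    have h1 : AnalyticOnNhd ℂ (fun s => num a s * den b s) U := ((hn a).mul (hd b)).analyticOnNhd hU
    have h2 : AnalyticOnNhd ℂ (fun s => num b s * den a s) U := ((hn b).mul (hd a)).analyticOnNhd hU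
    exact h1.eqOn_of_preconnected_of_eventuallyEq h2 hUp (hVU hz) (by
      filter_upwards [hV.mem_nhds hz] with s hs
      rw [← hf a s hs, ← hf b s hs]; ring)
  have : Nonempty A := by
    obtain ⟨z, hz⟩ := hVn
    exact ⟨(hne z (hVU hz)).choose⟩
  choose! c hc using hne
  have main : ∀ a, ∀ s ∈ U, den a s * (num (c s) s / den (c s) s) = num a s := by
    intro a s hs
    have := cross a (c s) s hs
    have h0 := hc s hs
    field_simp
    linear_combination -this
  refine ⟨fun s => num (c s) s / den (c s) s, ?_, ?_, main⟩
  · intro s hs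
    have h0 := hc s hs
    have hda := (hd (c s)).differentiableAt (hU.mem_nhds hs)
    have hna := (hn (c s)).differentiableAt (hU.mem_nhds hs)
    have he : (fun w => num (c w) w / den (c w) w) =ᶠ[𝓝 s] fun w => num (c s) w / den (c s) w := by
      filter_upwards [hU.mem_nhds hs, hda.continuousAt.eventually_ne h0] with w hw hw0
      rw [eq_div_iff hw0, mul_comm]
      exact main (c s) w hw
    exact ((hna.div hda h0).congr_of_eventuallyEq he).differentiableWithinAt
  · intro s hs
    have h0 := hc s (hVU hs)
    rw [div_eq_iff h0, ← hf _ s hs, mul_comm]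

lemma growth_aux : ∃ c : ℝ, 0 < c ∧ ∀ (Z G : ℂ → ℂ) (E μ : ℝ), DifferentiableOn ℂ Z {s | 1 / 2 < s.re} → 0 ≤ E → 0 ≤ μ →
    (∀ s : ℂ, 1 / 2 < s.re → (1 - cexp ((1 - s) * (Real.log 4 : ℂ))) * Z s = G s) →
    (∀ s : ℂ, 3 / 4 ≤ s.re → s.re ≤ 4 → ‖G s‖ ≤ E * (2 + |s.im| + μ) ^ 2) →
    ∀ s : ℂ, 3 / 4 ≤ s.re → s.re ≤ 4 → ‖Z s‖ ≤ c * E * (2 + |s.im| + μ) ^ 2 := by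
  have hlog : 1 < Real.log 4 := by
    rw [Real.lt_log_iff_exp_lt (by norm_num)]; exact Real.exp_one_lt_d9.trans (by norm_num)
  set l4 := Real.log 4 with hl4
  set c1 := Real.exp (l4 / 8) - 1 with hc1
  set c2 := 1 - Real.exp (-(l4 / 8)) with hc2
  have hc1p : 0 < c1 := by rw [hc1, sub_pos]; exact Real.one_lt_exp_iff.mpr (by linarith)
  have hc2p : 0 < c2 := by rw [hc2, sub_pos]; rw [← Real.exp_zero]; exact Real.exp_lt_exp.mpr (by linarith)
  set c := min 1 (min c1 c2) with hc
  have hcp : 0 < c := lt_min one_pos (lt_min hc1p hc2p)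
  have hcc1 : c ≤ c1 := (min_le_right _ _).trans (min_le_left _ _)
  have hcc2 : c ≤ c2 := (min_le_right _ _).trans (min_le_right _ _)
  have hcc : c ≤ 1 := min_le_left _ _
  have hnorm : ∀ s : ℂ, ‖cexp ((1 - s) * (l4 : ℂ))‖ = Real.exp ((1 - s.re) * l4) := by
    intro s; rw [Complex.norm_exp, Complex.re_mul_ofReal]; simp
  have low1 : ∀ s : ℂ, s.re ≤ 7 / 8 → c ≤ ‖1 - cexp ((1 - s) * (l4 : ℂ))‖ := by
    intro s hs
    have h1 := norm_sub_norm_le (cexp ((1 - s) * (l4 : ℂ))) 1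
    rw [norm_sub_rev, norm_one, hnorm] at h1
    have : Real.exp (l4 / 8) ≤ Real.exp ((1 - s.re) * l4) := Real.exp_le_exp.mpr (by nlinarith)
    linarith
  have low2 : ∀ s : ℂ, 9 / 8 ≤ s.re → c ≤ ‖1 - cexp ((1 - s) * (l4 : ℂ))‖ := by
    intro s hs
    have h1 := norm_sub_norm_le 1 (cexp ((1 - s) * (l4 : ℂ)))
    rw [norm_one, hnorm] at h1
    have : Real.exp ((1 - s.re) * l4) ≤ Real.exp (-(l4 / 8)) := Real.exp_le_exp.mpr (by nlinarith)
    linarith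
  have low3 : ∀ s : ℂ, (∃ k : ℤ, s.im * l4 = (2 * k + 1) * Real.pi) → c ≤ ‖1 - cexp ((1 - s) * (l4 : ℂ))‖ := by
    rintro s ⟨k, hk⟩
    have e : cexp ((1 - s) * (l4 : ℂ)) = -(Real.exp ((1 - s.re) * l4) : ℂ) := by
      have e1 : (1 - s) * (l4 : ℂ) = (((1 - s.re) * l4 : ℝ) : ℂ) - ((s.im * l4 : ℝ) : ℂ) * I := by
        conv_lhs => rw [← Complex.re_add_im s]
        push_cast; ring
      rw [e1, hk, Complex.exp_sub]
      have e2 : (((2 * k + 1) * Real.pi : ℝ) : ℂ) * I = Real.pi * I + k * (2 * Real.pi * I) := by push_cast; ring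
      rw [e2, Complex.exp_add, Complex.exp_pi_mul_I, Complex.exp_int_mul_two_pi_mul_I]
      push_cast; ring
    rw [e, sub_neg_eq_add, ← Complex.ofReal_one, ← Complex.ofReal_add, Complex.norm_real, Real.norm_eq_abs]
    have := Real.exp_pos ((1 - s.re) * l4)
    rw [abs_of_pos (by linarith)]; linarith
  refine ⟨36 / c, by positivity, ?_⟩
  intro Z G E μ hZ hE hμ hZG hG
  have basic : ∀ s : ℂ, 3 / 4 ≤ s.re → s.re ≤ 4 → c ≤ ‖1 - cexp ((1 - s) * (l4 : ℂ))‖ →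
      ‖Z s‖ ≤ 1 / c * E * (2 + |s.im| + μ) ^ 2 := by
    intro s h1 h2 h3
    have h4 := hZG s (by linarith)
    have h5 := hG s h1 h2
    rw [← h4, norm_mul] at h5
    have : c * ‖Z s‖ ≤ E * (2 + |s.im| + μ) ^ 2 := (mul_le_mul_of_nonneg_right h3 (norm_nonneg _)).trans h5
    have e : 1 / c * E * (2 + |s.im| + μ) ^ 2 = (E * (2 + |s.im| + μ) ^ 2) / c := by ring
    rw [e, le_div_iff₀ hcp]; linarith
  have up : ∀ t t' : ℝ, |t'| ≤ |t| + 10 → 1 / c * E * (2 + |t'| + μ) ^ 2 ≤ 36 / c * E * (2 + |t| + μ) ^ 2 := by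
    intro t t' h
    have h0 := abs_nonneg t
    have h0' := abs_nonneg t'
    have h1 : (2 + |t'| + μ) ^ 2 ≤ (6 * (2 + |t| + μ)) ^ 2 := by
      apply pow_le_pow_left₀ (by positivity); linarith
    calc 1 / c * E * (2 + |t'| + μ) ^ 2 ≤ 1 / c * E * (6 * (2 + |t| + μ)) ^ 2 := by gcongr
      _ = _ := by ring
  intro s hs1 hs2
  rcases le_or_gt s.re (7 / 8) with h | h
  · exact (basic s hs1 hs2 (low1 s h)).trans (up _ _ (by linarith))
  rcases le_or_gt (9 / 8) s.re with h' | h'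
  · exact (basic s hs1 hs2 (low2 s h')).trans (up _ _ (by linarith))
  -- rectangle
  have hpi := Real.pi_pos
  have hpi4 := Real.pi_le_four
  set k : ℤ := ⌊(s.im * l4 / Real.pi - 1) / 2⌋ with hk
  have k1 : (k : ℝ) ≤ (s.im * l4 / Real.pi - 1) / 2 := Int.floor_le _
  have k2 : (s.im * l4 / Real.pi - 1) / 2 < k + 1 := Int.lt_floor_add_one _
  have k3 : (2 * k + 1) * Real.pi ≤ s.im * l4 := by
    have : (2 * k + 1 : ℝ) ≤ s.im * l4 / Real.pi := by linarith
    rwa [le_div_iff₀ hpi] at this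
  have k4 : s.im * l4 < (2 * (k + 1) + 1) * Real.pi := by
    have : s.im * l4 / Real.pi < 2 * (k + 1) + 1 := by linarith
    rwa [div_lt_iff₀ hpi] at this
  have hl0 : 0 < l4 := by linarith
  set t1 := (2 * k + 1) * Real.pi / l4 with ht1
  set t2 := (2 * (k + 1) + 1) * Real.pi / l4 with ht2
  have s1 : t1 ≤ s.im := by rw [ht1, div_le_iff₀ hl0]; exact k3
  have s2 : s.im < t2 := by rw [ht2, lt_div_iff₀ hl0]; exact k4
  have s3 : t2 - t1 ≤ 8 := by
    rw [ht1, ht2, ← sub_div, div_le_iff₀ hl0]; nlinarith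
  have hlt : t1 < t2 := by linarith
  have hcl : closure (Ioo (7/8:ℝ) (9/8) ×ℂ Ioo t1 t2) = Icc (7/8:ℝ) (9/8) ×ℂ Icc t1 t2 := by
    rw [closure_reProdIm, closure_Ioo (by norm_num), closure_Ioo hlt.ne]
  have hb : Bornology.IsBounded (Ioo (7/8:ℝ) (9/8) ×ℂ Ioo t1 t2) := (Metric.isBounded_Ioo _ _).reProdIm (Metric.isBounded_Ioo _ _)
  have hdiff : DiffContOnCl ℂ Z (Ioo (7/8:ℝ) (9/8) ×ℂ Ioo t1 t2) := by
    apply DifferentiableOn.diffContOnCl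
    rw [hcl]
    apply hZ.mono
    rintro w ⟨hw, -⟩
    have : 7/8 ≤ w.re := hw.1
    change 1 / 2 < w.re
    linarith
  refine Complex.norm_le_of_forall_mem_frontier_norm_le hb hdiff (C := 36 / c * E * (2 + |s.im| + μ) ^ 2) ?_ (z := s) ?_
  · intro w hw
    have hwc : w ∈ Icc (7/8:ℝ) (9/8) ×ℂ Icc t1 t2 := by rw [← hcl]; exact frontier_subset_closure hw
    have r1 : 7/8 ≤ w.re := hwc.1.1
    have r2 : w.re ≤ 9/8 := hwc.1.2
    have i1 : t1 ≤ w.im := hwc.2.1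
    have i2 : w.im ≤ t2 := hwc.2.2
    have hnw : w ∉ Ioo (7/8:ℝ) (9/8) ×ℂ Ioo t1 t2 := by
      have ho : IsOpen (Ioo (7/8:ℝ) (9/8) ×ℂ Ioo t1 t2) := isOpen_Ioo.reProdIm isOpen_Ioo
      rw [frontier, ho.interior_eq] at hw; exact hw.2
    have hbound : c ≤ ‖1 - cexp ((1 - w) * (l4 : ℂ))‖ := by
      rcases le_or_gt w.re (7/8) with a | a
      · exact low1 w a
      rcases le_or_gt (9/8) w.re with b | b
      · exact low2 w b
      apply low3
      rcases eq_or_lt_of_le i1 with e | e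
      · exact ⟨k, by rw [← e, ht1]; field_simp⟩
      rcases eq_or_lt_of_le i2 with e' | e'
      · exact ⟨k + 1, by rw [e', ht2]; push_cast; field_simp⟩
      exact absurd ⟨⟨a, b⟩, ⟨e, e'⟩⟩ hnw
    refine (basic w (by linarith) (by linarith) hbound).trans (up _ _ ?_)
    have : |w.im - s.im| ≤ 8 := by rw [abs_le]; constructor <;> linarith
    have := abs_sub_abs_le_abs_sub w.im s.im
    linarith
  · rw [hcl]; exact ⟨⟨h.le, h'.le⟩, ⟨s1, s2.le⟩⟩

namespace QD
variable {O : Type} [CommRing O] (Q : QD O)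

lemma X_two : Q.X 2 = 4 := by unfold X; rw [map_ofNat, map_ofNat]; norm_num
lemma X_three : Q.X 3 = 9 := by unfold X; rw [map_ofNat, map_ofNat]; norm_num
lemma y_two : Q.y 2 = 0 := by unfold y la lb; rw [map_ofNat, map_ofNat]; simp
lemma y_three : Q.y 3 = 0 := by unfold y la lb; rw [map_ofNat, map_ofNat]; simp
lemma two_ne (Q : QD O) : (2 : O) ≠ 0 := by
  intro h; have := congrArg Q.s1 h; rw [map_ofNat, map_zero] at this; norm_num at this
lemma three_ne (Q : QD O) : (3 : O) ≠ 0 := by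
  intro h; have := congrArg Q.s1 h; rw [map_ofNat, map_zero] at this; norm_num at this

lemma hh_diff (α : O) (m : ℤ) : Differentiable ℂ (Q.hh α m) := by
  unfold hh; fun_prop

lemma hh_two (m : ℤ) (s : ℂ) : Q.hh 2 m s = 1 - cexp ((1 - s) * (Real.log 4 : ℂ)) := by
  rw [hh, X_two, y_two]; simp
lemma hh_three (m : ℤ) (s : ℂ) : Q.hh 3 m s = 1 - cexp ((1 - s) * (Real.log 9 : ℂ)) := by
  rw [hh, X_three, y_three]; simp

lemma hh_ne {m : ℤ} {s : ℂ} (hs : s ≠ 1) : Q.hh 2 m s ≠ 0 ∨ Q.hh 3 m s ≠ 0 := by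
  by_contra hcon
  push Not at hcon
  obtain ⟨h1, h2⟩ := hcon
  rw [hh_two, sub_eq_zero, eq_comm, Complex.exp_eq_one_iff] at h1
  rw [hh_three, sub_eq_zero, eq_comm, Complex.exp_eq_one_iff] at h2
  obtain ⟨a, ha⟩ := h1
  obtain ⟨b, hb⟩ := h2
  have hp : (2 * Real.pi * I : ℂ) ≠ 0 := by simp [Real.pi_ne_zero]
  have hs0 : 1 - s ≠ 0 := fun h => hs (by linear_combination -h)
  have l4 : (Real.log 4) = 2 * Real.log 2 := by
    rw [show (4:ℝ) = 2 ^ 2 by norm_num, Real.log_pow]; norm_num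
  have l9 : (Real.log 9) = 2 * Real.log 3 := by
    rw [show (9:ℝ) = 3 ^ 2 by norm_num, Real.log_pow]; norm_num
  have hl2 : Real.log 2 > 0 := Real.log_pos (by norm_num)
  have hl3 : Real.log 3 > 0 := Real.log_pos (by norm_num)
  have e : (1 - s) * (2 * Real.pi * I) * ((a : ℂ) * (Real.log 9 : ℂ)) = (1 - s) * (2 * Real.pi * I) * ((b : ℂ) * (Real.log 4 : ℂ)) := by
    linear_combination (-(1 - s) * (Real.log 9 : ℂ)) * ha + (1 - s) * (Real.log 4 : ℂ) * hb
  have e2 := mul_left_cancel₀ (mul_ne_zero hs0 hp) e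
  have e3 : (a : ℝ) * Real.log 9 = b * Real.log 4 := by exact_mod_cast e2
  have ha0 : a ≠ 0 := by
    rintro rfl
    have : (Real.log 4 : ℂ) ≠ 0 := by rw [l4]; exact_mod_cast (by positivity)
    simp at ha
    rcases ha with h | h
    · exact hs0 h
    · exact this (by simpa using h)
  have e4 : (a : ℝ) * Real.log 3 = b * Real.log 2 := by rw [l4, l9] at e3; linarith
  have e5 : (a.natAbs : ℝ) * Real.log 3 = b.natAbs * Real.log 2 := by
    have := congrArg abs e4
    rw [abs_mul, abs_mul, abs_of_pos hl2, abs_of_pos hl3, ← Int.cast_abs, ← Int.cast_abs] at this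
    rw [Nat.cast_natAbs, Nat.cast_natAbs]; exact this
  rw [← Real.log_pow, ← Real.log_pow] at e5
  have e6 := Real.log_injOn_pos (by simp) (by simp) e5
  have e7 : 3 ^ a.natAbs = 2 ^ b.natAbs := by exact_mod_cast e6
  have hb0 : b.natAbs ≠ 0 := by
    intro h; rw [h, pow_zero] at e7
    have := Nat.one_lt_pow (Int.natAbs_ne_zero.mpr ha0) (by norm_num : 1 < 3)
    omega
  have : Even (3 ^ a.natAbs) := by rw [e7]; exact (Nat.even_pow.mpr ⟨even_two, hb0⟩)
  rw [Nat.even_pow] at this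
  exact absurd this.1 (by decide)

lemma isPre : IsPreconnected {s : ℂ | 1 / 2 < s.re} := (convex_halfSpace_re_gt _).isPreconnected
lemma isOp (c : ℝ) : IsOpen {s : ℂ | c < s.re} := isOpen_lt continuous_const continuous_re

variable [IsDomain O] [IsPrincipalIdealRing O]

lemma exists_Z (hy : ∀ m : ℤ, m ≠ 0 → ∃ α : O, α ≠ 0 ∧ Q.hh α m 1 ≠ 0) (m : ℤ) :
    ∃ Z : ℂ → ℂ, DifferentiableOn ℂ Z {s | 1 / 2 < s.re} ∧
      (∀ s : ℂ, 1 < s.re → Z s = (if m = 0 then s - 1 else 1) * (2 * Q.L m s)) ∧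
      ∀ s : ℂ, 1 / 2 < s.re → Q.hh 2 m s * Z s = (if m = 0 then s - 1 else 1) * Q.Hs 2 m s := by
  have hV : {s : ℂ | 1 < s.re} ⊆ {s : ℂ | 1 / 2 < s.re} := fun s hs => by
    have : 1 < s.re := hs
    change 1 / 2 < s.re; linarith
  have hVn : {s : ℂ | 1 < s.re}.Nonempty := ⟨2, by change 1 < (2:ℂ).re; norm_num⟩
  by_cases hm : m = 0
  · subst hm
    have hone : ∀ α : O, Q.hh α 0 1 = 0 := fun α => by rw [hh]; simp
    have hds : ∀ (α : O) (s : ℂ), (s - 1) * dslope (Q.hh α 0) 1 s = Q.hh α 0 s := by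
      intro α s
      have := sub_smul_dslope (Q.hh α 0) 1 s
      rw [hone, sub_zero, smul_eq_mul] at this; exact this
    obtain ⟨Z, h1, h2, h3⟩ := glue (A := {α : O // α ≠ 0}) (isOp (1/2)) isPre (isOp 1) hV hVn
      (fun α => Q.Hs α.1 0) (fun α => dslope (Q.hh α.1 0) 1) (fun s => (s - 1) * (2 * Q.L 0 s))
      (fun α => Q.Hs_diff α.2 0)
      (fun α => (Complex.differentiableOn_dslope ((isOp (1/2)).mem_nhds (by change (1/2:ℝ) < (1:ℂ).re; norm_num))).mpr
        (Q.hh_diff α.1 0).differentiableOn)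
      (fun α s hs => by
        rw [← Q.key_identity α.2 0 hs, ← hds]; ring)
      (fun s _ => by
        by_cases hs : s = 1
        · refine ⟨⟨2, Q.two_ne⟩, ?_⟩
          subst hs
          rw [dslope_same]
          have hd : HasDerivAt (Q.hh 2 0) (Real.log 4 : ℂ) 1 := by
            have h : HasDerivAt (fun s : ℂ => 1 - cexp ((1 - s) * (Real.log 4 : ℂ))) (-(cexp ((1 - 1) * (Real.log 4 : ℂ)) * ((0 - 1) * (Real.log 4 : ℂ)))) 1 :=
              ((((hasDerivAt_const (1:ℂ) (1:ℂ)).sub (hasDerivAt_id (1:ℂ))).mul_const _).cexp).const_sub 1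
            convert h using 1
            · ext s; exact Q.hh_two 0 s
            · simp
          rw [hd.deriv]
          have : Real.log 4 ≠ 0 := (Real.log_pos (by norm_num)).ne'
          exact_mod_cast this
        · have hs1 : s - 1 ≠ 0 := sub_ne_zero.mpr hs
          rcases Q.hh_ne (m := 0) hs with h | h
          · exact ⟨⟨2, Q.two_ne⟩, fun h0 => h (by rw [← hds, h0, mul_zero])⟩
          · exact ⟨⟨3, Q.three_ne⟩, fun h0 => h (by rw [← hds, h0, mul_zero])⟩)
    refine ⟨Z, h1, fun s hs => by rw [h2 s hs, if_pos rfl], fun s hs => ?_⟩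
    rw [if_pos rfl, ← h3 ⟨2, Q.two_ne⟩ s hs, ← hds]; ring
  · obtain ⟨Z, h1, h2, h3⟩ := glue (A := {α : O // α ≠ 0}) (isOp (1/2)) isPre (isOp 1) hV hVn
      (fun α => Q.Hs α.1 m) (fun α => Q.hh α.1 m) (fun s => 2 * Q.L m s)
      (fun α => Q.Hs_diff α.2 m) (fun α => (Q.hh_diff α.1 m).differentiableOn)
      (fun α s hs => Q.key_identity α.2 m hs)
      (fun s _ => by
        by_cases hs : s = 1
        · obtain ⟨α, h0, h⟩ := hy m hm
          exact ⟨⟨α, h0⟩, by rw [hs]; exact h⟩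
        · rcases Q.hh_ne (m := m) hs with h | h
          · exact ⟨⟨2, Q.two_ne⟩, h⟩
          · exact ⟨⟨3, Q.three_ne⟩, h⟩)
    refine ⟨Z, h1, fun s hs => by rw [h2 s hs, if_neg hm, one_mul], fun s hs => ?_⟩
    rw [if_neg hm, ← h3 ⟨2, Q.two_ne⟩ s hs, one_mul]

/-- all the `Z m`, with polynomial growth. -/
lemma exists_Z_growth (hy : ∀ m : ℤ, m ≠ 0 → ∃ α : O, α ≠ 0 ∧ Q.hh α m 1 ≠ 0) :
    ∃ Z : ℤ → ℂ → ℂ, (∀ m, DifferentiableOn ℂ (Z m) {s | 1 / 2 < s.re}) ∧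
      (∀ m, ∀ s : ℂ, 1 < s.re → Z m s = (if m = 0 then s - 1 else 1) * (2 * Q.L m s)) ∧
      ∃ B : ℝ, 0 < B ∧ ∀ (m : ℤ) (s : ℂ), 3 / 4 ≤ s.re → s.re ≤ 4 → ‖Z m s‖ ≤ B * (2 + |s.im| + |(m:ℝ)|) ^ (2:ℝ) := by
  choose Z h1 h2 h3 using Q.exists_Z hy
  obtain ⟨c, hc, hg⟩ := growth_aux
  obtain ⟨D, hD, hb⟩ := Q.Hs_bound Q.two_ne 4
  refine ⟨Z, h1, h2, c * (D * 9), by positivity, fun m s hs1 hs2 => ?_⟩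
  have := hg (Z m) (fun s => (if m = 0 then s - 1 else 1) * Q.Hs 2 m s) (D * 9) |(m:ℝ)| (h1 m) (by positivity) (abs_nonneg _)
    (fun s hs => by rw [← Q.hh_two m, h3 m s hs]) ?_ s hs1 hs2
  · rw [show (2:ℝ) = ((2:ℕ):ℝ) by norm_num, Real.rpow_natCast]; exact_mod_cast this
  · intro s hs1 hs2
    have hn : ‖s‖ ≤ 4 + |s.im| := by
      have := Complex.norm_le_abs_re_add_abs_im s
      rw [abs_of_nonneg (by linarith)] at this; linarith
    have p0 := abs_nonneg s.im
    have p1 := abs_nonneg (m:ℝ)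
    have q1 : ‖(if m = 0 then s - 1 else 1 : ℂ)‖ ≤ 3 * (2 + |s.im| + |(m:ℝ)|) := by
      split_ifs
      · have := norm_sub_le s 1; rw [norm_one] at this; linarith
      · rw [norm_one]; linarith
    have q2 : ‖Q.Hs 2 m s‖ ≤ D * (3 * (2 + |s.im| + |(m:ℝ)|)) := by
      refine (hb m s hs1 hs2).trans ?_
      gcongr; linarith
    rw [norm_mul]
    refine (mul_le_mul q1 q2 (norm_nonneg _) (by positivity)).trans (le_of_eq ?_)
    ring

end QD
end

section
open Complex Set Filter Topology

namespace QD
variable {O : Type} [CommRing O] (Q : QD O) [IsDomain O] [IsPrincipalIdealRing O]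

noncomputable def gX (n : Ideal O) : ℝ := Q.X (gen n)

lemma gX_span (k : O) : Q.gX (Ideal.span {k}) = Q.X k := by
  by_cases hk : k = 0
  · subst hk; rw [gX, Set.singleton_zero, Ideal.span_zero, gen_bot]
  · have : gen (Ideal.span {k}) ∈ Set.range (Q.fibf k) := by rw [Q.fib_range]; exact span_gen _
    obtain ⟨t, ht⟩ := this
    rw [gX, ← ht, Q.fib_X]

lemma gX_mul (a b : Ideal O) : Q.gX (a * b) = Q.gX a * Q.gX b := by
  conv_lhs => rw [← span_gen a, ← span_gen b, Ideal.span_singleton_mul_span_singleton, gX_span, X_mul]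
  rfl

lemma gX_ge {n : Ideal O} (hn : n ≠ ⊥) : 1 ≤ Q.gX n := Q.X_ge (gen_ne hn)

lemma gX_one : Q.gX (1 : Ideal O) = 1 := by
  rw [Ideal.one_eq_top, ← Ideal.span_singleton_one, gX_span]; simp [X]

lemma gX_gt {n : Ideal O} (hn : n ≠ ⊥) (hn1 : n ≠ 1) : 2 ≤ Q.gX n := by
  have h := Q.hcard _ (gen_ne hn)
  rw [span_gen] at h
  have h1 := Q.gX_ge hn
  rw [gX, X, ← h] at h1 ⊢
  have h2 : Nat.card (O ⧸ n) ≠ 1 := by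
    intro hc
    rw [Nat.card_eq_one_iff_unique] at hc
    apply hn1
    rw [Ideal.one_eq_top]
    exact Ideal.Quotient.subsingleton_iff.mp hc.1
  have h3 : 1 ≤ Nat.card (O ⧸ n) := by exact_mod_cast h1
  have : 2 ≤ Nat.card (O ⧸ n) := by omega
  exact_mod_cast this

/-- von Mangoldt function on ideals. -/
structure IsVM (Λ : Ideal O → ℝ) : Prop where
  h1 : ∀ (p : Ideal O) (k : ℕ), Prime p → 1 ≤ k → Λ (p ^ k) = Real.log (Q.gX p)
  h0 : ∀ n : Ideal O, (¬ ∃ (p : Ideal O) (k : ℕ), Prime p ∧ 1 ≤ k ∧ n = p ^ k) → Λ n = 0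

variable {Q} {Λ : Ideal O → ℝ}

lemma IsVM.nonneg (h : Q.IsVM Λ) (n : Ideal O) : 0 ≤ Λ n := by
  by_cases hn : ∃ (p : Ideal O) (k : ℕ), Prime p ∧ 1 ≤ k ∧ n = p ^ k
  · obtain ⟨p, k, hp, hk, rfl⟩ := hn
    rw [h.h1 p k hp hk]
    exact Real.log_nonneg (Q.gX_ge hp.ne_zero)
  · rw [h.h0 n hn]

lemma IsVM.bot (h : Q.IsVM Λ) : Λ ⊥ = 0 := by
  apply h.h0
  rintro ⟨p, k, hp, hk, he⟩
  exact pow_ne_zero k hp.ne_zero he.symm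

open Classical in
lemma IsVM.conv (h : Q.IsVM Λ) : ∀ n : Ideal O, n ≠ 0 → HasSum (fun a => if a ∣ n then Λ a else 0) (Real.log (Q.gX n)) := by
  intro n
  refine UniqueFactorizationMonoid.induction_on_prime n (fun h0 => absurd rfl h0) ?_ ?_
  · intro x hx _
    rw [Ideal.isUnit_iff.mp hx, ← Ideal.one_eq_top, gX_one, Real.log_one]
    convert hasSum_zero using 1
    ext a
    split_ifs with ha
    · apply h.h0
      rintro ⟨p, k, hp, hk, rfl⟩
      exact hp.not_isUnit (isUnit_of_dvd_one ((dvd_pow_self p (by omega)).trans ha))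
    · rfl
  · intro a p ha hp ih _
    have hs := ih ha
    have hfin : FiniteMultiplicity p a := FiniteMultiplicity.of_prime_left hp ha
    obtain ⟨c, hc, hpc⟩ := hfin.exists_eq_pow_mul_and_not_dvd
    set v := multiplicity p a with hv
    have hpa : p * a = p ^ (v + 1) * c := by rw [hc]; ring
    have hs2 : HasSum (fun b : Ideal O => if b = p ^ (v + 1) then Real.log (Q.gX p) else 0) (Real.log (Q.gX p)) :=
      hasSum_ite_eq _ _
    have hlog : Real.log (Q.gX (p * a)) = Real.log (Q.gX a) + Real.log (Q.gX p) := by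
      rw [gX_mul, Real.log_mul (by have := Q.gX_ge hp.ne_zero; positivity) (by have := Q.gX_ge ha; positivity), add_comm]
    rw [hlog]
    have hs3 := hs.add hs2
    have e : (fun b => if b ∣ p * a then Λ b else 0) =
        fun b => (if b ∣ a then Λ b else 0) + (if b = p ^ (v + 1) then Real.log (Q.gX p) else 0) := by
      ext b
      by_cases hb : ∃ (q : Ideal O) (k : ℕ), Prime q ∧ 1 ≤ k ∧ b = q ^ k
      · obtain ⟨q, k, hq, hk, rfl⟩ := hb
        by_cases hqp : q = p
        · subst hqp
          have hu : ¬ IsUnit q := hq.not_isUnit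
          have i1 : q ^ k ∣ a ↔ k ≤ v := by
            constructor
            · intro hd
              by_contra hlt
              push Not at hlt
              have : q ^ v * q ∣ q ^ v * c := by
                rw [← pow_succ, ← hc]; exact (pow_dvd_pow q hlt).trans hd
              exact hpc ((mul_dvd_mul_iff_left (pow_ne_zero v hq.ne_zero)).mp this)
            · intro hle; rw [hc]; exact (pow_dvd_pow q hle).trans (dvd_mul_right _ _)
          have i2 : q ^ k ∣ q * a ↔ k ≤ v + 1 := by
            rw [hpa]
            constructor
            · intro hd
              by_contra hlt
              push Not at hlt
              have : q ^ (v + 1) * q ∣ q ^ (v + 1) * c := by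
                rw [← pow_succ]; exact (pow_dvd_pow q hlt).trans hd
              exact hpc ((mul_dvd_mul_iff_left (pow_ne_zero (v + 1) hq.ne_zero)).mp this)
            · intro hle; exact (pow_dvd_pow q hle).trans (dvd_mul_right _ _)
          have i3 : q ^ k = q ^ (v + 1) ↔ k = v + 1 :=
            ⟨fun hh => pow_injective_of_not_isUnit hu hq.ne_zero hh, fun hh => by rw [hh]⟩
          simp only [i1, i2, i3, h.h1 q k hq hk]
          rcases lt_trichotomy k (v + 1) with hlt | heq | hgt
          · rw [if_pos (by omega), if_pos (by omega), if_neg (by omega), add_zero]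
          · rw [if_pos (by omega), if_neg (by omega), if_pos heq, zero_add]
          · rw [if_neg (by omega), if_neg (by omega), if_neg (by omega), add_zero]
        · have hnd : ¬ q ∣ p := fun hd => hqp (associated_iff_eq.mp (hq.associated_of_dvd hp hd))
          have i1 : q ^ k ∣ p * a ↔ q ^ k ∣ a := ⟨fun hd => hq.pow_dvd_of_dvd_mul_left k hnd hd, fun hd => hd.trans (dvd_mul_left _ _)⟩
          have i2 : q ^ k ≠ p ^ (v + 1) := by
            intro he
            exact hnd (hq.dvd_of_dvd_pow ((dvd_pow_self q (by omega : k ≠ 0)).trans he.dvd))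
          simp only [i1, i2, if_false, add_zero]
      · have hne : b ≠ p ^ (v + 1) := fun he => hb ⟨p, v + 1, hp, by omega, he⟩
        rw [h.h0 b hb]; simp [hne]
    rw [e]; exact hs3

lemma IsVM.le_log (h : Q.IsVM Λ) (n : Ideal O) : Λ n ≤ Real.log (Q.gX n) := by
  classical
  by_cases hn : n = ⊥
  · subst hn; rw [h.bot, gX, gen_bot]; simp [X]
  · have := (h.conv n hn)
    have h2 := le_hasSum this n (fun j _ => by split_ifs; exacts [h.nonneg j, le_rfl])
    simpa using h2

variable (Q)

lemma T_of_ne (m : ℤ) (s : ℂ) {n : Ideal O} (hn : n ≠ ⊥) : Q.T m s n =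
    cexp ((2 * Real.pi * m * Q.y (gen n) : ℝ) * I - s * (Real.log (Q.gX n) : ℂ)) := by
  rw [T, T0_of_ne _ _ _ (gen_ne hn), Q.la_add_lb (gen_ne hn)]; rfl
lemma T_bot (m : ℤ) (s : ℂ) : Q.T m s (⊥ : Ideal O) = 0 := by rw [T, gen_bot, T0_zero]
lemma T_unit (m : ℤ) (s : ℂ) : Q.T m s (1 : Ideal O) = 1 := by
  rw [Ideal.one_eq_top, ← Ideal.span_singleton_one, T_span, T0_one]

lemma T_norm (m : ℤ) (s : ℂ) {n : Ideal O} (hn : n ≠ ⊥) : ‖Q.T m s n‖ = Q.gX n ^ (-s.re) := by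
  rw [T_of_ne Q m s hn, Complex.norm_exp, Real.rpow_def_of_pos (by linarith [Q.gX_ge hn])]
  congr 1
  rw [Complex.sub_re, Complex.re_mul_ofReal, Complex.re_ofReal_mul]; simp; ring

lemma T_norm_anti (m m' : ℤ) (s s' : ℂ) (hs : s'.re ≤ s.re) (n : Ideal O) : ‖Q.T m s n‖ ≤ ‖Q.T m' s' n‖ := by
  by_cases hn : n = ⊥
  · rw [hn, T_bot, T_bot]
  · rw [T_norm Q _ _ hn, T_norm Q _ _ hn]
    exact Real.rpow_le_rpow_of_exponent_le (Q.gX_ge hn) (by linarith)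

lemma T_zero_real (σ : ℝ) (n : Ideal O) : Q.T 0 σ n = (‖Q.T 0 σ n‖ : ℂ) := by
  by_cases hn : n = ⊥
  · rw [hn, T_bot]; simp
  · rw [T_norm Q _ _ hn, T_of_ne Q _ _ hn, Real.rpow_def_of_pos (by linarith [Q.gX_ge hn])]
    push_cast; congr 1; simp; ring

lemma T_hasDeriv (m : ℤ) (s : ℂ) (n : Ideal O) : HasDerivAt (fun w => Q.T m w n) (-(Real.log (Q.gX n) : ℂ) * Q.T m s n) s := by
  by_cases hn : n = ⊥
  · subst hn; simp only [T_bot, mul_zero]; exact hasDerivAt_const _ _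
  · have e : (fun w => Q.T m w n) = fun w => cexp ((2 * Real.pi * m * Q.y (gen n) : ℝ) * I - w * (Real.log (Q.gX n) : ℂ)) := by
      ext w; exact T_of_ne Q m w hn
    rw [e, T_of_ne Q m s hn]
    have := (((hasDerivAt_id s).mul_const (Real.log (Q.gX n) : ℂ)).const_sub ((2 * Real.pi * m * Q.y (gen n) : ℝ) * I)).cexp
    refine this.congr_deriv ?_
    simp only [id]; ring

lemma L_deriv (m : ℤ) {s : ℂ} (hs : 1 < s.re) :
    HasSum (fun n => -(Real.log (Q.gX n) : ℂ) * Q.T m s n) (deriv (Q.L m) s) ∧ DifferentiableAt ℂ (Q.L m) s := by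
  set σ : ℝ := (s.re + 1) / 2 with hσ
  have hu : Summable fun n => ‖Q.T m (σ : ℂ) n‖ := (Q.T_summable m (s := (σ:ℂ)) (by rw [Complex.ofReal_re]; linarith)).norm
  have hd : ∀ n, DifferentiableOn ℂ (fun w => Q.T m w n) {w : ℂ | σ < w.re} :=
    fun n w _ => (Q.T_hasDeriv m w n).differentiableAt.differentiableWithinAt
  have hle : ∀ n, ∀ w ∈ {w : ℂ | σ < w.re}, ‖Q.T m w n‖ ≤ ‖Q.T m (σ : ℂ) n‖ := fun n w hw =>
    Q.T_norm_anti m m w σ (by rw [Complex.ofReal_re]; exact le_of_lt hw) n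
  have hsU : s ∈ {w : ℂ | σ < w.re} := by change σ < s.re; linarith
  constructor
  · have := Complex.hasSum_deriv_of_summable_norm hu hd (isOp σ) hle hsU
    simp only [(Q.T_hasDeriv m s _).deriv] at this
    exact this
  · exact (Complex.differentiableOn_tsum_of_summable_norm hu hd (isOp σ) hle).differentiableAt ((isOp σ).mem_nhds hsU)

/-- the logarithmic derivative series -/
noncomputable def DD (Λ : Ideal O → ℝ) (m : ℤ) (s : ℂ) : ℂ := ∑' n, (Λ n : ℂ) * Q.T m s n

variable {Q}
lemma IsVM.summable (h : Q.IsVM Λ) (m : ℤ) {s : ℂ} (hs : 1 < s.re) : Summable fun n => (Λ n : ℂ) * Q.T m s n := by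
  refine Summable.of_norm_bounded (Q.L_deriv m hs).1.summable.norm fun n => ?_
  rw [norm_mul, norm_mul, norm_neg, Complex.norm_real, Complex.norm_real, Real.norm_eq_abs, Real.norm_eq_abs,
    abs_of_nonneg (h.nonneg n)]
  exact mul_le_mul_of_nonneg_right ((h.le_log n).trans (le_abs_self _)) (norm_nonneg _)

lemma dvd_bij {n : Ideal O} (hn : n ≠ ⊥) : Function.Bijective
    (fun p : {p : Ideal O × Ideal O // p.1 * p.2 = n} => (⟨p.1.1, p.1.2, p.2.symm⟩ : {a : Ideal O // a ∣ n})) := by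
  constructor
  · rintro ⟨⟨a, b⟩, hab⟩ ⟨⟨a', b'⟩, hab'⟩ hh
    have ha : a = a' := congrArg Subtype.val hh
    subst ha
    have hab1 : a * b = n := hab
    have hab2 : a * b' = n := hab'
    have ha0 : a ≠ 0 := by rintro rfl; rw [zero_mul] at hab1; exact hn hab1.symm
    have : b = b' := mul_left_cancel₀ ha0 (hab1.trans hab2.symm)
    subst this; rfl
  · rintro ⟨a, b, hab⟩; exact ⟨⟨(a, b), hab.symm⟩, rfl⟩

lemma IsVM.fiber (h : Q.IsVM Λ) {n : Ideal O} (hn : n ≠ ⊥) :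
    HasSum (fun p : {p : Ideal O × Ideal O // p.1 * p.2 = n} => Λ p.1.1) (Real.log (Q.gX n)) := by
  classical
  have hc := h.conv n hn
  have hc2 : HasSum (fun a : {a : Ideal O // a ∣ n} => Λ a) (Real.log (Q.gX n)) := by
    refine (hasSum_subtype_iff_indicator (f := Λ) (s := {a : Ideal O | a ∣ n}) (a := Real.log (Q.gX n))).mpr ?_
    have e : Set.indicator {a : Ideal O | a ∣ n} Λ = fun a => if a ∣ n then Λ a else 0 := by
      ext a; rw [Set.indicator_apply]; rfl
    rw [e]; exact hc
  exact ((Equiv.ofBijective _ (dvd_bij hn)).hasSum_iff).mpr hc2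

lemma IsVM.fiber' (h : Q.IsVM Λ) (m : ℤ) (s : ℂ) (n : Ideal O) :
    HasSum (fun p : {p : Ideal O × Ideal O // p.1 * p.2 = n} => (Λ p.1.1 : ℂ) * Q.T m s p.1.1 * Q.T m s p.1.2)
      ((Real.log (Q.gX n) : ℂ) * Q.T m s n) := by
  have e : ∀ p : {p : Ideal O × Ideal O // p.1 * p.2 = n}, (Λ p.1.1 : ℂ) * Q.T m s p.1.1 * Q.T m s p.1.2 = (Λ p.1.1 : ℂ) * Q.T m s n := by
    rintro ⟨p, hp⟩; rw [mul_assoc, ← T_mul, hp]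
  simp only [e]
  by_cases hn : n = ⊥
  · rw [hn]; simp only [T_bot, mul_zero]; exact hasSum_zero
  · apply HasSum.mul_right
    exact Complex.hasSum_ofReal.mpr (h.fiber hn)

lemma IsVM.prod (h : Q.IsVM Λ) (m : ℤ) {s : ℂ} (hs : 1 < s.re) : HasSum (fun p : Ideal O × Ideal O => (Λ p.1 : ℂ) * Q.T m s p.1 * Q.T m s p.2) (Q.DD Λ m s * Q.L m s) := by
  have s1 := h.summable m hs
  have s2 := Q.T_summable m hs
  have s3 := summable_mul_of_summable_norm s1.norm s2.norm
  exact s1.hasSum.mul s2.hasSum s3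
lemma IsVM.L_eq0 (h : Q.IsVM Λ) (m : ℤ) {s : ℂ} (hs : 1 < s.re) : HasSum (fun n => (Real.log (Q.gX n) : ℂ) * Q.T m s n) (Q.DD Λ m s * Q.L m s) := by
  have h1 := ((Equiv.sigmaFiberEquiv fun p : Ideal O × Ideal O => p.1 * p.2).hasSum_iff).mpr (h.prod m hs)
  exact HasSum.sigma h1 (fun n => h.fiber' m s n)
lemma IsVM.L_eq (h : Q.IsVM Λ) (m : ℤ) {s : ℂ} (hs : 1 < s.re) : deriv (Q.L m) s = -Q.DD Λ m s * Q.L m s := by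
  have h3 := (Q.L_deriv m hs).1.neg
  have h4 : (fun n => -(-(Real.log (Q.gX n) : ℂ) * Q.T m s n)) = fun n => (Real.log (Q.gX n) : ℂ) * Q.T m s n := by
    funext n; ring
  rw [h4] at h3
  have := (h.L_eq0 m hs).unique h3
  rw [neg_mul, this, neg_neg]
end QD
end

section
open Complex Set Filter Topology

namespace QD
variable {O : Type} [CommRing O] (Q : QD O) [IsDomain O] [IsPrincipalIdealRing O]
variable {Q} {Λ : Ideal O → ℝ}

lemma IsVM.norm_eq (h : Q.IsVM Λ) (m : ℤ) (s : ℂ) (n : Ideal O) : ‖(Λ n : ℂ) * Q.T m s n‖ = Λ n * ‖Q.T 0 s.re n‖ := by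
  rw [norm_mul, Complex.norm_real, Real.norm_eq_abs, abs_of_nonneg (h.nonneg n)]
  congr 1
  exact le_antisymm (Q.T_norm_anti _ _ _ _ (by simp) n) (Q.T_norm_anti _ _ _ _ (by simp) n)

lemma IsVM.re_ge (h : Q.IsVM Λ) (m : ℤ) {s : ℂ} (hs : 1 < s.re) : 0 ≤ (Q.DD Λ m s).re + (Q.DD Λ 0 s.re).re := by
  have hσ : 1 < ((s.re : ℝ) : ℂ).re := by simpa using hs
  have s1 := (h.summable m hs).norm
  have e1 : ‖Q.DD Λ m s‖ ≤ ∑' n, Λ n * ‖Q.T 0 s.re n‖ := by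
    refine (norm_tsum_le_tsum_norm s1).trans (le_of_eq ?_)
    exact tsum_congr fun n => h.norm_eq m s n
  have e2 : Q.DD Λ 0 s.re = ((∑' n, Λ n * ‖Q.T 0 s.re n‖ : ℝ) : ℂ) := by
    rw [Complex.ofReal_tsum]
    refine tsum_congr fun n => ?_
    rw [Complex.ofReal_mul, ← Q.T_zero_real]
  rw [e2, Complex.ofReal_re]
  have := (abs_le.mp ((Complex.abs_re_le_norm (Q.DD Λ m s)).trans e1)).1
  linarith

lemma L_tendsto (m : ℤ) (t : ℝ) : Tendsto (fun σ : ℝ => Q.L m (σ + t * I)) atTop (𝓝 1) := by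
  classical
  have e : (1 : ℂ) = ∑' n : Ideal O, if n = 1 then (1 : ℂ) else 0 := (tsum_ite_eq (1 : Ideal O) (fun _ => (1 : ℂ))).symm
  rw [e]
  unfold L
  refine tendsto_tsum_of_dominated_convergence (bound := fun n => ‖Q.T 0 2 n‖) (Q.T_summable 0 (s := 2) (by norm_num)).norm ?_ ?_
  · intro n
    by_cases hn : n = 1
    · subst hn; simp only [T_unit, if_true]; exact tendsto_const_nhds
    · rw [if_neg hn]
      by_cases hb : n = ⊥
      · subst hb; simp only [T_bot]; exact tendsto_const_nhds
      · rw [tendsto_zero_iff_norm_tendsto_zero]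
        have : (fun σ : ℝ => ‖Q.T m (σ + t * I) n‖) = fun σ : ℝ => Q.gX n ^ (-σ) := by
          ext σ; rw [T_norm Q _ _ hb]; simp
        rw [this]
        have h2 := Q.gX_gt hb hn
        exact (tendsto_rpow_atBot_of_base_gt_one (Q.gX n) (by linarith)).comp tendsto_neg_atTop_atBot
  · filter_upwards [eventually_ge_atTop (2 : ℝ)] with σ hσ n
    exact Q.T_norm_anti _ _ _ _ (by simpa using hσ) n

lemma IsVM.normsq_deriv (h : Q.IsVM Λ) (m : ℤ) (t : ℝ) {σ : ℝ} (hσ : 1 < σ) :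
    HasDerivAt (fun σ : ℝ => ‖Q.L m (σ + t * I)‖ ^ 2) (-2 * (Q.DD Λ m (σ + t * I)).re * ‖Q.L m (σ + t * I)‖ ^ 2) σ := by
  have hs : 1 < ((σ : ℂ) + t * I).re := by simpa using hσ
  have h1 : HasDerivAt (Q.L m) (-Q.DD Λ m (σ + t * I) * Q.L m (σ + t * I)) (σ + t * I) := by
    rw [← h.L_eq m hs]; exact (Q.L_deriv m hs).2.hasDerivAt
  have h2 : HasDerivAt (fun σ : ℝ => (σ : ℂ) + t * I) 1 σ := (Complex.ofRealCLM.hasDerivAt (x := σ)).add_const _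
  have h3 : HasDerivAt (fun σ : ℝ => Q.L m (σ + t * I)) (-Q.DD Λ m (σ + t * I) * Q.L m (σ + t * I)) σ := by
    have := h1.comp σ h2
    rw [mul_one] at this; exact this
  refine h3.norm_sq.congr_deriv ?_
  rw [Complex.inner]
  rw [← Complex.normSq_eq_norm_sq, Complex.normSq_apply]
  simp
  ring

lemma IsVM.low (h : Q.IsVM Λ) (m : ℤ) (t : ℝ) {σ : ℝ} (hσ : 1 < σ) : 1 ≤ ‖Q.L m (σ + t * I)‖ * ‖Q.L 0 σ‖ := by
  set g : ℝ → ℝ := fun σ => ‖Q.L m (σ + t * I)‖ ^ 2 * ‖Q.L 0 (σ + (0 : ℝ) * I)‖ ^ 2 with hg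
  have hd : ∀ x : ℝ, 1 < x → HasDerivAt g (-2 * ((Q.DD Λ m (x + t * I)).re + (Q.DD Λ 0 (x + (0 : ℝ) * I)).re) * g x) x := by
    intro x hx
    refine ((h.normsq_deriv m t hx).mul (h.normsq_deriv 0 0 hx)).congr_deriv ?_
    simp only [hg]; ring
  have hanti : AntitoneOn g (Ioi 1) := by
    apply antitoneOn_of_deriv_nonpos (convex_Ioi 1)
    · exact fun x hx => (hd x hx).continuousAt.continuousWithinAt
    · rw [interior_Ioi]; exact fun x hx => (hd x hx).differentiableAt.differentiableWithinAt
    · rw [interior_Ioi]; intro x hx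
      rw [(hd x hx).deriv]
      have hs : 1 < ((x : ℂ) + t * I).re := by simpa using hx
      have h1 := h.re_ge m hs
      have h2 : (((((x : ℂ) + t * I).re : ℝ) : ℂ)) = x + (0 : ℝ) * I := by simp
      rw [h2] at h1
      have h3 : 0 ≤ g x := by simp only [hg]; positivity
      nlinarith [mul_nonneg h1 h3]
  have hlim : Tendsto g atTop (𝓝 1) := by
    have := ((L_tendsto (Q := Q) m t).norm.pow 2).mul ((L_tendsto (Q := Q) 0 0).norm.pow 2)
    rw [norm_one, one_pow, mul_one] at this
    exact this
  have h1 : 1 ≤ g σ := by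
    refine le_of_tendsto hlim ?_
    filter_upwards [eventually_ge_atTop σ] with x hx
    exact hanti hσ (lt_of_lt_of_le hσ hx) hx
  simp only [hg, Complex.ofReal_zero, zero_mul, add_zero] at h1
  rw [← mul_pow] at h1
  by_contra hc
  push Not at hc
  have : (‖Q.L m (σ + t * I)‖ * ‖Q.L 0 σ‖) ^ 2 < 1 := by
    apply pow_lt_one₀ (by positivity) hc (by norm_num)
  linarith

lemma IsVM.Dser_eq (h : Q.IsVM Λ) (m : ℤ) (s : ℂ) :
    Dser (fun n => max 1 (Q.gX n)) (fun n => Q.y (gen n)) Λ m s = Q.DD Λ m s := by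
  unfold Dser DD
  refine tsum_congr fun n => ?_
  by_cases hn : n = ⊥
  · subst hn; rw [h.bot]; simp
  · have h1 := Q.gX_ge hn
    simp only []
    rw [max_eq_right h1, T_of_ne Q m s hn, mul_assoc]
    congr 1
    rw [Complex.cpow_def_of_ne_zero (by exact_mod_cast (by linarith : Q.gX n ≠ 0)), ← Complex.exp_add, Complex.ofReal_log (by linarith)]
    congr 1
    push_cast; ring

lemma IsVM.exists_hecke (h : Q.IsVM Λ) (hy : ∀ m : ℤ, m ≠ 0 → ∃ α : O, α ≠ 0 ∧ Q.hh α m 1 ≠ 0)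
    {r : ℂ} (hr : r ≠ 0) (hres : Tendsto (fun σ : ℝ => ((σ : ℂ) - 1) * Q.L 0 σ) (𝓝[>] 1) (𝓝 r)) :
    ∃ H : HeckeData (Ideal O), H.X = (fun n => max 1 (Q.gX n)) ∧ H.y = (fun n => Q.y (gen n)) ∧ H.Lam = Λ := by
  obtain ⟨Z, hZd, hZ, B, hB, hZb⟩ := Q.exists_Z_growth hy
  refine ⟨{ X := fun n => max 1 (Q.gX n), y := fun n => Q.y (gen n), Lam := Λ, hX := fun n => le_max_left _ _,
            hLam := h.nonneg, hsum := ?_, Z := Z, hZd := hZd, A := 2, B := B, hA := by norm_num, hB := hB, hZb := hZb, 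
            hZeq := ?_, c0 := 1 / (16 * (B + 1)), hc0 := by positivity, hZlow := ?_, hZ0 := ?_ }, rfl, rfl, rfl⟩
  · intro σ hσ
    refine ((h.summable 0 (s := (σ : ℂ)) (by simpa using hσ)).norm).congr fun n => ?_
    rw [h.norm_eq]
    by_cases hn : n = ⊥
    · subst hn; rw [h.bot]; simp
    · rw [T_norm Q _ _ hn, max_eq_right (Q.gX_ge hn)]; simp
  · intro m s hs
    rw [h.Dser_eq]
    have hL : HasDerivAt (Q.L m) (-Q.DD Λ m s * Q.L m s) s := by
      rw [← h.L_eq m hs]; exact (Q.L_deriv m hs).2.hasDerivAt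
    have hev : Z m =ᶠ[𝓝 s] fun s => (if m = 0 then s - 1 else 1) * (2 * Q.L m s) := by
      filter_upwards [(isOp 1).mem_nhds hs] with w hw
      exact hZ m w hw
    rw [hev.deriv_eq, hZ m s hs]
    have hs1 : s - 1 ≠ 0 := by
      intro hc; rw [sub_eq_zero] at hc; rw [hc] at hs; simp at hs
    by_cases hm : m = 0
    · simp only [hm, if_true] at hL ⊢
      have hd : HasDerivAt (fun s => (s - 1) * (2 * Q.L 0 s)) (1 * (2 * Q.L 0 s) + (s - 1) * (2 * (-Q.DD Λ 0 s * Q.L 0 s))) s :=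
        ((hasDerivAt_id s).sub_const 1).mul (hL.const_mul 2)
      rw [hd.deriv]
      field_simp
      ring
    · simp only [hm, if_false]
      simp only [one_mul, add_zero]
      rw [(hL.const_mul 2).deriv]; ring
  · intro m s hs hs3
    have hlow := h.low m s.im hs
    have e : (s.re : ℂ) + s.im * I = s := Complex.re_add_im s
    rw [e] at hlow
    have hp : 0 < s.re - 1 := by linarith
    have hb := hZb 0 (s.re : ℂ) (by simp; linarith) (by simp; linarith)
    rw [hZ 0 _ (by simpa using hs)] at hb
    simp only [if_true, Complex.ofReal_im, abs_zero, Int.cast_zero, add_zero] at hb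
    have e2 : (s.re : ℂ) - 1 = ((s.re - 1 : ℝ) : ℂ) := by push_cast; ring
    rw [norm_mul, norm_mul, e2, Complex.norm_real, Real.norm_eq_abs, abs_of_pos hp] at hb
    norm_num at hb
    -- ‖L0‖ (σ-1) ≤ 2B
    set a := ‖Q.L m s‖
    set b := ‖Q.L 0 (s.re : ℂ)‖
    have ha : 0 ≤ a := norm_nonneg _
    have h1 : (s.re - 1) ≤ a * (2 * B) := by nlinarith
    have h2 : (s.re - 1) / (2 * (B + 1)) ≤ a := by
      rw [div_le_iff₀ (by positivity)]; nlinarith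
    rw [hZ m s hs, norm_mul, norm_mul]
    have h3 : 1 / (16 * (B + 1)) * (s.re - 1) ^ 2 ≤ (s.re - 1) * ((s.re - 1) / (2 * (B + 1))) / 2 := by
      have : 1 / (16 * (B + 1)) * (s.re - 1) ^ 2 = (s.re - 1) * ((s.re - 1) / (2 * (B + 1))) / 8 := by field_simp; ring
      rw [this]
      have : 0 ≤ (s.re - 1) * ((s.re - 1) / (2 * (B + 1))) := by positivity
      linarith
    by_cases hm : m = 0
    · simp only [hm, if_true]
      have h4 : s.re - 1 ≤ ‖s - 1‖ := by
        have := Complex.re_le_norm (s - 1); simpa using this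
      have : (s.re - 1) * ((s.re - 1) / (2 * (B + 1))) ≤ ‖s - 1‖ * a := mul_le_mul h4 h2 (by positivity) (norm_nonneg _)
      simp only [a, hm] at this
      rw [Complex.norm_two]
      have h0 : 0 ≤ (s.re - 1) * ((s.re - 1) / (2 * (B + 1))) := by positivity
      linarith
    · simp only [hm, if_false]
      rw [Complex.norm_two, norm_one, one_mul]
      have : (s.re - 1) * ((s.re - 1) / (2 * (B + 1))) ≤ 2 * a := mul_le_mul (by linarith) h2 (by positivity) (by norm_num)
      have h0 : 0 ≤ (s.re - 1) * ((s.re - 1) / (2 * (B + 1))) := by positivity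
      linarith
  · have hc : ContinuousAt (Z 0) 1 := ((hZd 0).differentiableAt ((isOp (1/2)).mem_nhds (by simp; norm_num))).continuousAt
    have h1 : Tendsto (fun σ : ℝ => Z 0 (σ : ℂ)) (𝓝[>] 1) (𝓝 (Z 0 1)) := by
      have : Tendsto (fun σ : ℝ => (σ : ℂ)) (𝓝[>] 1) (𝓝 ((1 : ℝ) : ℂ)) :=
        (Complex.continuous_ofReal.tendsto 1).mono_left nhdsWithin_le_nhds
      rw [Complex.ofReal_one] at this
      exact hc.tendsto.comp this
    have h2 : Tendsto (fun σ : ℝ => Z 0 (σ : ℂ)) (𝓝[>] 1) (𝓝 (2 * r)) := by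
      refine (hres.const_mul 2).congr' ?_
      filter_upwards [self_mem_nhdsWithin] with σ hσ
      rw [hZ 0 _ (by simpa using hσ)]
      simp only [if_true]; ring
    rw [tendsto_nhds_unique h1 h2]
    exact mul_ne_zero two_ne_zero hr
end QD
end

section
open Complex Set Filter Topology

namespace QD
variable {O : Type} [CommRing O] (Q : QD O) [IsDomain O] [IsPrincipalIdealRing O]

lemma hker_summable {C : ℕ} (hC : 0 < C) {l x : ℝ} (hl : 0 < l) (hx : 0 ≤ x) (y : ℝ) : Summable fun j : ℤ => hker C l x (y + j) := by
  refine Summable.of_nonneg_of_le (fun j => hker_nonneg hx) (fun j => (hker_le hC hl hx).trans ?_)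
    ((summable_exp_neg_abs_int (κ := 2 * l) (by linarith)).mul_left (Real.pi * x * Real.exp (2 * l * |y|)))
  rw [mul_assoc (Real.pi * x), ← Real.exp_add]
  apply mul_le_mul_of_nonneg_left _ (by positivity)
  apply Real.exp_le_exp.mpr
  have : |(j : ℝ)| ≤ |y + j| + |y| := by
    have := abs_sub (y + j) y
    rwa [add_sub_cancel_left] at this
  nlinarith

lemma fwt_prod {C : ℕ} {N : ℝ} (hN : 0 < N) {g : O} (hg : g ≠ 0) :
    fwt C (Q.s1 g / Real.sqrt N) * fwt C (Q.s2 g / Real.sqrt N) = hker C Q.l (Q.X g / N) (Q.y g) := by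
  have hl := Q.hl
  have e : ∀ x, fwt C x = phi C (x ^ 2) := fun x => rfl
  have h2 : 2 * Q.l * Q.y g = Q.la g - Q.lb g := by unfold y; field_simp
  rw [e, e, hker, h2, div_pow, div_pow, Real.sq_sqrt hN.le]
  congr 2
  · rw [Real.exp_sub, Q.exp_la hg, Q.exp_lb hg, ← sq_abs, X]
    have := Q.s2_pos hg
    field_simp
  · rw [neg_sub, Real.exp_sub, Q.exp_la hg, Q.exp_lb hg, ← sq_abs, X]
    have := Q.s1_pos hg
    field_simp

open Classical in
lemma psi_eq {C : ℕ} (hC : 0 < C) {N : ℝ} (hN : 0 < N) {n : Ideal O} (hn : n ≠ ⊥) :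
    (∑' k : O, if Ideal.span {k} = n then fwt C (Q.s1 k / Real.sqrt N) * fwt C (Q.s2 k / Real.sqrt N) else 0)
      = 2 * ∑' j : ℤ, hker C Q.l (Q.gX n / N) (Q.y (gen n) + j) := by
  have hg := gen_ne hn
  have hX : 0 ≤ Q.gX n / N := div_nonneg (by linarith [Q.gX_ge hn]) hN.le
  have hs := (hker_summable hC Q.hl hX (Q.y (gen n))).hasSum
  have h1 := Q.hasSum_fib hg (F := fun k => fwt C (Q.s1 k / Real.sqrt N) * fwt C (Q.s2 k / Real.sqrt N))
    (fun t => by rw [Q.fwt_prod hN (Q.fib_ne hg t), Q.fib_X, Q.fib_y hg]; rfl) hs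
  rw [span_gen] at h1
  have h2 := (hasSum_subtype_iff_indicator (f := fun k : O => fwt C (Q.s1 k / Real.sqrt N) * fwt C (Q.s2 k / Real.sqrt N)) (s := {k : O | Ideal.span {k} = n})).mp h1
  rw [two_mul, ← h2.tsum_eq]
  refine tsum_congr fun k => ?_
  simp only [Set.indicator, mem_ofPred_eq]

end QD
end

section
open Complex Set Filter Topology NumberField

section
variable (K : Subfield ℝ) [NumberField K] (σ₂ : K →+* ℝ)

lemma nf_norm (hdeg : Module.finrank ℚ K = 2) (a : K) (ha : σ₂ a ≠ (a : ℝ)) (x : K) :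
    ((Algebra.norm ℚ x : ℚ) : ℝ) = (x : ℝ) * σ₂ x := by
  classical
  let φ1 : K →ₐ[ℚ] ℂ := (Complex.ofRealHom.comp K.subtype).toRatAlgHom
  let φ2 : K →ₐ[ℚ] ℂ := (Complex.ofRealHom.comp σ₂).toRatAlgHom
  have h1 : ∀ x, φ1 x = ((x : ℝ) : ℂ) := fun x => rfl
  have h2 : ∀ x, φ2 x = (σ₂ x : ℂ) := fun x => rfl
  have hne : φ1 ≠ φ2 := by
    intro h
    have := DFunLike.congr_fun h a
    rw [h1, h2] at this
    exact ha (by exact_mod_cast this.symm)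
  have hcard : Fintype.card (K →ₐ[ℚ] ℂ) = 2 := by rw [AlgHom.card, hdeg]
  have huniv : (Finset.univ : Finset (K →ₐ[ℚ] ℂ)) = {φ1, φ2} := by
    symm
    apply Finset.eq_univ_of_card
    rw [hcard, Finset.card_pair hne]
  have h := Algebra.norm_eq_prod_embeddings ℚ ℂ x
  rw [huniv, Finset.prod_pair hne, h1, h2] at h
  have : ((((Algebra.norm ℚ x : ℚ) : ℝ)) : ℂ) = (((x : ℝ) * σ₂ x : ℝ) : ℂ) := by
    push_cast
    exact h
  exact_mod_cast this

lemma nf_absNorm (hdeg : Module.finrank ℚ K = 2) (a : K) (ha : σ₂ a ≠ (a : ℝ)) (k : 𝓞 K) :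
    (Ideal.absNorm (Ideal.span {k}) : ℝ) = |((k : K) : ℝ)| * |σ₂ k| := by
  rw [Ideal.absNorm_span_singleton, ← abs_mul, ← nf_norm K σ₂ hdeg a ha, ← Algebra.coe_norm_int]
  rw [Nat.cast_natAbs]; push_cast; rfl

lemma nf_one_le (hdeg : Module.finrank ℚ K = 2) (a : K) (ha : σ₂ a ≠ (a : ℝ)) (k : 𝓞 K) (hk : k ≠ 0) :
    1 ≤ |((k : K) : ℝ)| * |σ₂ k| := by
  rw [← nf_absNorm K σ₂ hdeg a ha]
  have : Ideal.absNorm (Ideal.span {k}) ≠ 0 := by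
    rw [Ne, Ideal.absNorm_eq_zero_iff, Ideal.span_singleton_eq_bot]; exact hk
  exact_mod_cast Nat.one_le_iff_ne_zero.mpr this

lemma nf_summable (hdeg : Module.finrank ℚ K = 2) (a : K) (ha : σ₂ a ≠ (a : ℝ)) (p : ℝ) (hp : 2 < p) :
    Summable fun k : 𝓞 K => (1 + max |((k : K) : ℝ)| |σ₂ k|) ^ (-p) := by
  let f1 : 𝓞 K →+* ℝ := K.subtype.comp (algebraMap (𝓞 K) K)
  let f2 : 𝓞 K →+* ℝ := σ₂.comp (algebraMap (𝓞 K) K)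
  let φ : 𝓞 K →ₗ[ℤ] ℝ × ℝ := (f1.prod f2).toAddMonoidHom.toIntLinearMap
  have hφ : ∀ k, φ k = (((k : K) : ℝ), σ₂ k) := fun k => rfl
  have hn : ∀ k, ‖φ k‖ = max |((k : K) : ℝ)| |σ₂ k| := by
    intro k; rw [hφ, Prod.norm_def, Real.norm_eq_abs, Real.norm_eq_abs]
  have hn1 : ∀ k, k ≠ 0 → 1 ≤ ‖φ k‖ := by
    intro k hk
    rw [hn]
    by_contra hc
    push Not at hc
    have h1 := nf_one_le K σ₂ hdeg a ha k hk
    have h2 := lt_of_le_of_lt (le_max_left _ _) hc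
    have h3 := lt_of_le_of_lt (le_max_right _ _) hc
    nlinarith [abs_nonneg ((k : K) : ℝ), abs_nonneg (σ₂ k)]
  have hinj : Function.Injective φ := by
    rw [← LinearMap.ker_eq_bot, LinearMap.ker_eq_bot']
    intro k hk
    by_contra h0
    have := hn1 k h0
    rw [hk, norm_zero] at this; linarith
  let Lt : Submodule ℤ (ℝ × ℝ) := LinearMap.range φ
  have hdisc : DiscreteTopology Lt := by
    apply discreteTopology_of_isOpen_singleton_zero
    rw [Metric.isOpen_singleton_iff]
    refine ⟨1, one_pos, ?_⟩
    rintro ⟨y, k, rfl⟩ hy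
    by_contra h0
    have hk : k ≠ 0 := by
      rintro rfl; apply h0; ext1; simp
    have := hn1 k hk
    rw [dist_zero_right] at hy
    have e : ‖(⟨φ k, k, rfl⟩ : Lt)‖ = ‖φ k‖ := rfl
    rw [e] at hy; linarith
  let e : 𝓞 K ≃ₗ[ℤ] Lt := LinearEquiv.ofInjective φ hinj
  have hr : Module.finrank ℤ Lt = 2 := by
    rw [← e.finrank_eq, RingOfIntegers.rank, hdeg]
  have hs := ZLattice.summable_norm_rpow Lt (-p) (by rw [hr]; push_cast; linarith)
  have hs2 := (e.toEquiv.summable_iff (f := fun z : Lt => ‖z‖ ^ (-p))).mpr hs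
  refine (Summable.of_norm_bounded_eventually hs2 ?_)
  rw [Filter.eventually_cofinite]
  refine (Set.finite_singleton (0 : 𝓞 K)).subset ?_
  intro k hk
  by_contra h0
  apply hk
  have h1 := hn1 k h0
  have e1 : ((fun z : Lt => ‖z‖ ^ (-p)) ∘ e.toEquiv) k = ‖φ k‖ ^ (-p) := rfl
  rw [e1, ← hn, Real.norm_eq_abs, abs_of_nonneg (by positivity)]
  exact Real.rpow_le_rpow_of_nonpos (by linarith) (by linarith) (by linarith)
end
end

section
open Complex Set Filter Topology NumberField

section
variable (K : Subfield ℝ) [NumberField K]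

/-- The quadratic data attached to the ring of integers. -/
noncomputable def nfQD (σ₂ : K →+* ℝ) (hdeg : Module.finrank ℚ K = 2) (a : K) (ha : σ₂ a ≠ (a : ℝ))
    (ϵ : (𝓞 K)ˣ) (hϵ1 : 1 < (((ϵ : 𝓞 K) : K) : ℝ))
    (hϵgen : ∀ u : (𝓞 K)ˣ, ∃ n : ℤ, u = ϵ ^ n ∨ u = -ϵ ^ n) : QD (𝓞 K) where
  s1 := K.subtype.comp (algebraMap (𝓞 K) K)
  s2 := σ₂.comp (algebraMap (𝓞 K) K)
  l := Real.log (((ϵ : 𝓞 K) : K) : ℝ)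
  hl := Real.log_pos hϵ1
  h1 := fun k hk => nf_one_le K σ₂ hdeg a ha k hk
  hsum := fun p hp => nf_summable K σ₂ hdeg a ha p hp
  hcard := fun k _ => nf_absNorm K σ₂ hdeg a ha k
  ε := ϵ
  hε1 := by
    rw [Real.exp_log (by linarith)]
    exact abs_of_pos (lt_trans one_pos hϵ1)
  hε2 := by
    rw [Real.exp_neg, Real.exp_log (by linarith)]
    have h := nf_absNorm K σ₂ hdeg a ha (ϵ : 𝓞 K)
    have hu : Ideal.span {(ϵ : 𝓞 K)} = ⊤ := Ideal.span_singleton_eq_top.mpr ϵ.isUnit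
    rw [hu, Ideal.absNorm_top, abs_of_pos (lt_trans one_pos hϵ1)] at h
    apply eq_inv_of_mul_eq_one_right
    push_cast at h
    exact h.symm
  hgen := hϵgen

lemma nf_countable (Q : QD (𝓞 K)) : Countable (𝓞 K) := by
  have h := (Q.hsum 3 (by norm_num)).countable_support
  have : Function.support (fun k : 𝓞 K => (1 + max |Q.s1 k| |Q.s2 k|) ^ (-3 : ℝ)) = univ := by
    ext k
    simp only [Function.mem_support, mem_univ, iff_true]
    have : 0 < 1 + max |Q.s1 k| |Q.s2 k| := by
      have := le_max_left |Q.s1 k| |Q.s2 k|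
      have := abs_nonneg (Q.s1 k)
      linarith
    exact (Real.rpow_pos_of_pos this _).ne'
  rw [this] at h
  exact countable_univ_iff.mp h

variable [IsPrincipalIdealRing (𝓞 K)]

lemma nf_countable_ideal (Q : QD (𝓞 K)) : Countable (Ideal (𝓞 K)) := by
  have := nf_countable K Q
  refine Function.Injective.countable (f := fun n : Ideal (𝓞 K) => QD.gen n) fun a b h => ?_
  rw [← QD.span_gen a, ← QD.span_gen b]
  simp only at h
  rw [h]

variable (Q : QD (𝓞 K))

lemma nf_gX {n : Ideal (𝓞 K)} (hn : n ≠ ⊥) : Q.gX n = Ideal.absNorm n := by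
  have h := Q.hcard _ (QD.gen_ne hn)
  rw [QD.span_gen] at h
  exact h.symm

lemma nf_isVM : Q.IsVM (LambdaIdeal K) where
  h1 := by
    intro p k hp hk
    have h : ∃ q : Ideal (𝓞 K), (∃ j : ℕ, 1 ≤ j ∧ p ^ k = q ^ j) ∧ q.IsPrime ∧ q ≠ ⊥ :=
      ⟨p, ⟨k, hk, rfl⟩, Ideal.isPrime_of_prime hp, hp.ne_zero⟩
    unfold LambdaIdeal
    rw [dif_pos h]
    obtain ⟨⟨j, hj, he⟩, hq, hq0⟩ := h.choose_spec
    have hqp : Prime h.choose := Ideal.prime_of_isPrime hq0 hq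
    have hd : p ∣ h.choose := by
      apply hp.dvd_of_dvd_pow (n := j)
      rw [← he]
      exact dvd_pow_self p (by omega)
    have : p = h.choose := associated_iff_eq.mp (hp.associated_of_dvd hqp hd)
    rw [← this, nf_gX K Q hp.ne_zero]
  h0 := by
    intro n hn
    unfold LambdaIdeal
    rw [dif_neg]
    rintro ⟨p, ⟨k, hk, he⟩, hp, hp0⟩
    exact hn ⟨p, k, Ideal.prime_of_isPrime hp0 hp, hk, he⟩

lemma nf_L {s : ℂ} (hs : 1 < s.re) : Q.L 0 s = dedekindZeta K s := by
  have h := (Q.T_summable 0 hs).hasSum.tsum_fiberwise (fun n : Ideal (𝓞 K) => Ideal.absNorm n)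
  rw [QD.L, ← h.tsum_eq, dedekindZeta, LSeries]
  refine tsum_congr fun n => ?_
  by_cases hn : n = 0
  · subst hn
    rw [LSeries.term_zero]
    convert tsum_zero with b
    have hb : Ideal.absNorm (b : Ideal (𝓞 K)) = 0 := b.2
    rw [Ideal.absNorm_eq_zero_iff] at hb
    rw [hb, QD.T_bot]
  · rw [LSeries.term_of_ne_zero hn]
    have h1 : ∀ b : ((fun n : Ideal (𝓞 K) => Ideal.absNorm n) ⁻¹' {n}), Q.T 0 s b = (n : ℂ) ^ (-s) := by
      intro b
      have hb : Ideal.absNorm (b : Ideal (𝓞 K)) = n := b.2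
      have hb0 : (b : Ideal (𝓞 K)) ≠ ⊥ := by
        rintro hc; rw [hc, Ideal.absNorm_bot] at hb; exact hn hb.symm
      rw [QD.T_of_ne Q _ _ hb0, nf_gX K Q hb0, hb, Complex.cpow_def_of_ne_zero (by exact_mod_cast hn)]
      congr 1
      rw [← Complex.ofReal_natCast, ← Complex.ofReal_log (by positivity)]
      simp; ring
    rw [tsum_congr h1, tsum_const, Complex.cpow_neg, nsmul_eq_mul, div_eq_mul_inv]
    rfl

lemma nf_res : Tendsto (fun σ : ℝ => ((σ : ℂ) - 1) * Q.L 0 σ) (𝓝[>] 1) (𝓝 ((dedekindZeta_residue K : ℝ) : ℂ)) := by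
  refine (tendsto_sub_one_mul_dedekindZeta_nhdsGT K).congr' ?_
  filter_upwards [self_mem_nhdsWithin] with σ hσ
  rw [nf_L K Q (by simpa using hσ)]

lemma nf_hy (d : ℝ) (hd : 1 < d) (sq : 𝓞 K) (h1 : Q.s1 sq = d) (h2 : Q.s2 sq = -d) (m : ℤ) (hm : m ≠ 0) :
    ∃ α : 𝓞 K, α ≠ 0 ∧ Q.hh α m 1 ≠ 0 := by
  have hl := Q.hl
  have hm0 : 0 < |(m : ℝ)| := abs_pos.mpr (by exact_mod_cast hm)
  obtain ⟨n, hn⟩ := exists_nat_gt (d + |(m : ℝ)| * d / Q.l)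
  have hpos : 0 < |(m : ℝ)| * d / Q.l := by positivity
  have hnd : 0 < (n : ℝ) - d := by linarith
  have e1 : Q.s1 ((n : 𝓞 K) + sq) = n + d := by rw [map_add, map_natCast, h1]
  have e2 : Q.s2 ((n : 𝓞 K) + sq) = n - d := by rw [map_add, map_natCast, h2]; ring
  have hy0 : 0 < Q.y ((n : 𝓞 K) + sq) := by
    unfold QD.y QD.la QD.lb
    rw [e1, e2, abs_of_pos hnd, abs_of_pos (by linarith)]
    apply div_pos _ (by linarith)
    rw [sub_pos]
    exact Real.log_lt_log hnd (by linarith)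
  have hy1 : |(m : ℝ)| * Q.y ((n : 𝓞 K) + sq) < 1 := by
    unfold QD.y QD.la QD.lb
    rw [e1, e2, abs_of_pos hnd, abs_of_pos (by linarith : 0 < (n : ℝ) + d), ← Real.log_div (by linarith) (by linarith)]
    have h3 : Real.log ((n + d) / (n - d)) ≤ 2 * d / (n - d) := by
      have := Real.log_le_sub_one_of_pos (x := (n + d) / (n - d)) (div_pos (by linarith) hnd)
      have e : ((n : ℝ) + d) / (n - d) - 1 = 2 * d / (n - d) := by field_simp; ring
      linarith
    have h4 : |(m : ℝ)| * (Real.log ((n + d) / (n - d)) / (2 * Q.l)) ≤ |(m : ℝ)| * ((2 * d / (n - d)) / (2 * Q.l)) := by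
      apply mul_le_mul_of_nonneg_left _ hm0.le
      exact div_le_div_of_nonneg_right h3 (by linarith)
    have h5 : |(m : ℝ)| * ((2 * d / (n - d)) / (2 * Q.l)) = (|(m : ℝ)| * d / Q.l) / (n - d) := by field_simp
    have h6 : (|(m : ℝ)| * d / Q.l) / (n - d) < 1 := by
      rw [div_lt_one hnd]; linarith
    linarith
  refine ⟨(n : 𝓞 K) + sq, ?_, ?_⟩
  · intro h0
    rw [h0, map_zero] at e1; linarith
  · unfold QD.hh
    rw [sub_self, zero_mul, add_zero]
    intro hc
    have hc1 : cexp ((2 * Real.pi * m * Q.y ((n : 𝓞 K) + sq) : ℝ) * I) = 1 := (sub_eq_zero.mp hc).symm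
    rw [Complex.exp_eq_one_iff] at hc1
    obtain ⟨j, hj⟩ := hc1
    have hj2 : (m : ℝ) * Q.y ((n : 𝓞 K) + sq) = j := by
      have := congrArg Complex.im hj
      simp at this
      have hpi := Real.pi_pos
      have h3 : 2 * Real.pi * ((m : ℝ) * Q.y ((n : 𝓞 K) + sq) - j) = 0 := by linarith
      rcases mul_eq_zero.mp h3 with h | h
      · linarith
      · linarith
    have ha : |(j : ℝ)| = |(m : ℝ)| * Q.y ((n : 𝓞 K) + sq) := by rw [← hj2, abs_mul, abs_of_pos hy0]
    have hb : |(j : ℝ)| < 1 := by rw [ha]; exact hy1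
    have hc : 0 < |(j : ℝ)| := by rw [ha]; positivity
    have hj0 : j ≠ 0 := by rintro rfl; simp at hc
    have := Int.one_le_abs hj0
    have : (1 : ℝ) ≤ |(j : ℝ)| := by exact_mod_cast this
    linarith
end

theorem lambda_psi_asymptotic_aux
    (d : ℕ) (hd : 1 < d) (hdsq : Squarefree d) (hd4 : d % 4 = 3)
    (K : Subfield ℝ) [NumberField K]
    (hdeg : Module.finrank ℚ K = 2)
    (sq : 𝓞 K) (hsq : ((sq : K) : ℝ) = Real.sqrt d)
    (hclass : NumberField.classNumber K = 1)
    (σ₂ : K →+* ℝ) (hσ₂ : σ₂ (sq : K) = -Real.sqrt d)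
    (C : ℕ) (hC : 0 < C)
    (ϵ : (𝓞 K)ˣ) (hϵ1 : 1 < (((ϵ : 𝓞 K) : K) : ℝ))
    (hϵgen : ∀ u : (𝓞 K)ˣ, ∃ n : ℤ, u = ϵ ^ n ∨ u = -ϵ ^ n) :
    0 < sieveConst C (((ϵ : 𝓞 K) : K) : ℝ) ∧
    ∃ ε₀ : ℝ, 0 < ε₀ ∧ ∃ M : ℝ, ∃ N₀ : ℝ, ∀ N : ℝ, N₀ ≤ N →
      |(∑' n : Ideal (𝓞 K), if n ≠ ⊥ then LambdaIdeal K n * PsiW K σ₂ C N n else 0) -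
          sieveConst C (((ϵ : 𝓞 K) : K) : ℝ) * N|
        ≤ M * N ^ (1 - ε₀ / Real.log (Real.log N)) := by
  have hd1 : 1 < Real.sqrt d := by
    rw [Real.lt_sqrt (by norm_num)]; simp; exact_mod_cast hd
  have ha : σ₂ (sq : K) ≠ ((sq : K) : ℝ) := by rw [hsq, hσ₂]; intro h; linarith
  have hPID : IsPrincipalIdealRing (𝓞 K) := classNumber_eq_one_iff.mp hclass
  set Q := nfQD K σ₂ hdeg (sq : K) ha ϵ hϵ1 hϵgen with hQ
  have hl : Q.l = Real.log (((ϵ : 𝓞 K) : K) : ℝ) := rfl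
  have hE : (((ϵ : 𝓞 K) : K) : ℝ) = Real.exp Q.l := by rw [hl, Real.exp_log (by linarith)]
  rw [hE]
  refine ⟨sieveConst_pos hC Q.hl, ?_⟩
  have hVM := nf_isVM K Q
  have hr : ((dedekindZeta_residue K : ℝ) : ℂ) ≠ 0 := by exact_mod_cast dedekindZeta_residue_ne_zero K
  obtain ⟨H, hX, hy, hLam⟩ := hVM.exists_hecke (nf_hy K Q (Real.sqrt d) hd1 sq hsq hσ₂) hr (nf_res K Q)
  have hcount := nf_countable_ideal K Q
  obtain ⟨ε₀, hε, M, N₀, hN⟩ := H.asymptotic hC Q.hl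
  refine ⟨ε₀, hε, M, max N₀ 1, fun N hN1 => ?_⟩
  have hNpos : 0 < N := lt_of_lt_of_le one_pos ((le_max_right _ _).trans hN1)
  have h := hN N ((le_max_left _ _).trans hN1)
  have e : (∑' n : Ideal (𝓞 K), if n ≠ ⊥ then LambdaIdeal K n * PsiW K σ₂ C N n else 0) = H.S C Q.l N := by
    unfold HeckeData.S
    refine tsum_congr fun n => ?_
    rw [hX, hy, hLam]
    by_cases hn : n = ⊥
    · subst hn; rw [hVM.bot]; simp
    · rw [if_pos hn]
      simp only []
      rw [max_eq_right (Q.gX_ge hn), ← Q.psi_eq hC hNpos hn]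
      rfl
  rw [e]
  exact h
end

/-- **Asymptotic evaluation of `∑ Λ(𝔫) Ψ(𝔫)` in real quadratic fields of class number
one:** the constant `c = sieveConst` is positive and there is `ε₀ > 0` with
`∑_{𝔫∈ℐ} Λ(𝔫)Ψ(𝔫) = cN + O(N^{1−ε₀/log log N})` as `N → ∞`. -/
theorem lambda_psi_asymptotic
    (d : ℕ) (hd : 1 < d) (hdsq : Squarefree d) (hd4 : d % 4 = 3)
    (K : Subfield ℝ) [NumberField K]
    (hdeg : Module.finrank ℚ K = 2)
    (sq : 𝓞 K) (hsq : ((sq : K) : ℝ) = Real.sqrt d)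
    (hclass : NumberField.classNumber K = 1)
    (σ₂ : K →+* ℝ) (hσ₂ : σ₂ (sq : K) = -Real.sqrt d)
    (C : ℕ) (hC : 0 < C)
    (ϵ : (𝓞 K)ˣ) (hϵ1 : 1 < (((ϵ : 𝓞 K) : K) : ℝ))
    (hϵgen : ∀ u : (𝓞 K)ˣ, ∃ n : ℤ, u = ϵ ^ n ∨ u = -ϵ ^ n) :
    0 < sieveConst C (((ϵ : 𝓞 K) : K) : ℝ) ∧
    ∃ ε₀ : ℝ, 0 < ε₀ ∧ ∃ M : ℝ, ∃ N₀ : ℝ, ∀ N : ℝ, N₀ ≤ N →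
      |(∑' n : Ideal (𝓞 K), if n ≠ ⊥ then LambdaIdeal K n * PsiW K σ₂ C N n else 0) -
          sieveConst C (((ϵ : 𝓞 K) : K) : ℝ) * N|
        ≤ M * N ^ (1 - ε₀ / Real.log (Real.log N)) := by
  exact lambda_psi_asymptotic_aux d hd hdsq hd4 K hdeg sq hsq hclass σ₂ hσ₂ C hC ϵ hϵ1 hϵgen
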